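/- arXiv:2305.18053 — 2 statements merged into one kernel-verified Lean document; each statement's English description precedes it below -/
import Mathlib

section
/- Let d ≥ 2 and let E ⊆ ℝ^d be a Borel set with Hausdorff dimension dim(E) > (2d+1)/3. Then the diagonal distance set Δ°^diag(E) has non-empty interior in ℝ. -/
open MeasureTheory
open scoped ENNReal

open MeasureTheory
open scoped ENNReal
set_option autoImplicit false

namespace DD

/-- dyadic index of a point at level `n` -/
noncomputable def q {d : ℕ} (n : ℕ) (x : EuclideanSpace ℝ (Fin d)) : Fin d → ℤ := fun i => ⌊(2 : ℝ) ^ n * x i⌋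

def par {d : ℕ} (k : Fin d → ℤ) : Fin d → ℤ := fun i => k i / 2

lemma par_q {d : ℕ} (n : ℕ) (x : EuclideanSpace ℝ (Fin d)) : par (q (n + 1) x) = q n x := by
  funext i
  simp only [par, q]
  symm
  rw [Int.floor_eq_iff]
  have h1 := Int.floor_le ((2 : ℝ) ^ (n + 1) * x i)
  have h2 := Int.lt_floor_add_one ((2 : ℝ) ^ (n + 1) * x i)
  set k := ⌊(2 : ℝ) ^ (n + 1) * x i⌋
  have e : (2 : ℝ) ^ (n + 1) * x i = 2 * (2 ^ n * x i) := by ring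
  rw [e] at h1 h2
  have h3 : 2 * (k / 2) ≤ k := by omega
  have h4 : k + 1 ≤ 2 * (k / 2) + 2 := by omega
  have h3' : (2 : ℝ) * ((k / 2 : ℤ) : ℝ) ≤ k := by exact_mod_cast h3
  have h4' : (k : ℝ) + 1 ≤ 2 * ((k / 2 : ℤ) : ℝ) + 2 := by exact_mod_cast h4
  constructor <;> linarith

lemma par_iter_q {d : ℕ} (n j : ℕ) (x : EuclideanSpace ℝ (Fin d)) :
    par^[j] (q (n + j) x) = q n x := by
  induction j with
  | zero => rfl
  | succ j ih =>
    rw [Function.iterate_succ_apply, ← add_assoc, par_q, ih]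

lemma q_eq_of_le {d : ℕ} {n m : ℕ} (h : n ≤ m) {x y : EuclideanSpace ℝ (Fin d)}
    (hxy : q m x = q m y) : q n x = q n y := by
  obtain ⟨j, rfl⟩ := Nat.exists_eq_add_of_le h
  rw [← par_iter_q n j x, hxy, par_iter_q]

def Cov {d : ℕ} (C : Set (ℕ × (Fin d → ℤ))) (A : Set (EuclideanSpace ℝ (Fin d))) : Prop :=
  ∀ x ∈ A, ∃ n, (n, q n x) ∈ C

/-- side length to the power `s` -/
noncomputable def w (s : ℝ) (n : ℕ) : ℝ := ((1 / 2 : ℝ) ^ n) ^ s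

lemma w_pos (s : ℝ) (n : ℕ) : 0 < w s n := by unfold w; positivity

noncomputable def W {d : ℕ} (s : ℝ) (C : Set (ℕ × (Fin d → ℤ))) : ℝ≥0∞ :=
  ∑' p, C.indicator (fun p => ENNReal.ofReal (w s p.1)) p

noncomputable def M {d : ℕ} (s : ℝ) (A : Set (EuclideanSpace ℝ (Fin d))) : ℝ≥0∞ :=
  ⨅ C : {C : Set (ℕ × (Fin d → ℤ)) // Cov C A}, W s C.1

variable {d : ℕ} {s : ℝ}

lemma M_le {A : Set (EuclideanSpace ℝ (Fin d))} {C : Set (ℕ × (Fin d → ℤ))} (h : Cov C A) :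
    M s A ≤ W s C := iInf_le (fun C : {C : Set (ℕ × (Fin d → ℤ)) // Cov C A} => W s C.1) ⟨C, h⟩

lemma exists_cov {A : Set (EuclideanSpace ℝ (Fin d))} {b : ℝ≥0∞} (h : M s A < b) :
    ∃ C : Set (ℕ × (Fin d → ℤ)), Cov C A ∧ W s C < b := by
  unfold M at h
  rw [iInf_lt_iff] at h
  obtain ⟨C, hC⟩ := h
  exact ⟨C.1, C.2, hC⟩

lemma le_M {A : Set (EuclideanSpace ℝ (Fin d))} {b : ℝ≥0∞} 
    (h : ∀ C : Set (ℕ × (Fin d → ℤ)), Cov C A → b ≤ W s C) : b ≤ M s A :=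
  le_iInf fun C => h C.1 C.2

lemma M_mono {A B : Set (EuclideanSpace ℝ (Fin d))} (h : A ⊆ B) : M s A ≤ M s B :=
  le_M fun _ hC => M_le fun x hx => hC x (h hx)

lemma M_empty : M s (∅ : Set (EuclideanSpace ℝ (Fin d))) = 0 := by
  have : M s (∅ : Set (EuclideanSpace ℝ (Fin d))) ≤ W s ∅ := M_le (fun x hx => hx.elim)
  simpa [W] using this

lemma W_union (C D : Set (ℕ × (Fin d → ℤ))) : W s (C ∪ D) ≤ W s C + W s D := by
  unfold W
  rw [← ENNReal.tsum_add]
  refine ENNReal.tsum_le_tsum fun p => ?_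
  by_cases h1 : p ∈ C <;> by_cases h2 : p ∈ D <;> simp [h1, h2]

lemma M_union (A B : Set (EuclideanSpace ℝ (Fin d))) : M s (A ∪ B) ≤ M s A + M s B := by
  refine ENNReal.le_of_forall_pos_le_add fun ε hε hfin => ?_
  have hA : M s A ≠ ⊤ := fun h => by simp [h] at hfin
  have hB : M s B ≠ ⊤ := fun h => by simp [h] at hfin
  have hε2 : ((ε : ℝ≥0∞) / 2) ≠ 0 := by
    simpa using hε.ne'
  obtain ⟨C, hC, hC'⟩ := exists_cov (ENNReal.lt_add_right hA hε2)
  obtain ⟨D, hD, hD'⟩ := exists_cov (ENNReal.lt_add_right hB hε2)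
  have hcov : Cov (C ∪ D) (A ∪ B) := by
    rintro x (hx | hx)
    · obtain ⟨n, hn⟩ := hC x hx
      exact ⟨n, Or.inl hn⟩
    · obtain ⟨n, hn⟩ := hD x hx
      exact ⟨n, Or.inr hn⟩
  refine (M_le hcov).trans ((W_union C D).trans ((add_le_add hC'.le hD'.le).trans (le_of_eq ?_)))
  rw [add_add_add_comm, ENNReal.add_halves]

lemma M_biUnion {ι : Type*} (t : Finset ι) (A : ι → Set (EuclideanSpace ℝ (Fin d))) :
    M s (⋃ i ∈ t, A i) ≤ ∑ i ∈ t, M s (A i) := by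
  classical
  induction t using Finset.induction_on with
  | empty => simp [M_empty]
  | insert a t ha ih =>
    rw [Finset.set_biUnion_insert, Finset.sum_insert ha]
    exact (M_union _ _).trans (by gcongr)

lemma W_cube (n : ℕ) (k : Fin d → ℤ) : W s {((n, k) : ℕ × (Fin d → ℤ))} = ENNReal.ofReal (w s n) := by
  unfold W
  rw [tsum_eq_single ((n, k) : ℕ × (Fin d → ℤ))]
  · simp
  · intro p hp; simp [hp]

lemma M_cube (A : Set (EuclideanSpace ℝ (Fin d))) (n : ℕ) (k : Fin d → ℤ)
   (hA : ∀ x ∈ A, q n x = k) : M s A ≤ ENNReal.ofReal (w s n) := by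
  rw [← W_cube n k]
  exact M_le fun x hx => ⟨n, by simp [hA x hx]⟩

def mx (C : Set (ℕ × (Fin d → ℤ))) : Set (ℕ × (Fin d → ℤ)) :=
  {p | p ∈ C ∧ ∀ m, ∀ j, m + (j + 1) = p.1 → (m, par^[j + 1] p.2) ∉ C}

lemma cov_mx {C : Set (ℕ × (Fin d → ℤ))} {A : Set (EuclideanSpace ℝ (Fin d))}  (h : Cov C A) :
    Cov (mx C) A := by
  classical
  intro x hx
  have hx := h x hx
  refine ⟨Nat.find hx, Nat.find_spec hx, ?_⟩
  intro m j hmj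
  simp only at hmj ⊢
  rw [← hmj, par_iter_q]
  exact Nat.find_min hx (by omega)

lemma strong {C D : Set (ℕ × (Fin d → ℤ))} {A : Set (EuclideanSpace ℝ (Fin d))} 
    (hC : Cov C A) (hD : Cov D A) : W s (mx (C ∪ D)) + M s A ≤ W s C + W s D := by
  have hL : Cov (((C ∪ D) \ mx (C ∪ D)) ∪ (C ∩ D)) A := by
    intro x hx
    obtain ⟨n, hn⟩ := hC x hx
    obtain ⟨m, hm⟩ := hD x hx
    rcases lt_trichotomy n m with h | h | h
    · refine ⟨m, Or.inl ⟨Or.inr hm, fun h' => ?_⟩⟩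
      obtain ⟨j, rfl⟩ := Nat.exists_eq_add_of_lt h
      have := h'.2 n j rfl
      simp only [add_assoc, par_iter_q] at this
      exact this (Or.inl hn)
    · subst h; exact ⟨n, Or.inr ⟨hn, hm⟩⟩
    · refine ⟨n, Or.inl ⟨Or.inl hn, fun h' => ?_⟩⟩
      obtain ⟨j, rfl⟩ := Nat.exists_eq_add_of_lt h
      have := h'.2 m j rfl
      simp only [add_assoc, par_iter_q] at this
      exact this (Or.inr hm)
  refine (add_le_add_right (M_le hL) _).trans ?_
  unfold W
  rw [← ENNReal.tsum_add, ← ENNReal.tsum_add]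
  refine ENNReal.tsum_le_tsum fun p => ?_
  have hsub : p ∈ mx (C ∪ D) → p ∈ C ∪ D := fun h => h.1
  by_cases h1 : p ∈ C <;> by_cases h2 : p ∈ D <;> by_cases h3 : p ∈ mx (C ∪ D) <;> simp_all 

lemma exists_mx {C : Set (ℕ × (Fin d → ℤ))} (n : ℕ) : ∀ (k : Fin d → ℤ), (n, k) ∈ C →
    ∃ m j, m + j = n ∧ (m, par^[j] k) ∈ mx C := by
  induction n using Nat.strong_induction_on with
  | _ n ih =>
    intro k hk
    by_cases h : (n, k) ∈ mx C
    · exact ⟨n, 0, rfl, h⟩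
    · have : ∃ m j, m + (j + 1) = n ∧ (m, par^[j + 1] k) ∈ C := by
        by_contra! h'
        exact h ⟨hk, h'⟩
      obtain ⟨m, j, hmj, hm⟩ := this
      obtain ⟨m', j', hmj', hm'⟩ := ih m (by omega) _ hm
      refine ⟨m', j' + (j + 1), by omega, ?_⟩
      rwa [Function.iterate_add_apply]

lemma mx_mx (C D : Set (ℕ × (Fin d → ℤ))) : mx (mx C ∪ D) = mx (C ∪ D) := by
  ext ⟨n, k⟩
  constructor
  · rintro ⟨h1, h2⟩
    refine ⟨h1.imp (fun h => h.1) id, fun m j hmj hm => ?_⟩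
    rcases hm with hm | hm
    · obtain ⟨m', j', hmj', hm'⟩ := exists_mx m _ hm
      rw [← Function.iterate_add_apply] at hm'
      exact h2 m' (j' + j) (by simp only at hmj ⊢; omega) (Or.inl hm')
    · exact h2 m j hmj (Or.inr hm)
  · rintro ⟨h1, h2⟩
    refine ⟨?_, fun m j hmj hm => h2 m j hmj (hm.imp (fun h => h.1) id)⟩
    rcases h1 with h1 | h1
    · exact Or.inl ⟨h1, fun m j hmj hm => h2 m j hmj (Or.inl hm)⟩
    · exact Or.inr h1

lemma increasing {A : ℕ → Set (EuclideanSpace ℝ (Fin d))} (hA : Monotone A) {b : ℝ≥0∞} (hb : b ≠ ⊤)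
    (h : ∀ n, M s (A n) ≤ b) : M s (⋃ n, A n) ≤ b := by
  refine ENNReal.le_of_forall_pos_le_add fun ε hε _ => ?_
  obtain ⟨e, he, hes⟩ := ENNReal.exists_pos_sum_of_countable' (ι := ℕ) (ε := ε) (by positivity) 
  have hfin : ∀ n, M s (A n) ≠ ⊤ := fun n => ne_top_of_le_ne_top hb (h n)
  have : ∀ n, ∃ C : Set (ℕ × (Fin d → ℤ)), Cov C (A n) ∧ W s C < M s (A n) + e n := 
    fun n => exists_cov (ENNReal.lt_add_right (hfin n) (he n).ne')
  choose C hC hW using this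
  let D : ℕ → Set (ℕ × (Fin d → ℤ)) := fun n => mx (⋃ k ∈ Finset.range (n + 1), C k)
  have hDs : ∀ n, D (n + 1) = mx (D n ∪ C (n + 1)) := by
    intro n
    simp only [D]
    rw [mx_mx]
    congr 1
    rw [Finset.range_add_one (n := n + 1), Finset.set_biUnion_insert, Set.union_comm]
  have hDc : ∀ n, Cov (D n) (A n) := fun n => cov_mx fun x hx => by
    obtain ⟨m, hm⟩ := hC n x hx
    exact ⟨m, Set.mem_biUnion (x := n) (by simp) hm⟩
  have hDW : ∀ n, W s (D n) ≤ M s (A n) + ∑ k ∈ Finset.range (n + 1), e k := by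
    intro n
    induction n with
    | zero => 
      have : D 0 ⊆ C 0 := by
        intro p hp
        have := hp.1
        simpa using this
      simp only [zero_add, Finset.sum_range_one]
      refine le_trans ?_ (hW 0).le
      exact ENNReal.tsum_le_tsum fun p => Set.indicator_le_indicator_of_subset this (by simp) p
    | succ n ih =>
      have h1 := strong (s := s) (hDc n) (fun x hx => hC (n + 1) x (hA (Nat.le_succ n) hx))
      rw [← hDs] at h1
      have h2 : W s (D (n + 1)) + M s (A n) ≤ (M s (A (n + 1)) + ∑ k ∈ Finset.range (n + 1 + 1), e k) + M s (A n) := by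
        refine h1.trans ((add_le_add ih (hW (n + 1)).le).trans (le_of_eq ?_))
        rw [Finset.sum_range_succ _ (n + 1)]
        ring
      exact (ENNReal.add_le_add_iff_right (hfin n)).1 h2
  have hcov : Cov (mx (⋃ k, C k)) (⋃ n, A n) := cov_mx fun x hx => by
    obtain ⟨n, hn⟩ := Set.mem_iUnion.1 hx
    obtain ⟨m, hm⟩ := hC n x hn
    exact ⟨m, Set.mem_iUnion.2 ⟨n, hm⟩⟩
  refine (M_le hcov).trans ?_
  unfold W
  rw [ENNReal.tsum_eq_iSup_sum]
  refine iSup_le fun F => ?_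
  -- all elements of F in mx are in D n
  have : ∃ n, ∀ p ∈ F, p ∈ mx (⋃ k, C k) → p ∈ D n := by
    have h0 : ∀ p ∈ F, ∃ n, p ∈ mx (⋃ k, C k) → p ∈ ⋃ k ∈ Finset.range (n + 1), C k := by
      intro p _
      by_cases hp : p ∈ mx (⋃ k, C k)
      · obtain ⟨n, hn⟩ := Set.mem_iUnion.1 hp.1
        exact ⟨n, fun _ => Set.mem_biUnion (x := n) (by simp) hn⟩
      · exact ⟨0, fun h => (hp h).elim⟩
    choose! g hg using h0
    refine ⟨F.sup g, fun p hp hm => ⟨?_, fun m j hmj hmem => hm.2 m j hmj ?_⟩⟩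
    · have := hg p hp hm
      simp only [Set.mem_iUnion, Finset.mem_range] at this ⊢
      obtain ⟨k, hk, hk'⟩ := this
      have := Finset.le_sup (f := g) hp
      exact ⟨k, by omega, hk'⟩
    · simp only [Set.mem_iUnion] at hmem ⊢
      obtain ⟨k, _, hk'⟩ := hmem
      exact ⟨k, hk'⟩
  obtain ⟨n, hn⟩ := this
  calc _ ≤ ∑ p ∈ F, (D n).indicator (fun p => ENNReal.ofReal (w s p.1)) p := by
        refine Finset.sum_le_sum fun p hp => ?_
        by_cases hm : p ∈ mx (⋃ k, C k)
        · simp [hm, hn p hp hm]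
        · simp [hm]
    _ ≤ W s (D n) := ENNReal.sum_le_tsum _
    _ ≤ M s (A n) + ∑ k ∈ Finset.range (n + 1), e k := hDW n
    _ ≤ b + ε := add_le_add (h n) ((ENNReal.sum_le_tsum _).trans hes.le)

end DD

open MeasureTheory
open scoped ENNReal
set_option autoImplicit false
namespace DD
variable {d : ℕ} {s : ℝ}

lemma dist_cube {n : ℕ} {x y : EuclideanSpace ℝ (Fin d)} (h : q n x = q n y) :
    dist x y ≤ d * (1 / 2 : ℝ) ^ n := by
  have hc : ∀ i, |x i - y i| ≤ (1 / 2 : ℝ) ^ n := by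
    intro i
    have := congrFun h i
    simp only [q] at this
    have h1 := (Int.abs_sub_lt_one_of_floor_eq_floor this).le
    rw [← mul_sub, abs_mul, abs_of_pos (by positivity : (0 : ℝ) < 2 ^ n)] at h1
    rw [one_div, inv_pow, ← one_div, le_div_iff₀' (by positivity)]
    exact h1
  rw [EuclideanSpace.dist_eq]
  apply Real.sqrt_le_iff.2 ⟨by positivity, ?_⟩
  calc ∑ i, dist (x i) (y i) ^ 2 ≤ ∑ i : Fin d, ((1 / 2 : ℝ) ^ n) ^ 2 := by
        refine Finset.sum_le_sum fun i _ => ?_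
        rw [Real.dist_eq]
        exact pow_le_pow_left₀ (abs_nonneg _) (hc i) 2
    _ = d * ((1 / 2 : ℝ) ^ n) ^ 2 := by simp
    _ ≤ (d * (1 / 2 : ℝ) ^ n) ^ 2 := by
        rw [mul_pow]
        have : (d : ℝ) ≤ (d : ℝ) ^ 2 := by
          exact_mod_cast Nat.le_self_pow (by norm_num) d
        gcongr

lemma M_pos (hs : 0 < s) (E : Set (EuclideanSpace ℝ (Fin d)))
    (h : ENNReal.ofReal s < dimH E) : M s E ≠ 0 := by
  intro h0
  refine absurd h (not_lt.2 ?_)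
  have key : μH[s] E = 0 := by
    have h1 : ∀ j : ℕ, ∃ C : Set (ℕ × (Fin d → ℤ)), Cov C E ∧ W s C < ENNReal.ofReal (1 / (j + 1)) := by
      intro j
      apply exists_cov
      rw [h0]
      simp only [ENNReal.ofReal_pos]
      positivity
    choose C hC hW using h1
    let t : ℕ → (ℕ × (Fin d → ℤ)) → Set (EuclideanSpace ℝ (Fin d)) :=
      fun j p => {x | p ∈ C j ∧ q p.1 x = p.2}
    have hdiam : ∀ j p, Metric.ediam (t j p) ≤ ENNReal.ofReal (d * (1 / 2 : ℝ) ^ p.1) := by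
      intro j p
      refine Metric.ediam_le fun x hx y hy => ?_
      rw [edist_dist]
      exact ENNReal.ofReal_le_ofReal (dist_cube (hx.2.trans hy.2.symm))
    have hw : ∀ j p, p ∈ C j → w s p.1 ≤ 1 / ((j : ℝ) + 1) := by
      intro j p hp
      have : ENNReal.ofReal (w s p.1) ≤ W s (C j) := by
        have := ENNReal.le_tsum (f := (C j).indicator (fun p => ENNReal.ofReal (w s p.1))) p
        simpa [hp, W] using this
      exact (ENNReal.ofReal_le_ofReal_iff (by positivity)).1 (this.trans (hW j).le)
    have hr : ∀ j p, Metric.ediam (t j p) ≤ ENNReal.ofReal (d * (1 / ((j : ℝ) + 1)) ^ (1 / s)) := by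
      intro j p
      by_cases hp : p ∈ C j
      · refine (hdiam j p).trans (ENNReal.ofReal_le_ofReal ?_)
        gcongr
        have := Real.rpow_le_rpow (w_pos s p.1).le (hw j p hp) (by positivity : 0 ≤ 1 / s)
        unfold w at this
        rwa [← Real.rpow_mul (by positivity), mul_one_div_cancel hs.ne', Real.rpow_one] at this
      · have : t j p = ∅ := by ext x; simp [t, hp]
        simp [this]
    have hlim : Filter.Tendsto (fun j : ℕ => ENNReal.ofReal (d * (1 / ((j : ℝ) + 1)) ^ (1 / s)))
        Filter.atTop (nhds 0) := by
      rw [← ENNReal.ofReal_zero]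
      refine ENNReal.tendsto_ofReal ?_
      have h2 := (tendsto_one_div_add_atTop_nhds_zero_nat (𝕜 := ℝ)).rpow_const (p := 1 / s) (Or.inr (by positivity))
      rw [Real.zero_rpow (by positivity)] at h2
      simpa using h2.const_mul (d : ℝ)
    have hle := Measure.hausdorffMeasure_le_liminf_tsum s E (l := Filter.atTop) _ hlim t
      (Filter.Eventually.of_forall hr) (Filter.Eventually.of_forall (fun j x hx => by
        obtain ⟨n, hn⟩ := hC j x hx
        exact Set.mem_iUnion.2 ⟨(n, q n x), hn, rfl⟩))
    have hb : ∀ j, ∑' p, Metric.ediam (t j p) ^ s ≤ ENNReal.ofReal ((d : ℝ) ^ s) * ENNReal.ofReal (1 / (j + 1)) := by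
      intro j
      calc _ ≤ ∑' p, ENNReal.ofReal ((d : ℝ) ^ s) * (C j).indicator (fun p => ENNReal.ofReal (w s p.1)) p := by
            refine ENNReal.tsum_le_tsum fun p => ?_
            by_cases hp : p ∈ C j
            · simp only [hp, Set.indicator_of_mem]
              refine (ENNReal.rpow_le_rpow (hdiam j p) hs.le).trans (le_of_eq ?_)
              rw [ENNReal.ofReal_rpow_of_nonneg (by positivity) hs.le, Real.mul_rpow (by positivity) (by positivity),
                ENNReal.ofReal_mul (by positivity)]
              rfl
            · have : t j p = ∅ := by ext x; simp [t, hp]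
              simp [this, hs]
        _ = ENNReal.ofReal ((d : ℝ) ^ s) * W s (C j) := ENNReal.tsum_mul_left
        _ ≤ _ := by gcongr; exact (hW j).le
    have hlim2 : Filter.Tendsto (fun j : ℕ => ENNReal.ofReal ((d : ℝ) ^ s) * ENNReal.ofReal (1 / ((j : ℝ) + 1)))
        Filter.atTop (nhds 0) := by
      have h2 := ENNReal.tendsto_ofReal (tendsto_one_div_add_atTop_nhds_zero_nat (𝕜 := ℝ))
      have := ENNReal.Tendsto.const_mul (a := ENNReal.ofReal ((d : ℝ) ^ s)) h2 (Or.inr ENNReal.ofReal_ne_top)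
      simpa using this
    refine le_antisymm (hle.trans ?_) zero_le
    rw [← hlim2.liminf_eq]
    exact Filter.liminf_le_liminf (Filter.Eventually.of_forall hb)
  have := dimH_le_of_hausdorffMeasure_ne_top (d := s.toNNReal) (s := E) (by
    rw [Real.coe_toNNReal _ hs.le, key]; simp)
  exact this

lemma tube {N : ℕ → ℕ} {V : Set (ℕ → ℕ)} (hV : IsOpen V) (h : {σ : ℕ → ℕ | ∀ i, σ i ≤ N i} ⊆ V) :
    ∃ k, {σ : ℕ → ℕ | ∀ i < k, σ i ≤ N i} ⊆ V := by
  by_contra! hcon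
  have : ∀ k, ∃ σ : ℕ → ℕ, (∀ i < k, σ i ≤ N i) ∧ σ ∉ V := fun k => by
    obtain ⟨σ, h1, h2⟩ := Set.not_subset.1 (hcon k)
    exact ⟨σ, h1, h2⟩
  choose σ h1 h2 using this
  have hcpt : IsCompact {σ : ℕ → ℕ | ∀ i, σ i ≤ N i} := by
    have := isCompact_univ_pi (X := fun _ : ℕ => ℕ) (s := fun i => Set.Iic (N i)) 
      (fun i => (Set.finite_Iic (N i)).isCompact)
    convert this using 1
    ext; simp [Pi.le_def]
  obtain ⟨τ, hτ, φ, hφ, hlim⟩ := hcpt.tendsto_subseq (x := fun k i => min (σ k i) (N i)) 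
    (fun k i => min_le_right _ _)
  have hl2 : Filter.Tendsto (fun j => σ (φ j)) Filter.atTop (nhds τ) := by
    rw [tendsto_pi_nhds] at hlim ⊢
    intro i
    refine (hlim i).congr' ?_
    filter_upwards [hφ.tendsto_atTop.eventually_gt_atTop i] with j hj
    exact min_eq_left (h1 _ i hj)
  obtain ⟨j, hj⟩ := (hl2.eventually (hV.mem_nhds (h hτ))).exists
  exact h2 _ hj

def Bx (k : ℕ) (N : ℕ → ℕ) : Set (ℕ → ℕ) := {σ | ∀ i < k, σ i ≤ N i}

lemma exists_box {F : (ℕ → ℕ) → EuclideanSpace ℝ (Fin d)} {c : ℝ≥0∞} (hc : c ≠ ⊤)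
    (h : c < M s (Set.range F)) : ∃ N : ℕ → ℕ, ∀ k, c < M s (F '' Bx k N) := by
  have step : ∀ k (g : ℕ → ℕ), c < M s (F '' Bx k g) → ∃ v, c < M s (F '' Bx (k + 1) (Function.update g k v)) := by
    intro k g hg
    by_contra! hcon
    have hmono : Monotone (fun v => F '' Bx (k + 1) (Function.update g k v)) := by
      intro v v' hv
      refine Set.image_mono fun σ hσ i hi => (hσ i hi).trans ?_
      by_cases hik : i = k
      · subst hik; simpa using hv
      · simp [hik]
    have := increasing hmono hc hcon
    refine absurd (hg.trans_le ((M_mono ?_).trans this)) (lt_irrefl _)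
    rintro _ ⟨σ, hσ, rfl⟩
    refine Set.mem_iUnion.2 ⟨σ k, σ, fun i hi => ?_, rfl⟩
    by_cases hik : i = k
    · subst hik; simp
    · simp only [ne_eq, hik, not_false_eq_true, Function.update_of_ne]
      exact hσ i (by omega)
  choose! v hv using step
  let g : ℕ → (ℕ → ℕ) := fun k => Nat.rec (fun _ => 0) (fun k g => Function.update g k (v k g)) k
  have hgs : ∀ k, g (k + 1) = Function.update (g k) k (v k (g k)) := fun k => rfl
  have hg : ∀ k, c < M s (F '' Bx k (g k)) := by
    intro k
    induction k with
    | zero => 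
      have : F '' Bx 0 (g 0) = Set.range F := by
        simp [Bx]
      rwa [this]
    | succ k ih => rw [hgs]; exact hv _ _ ih
  have hst : ∀ i j, g (i + 1 + j) i = g (i + 1) i := by
    intro i j
    induction j with
    | zero => rfl
    | succ j ih => 
      rw [← add_assoc, hgs, Function.update_of_ne (by omega), ih]
  refine ⟨fun i => g (i + 1) i, fun k => (hg k).trans_le (M_mono (Set.image_mono fun σ hσ i hi => ?_))⟩
  obtain ⟨j, rfl⟩ := Nat.exists_eq_add_of_lt hi
  have := hσ i hi
  have e : i + j + 1 = i + 1 + j := by omega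
  rw [e, hst] at this
  exact this

lemma W_enlarge (C : Set (ℕ × (Fin d → ℤ))) :
    ∃ C' : Set (ℕ × (Fin d → ℤ)), W s C' ≤ 3 ^ d * W s C ∧ 
      ∀ n k k', (n, k) ∈ C → (∀ i, |k' i - k i| ≤ 1) → (n, k') ∈ C' := by
  let S : Finset (Fin d → ℤ) := Fintype.piFinset fun _ => Finset.Icc (-1) 1
  have hS : S.card = 3 ^ d := by simp [S, Fintype.card_piFinset]
  refine ⟨{p | ∃ e ∈ S, (p.1, p.2 - e) ∈ C}, ?_, ?_⟩
  · have hsh : ∀ e : Fin d → ℤ, ∑' p : ℕ × (Fin d → ℤ), C.indicator (fun p => ENNReal.ofReal (w s p.1)) (p.1, p.2 - e) = W s C := by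
      intro e
      exact (Equiv.tsum_eq ((Equiv.refl ℕ).prodCongr (Equiv.subRight e)) 
        (C.indicator (fun p => ENNReal.ofReal (w s p.1))))
    calc _ ≤ ∑' p : ℕ × (Fin d → ℤ), ∑ e ∈ S, C.indicator (fun p => ENNReal.ofReal (w s p.1)) (p.1, p.2 - e) := by
          refine ENNReal.tsum_le_tsum fun p => ?_
          by_cases hp : ∃ e ∈ S, (p.1, p.2 - e) ∈ C
          · obtain ⟨e, he, hep⟩ := hp
            rw [Set.indicator_of_mem (show p ∈ {p | ∃ e ∈ S, (p.1, p.2 - e) ∈ C} from ⟨e, he, hep⟩)]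
            refine le_trans ?_ (Finset.single_le_sum (fun _ _ => zero_le) he)
            simp [hep]
          · rw [Set.indicator_of_notMem (by simpa using hp)]
            exact zero_le
      _ = ∑ e ∈ S, ∑' p : ℕ × (Fin d → ℤ), C.indicator (fun p => ENNReal.ofReal (w s p.1)) (p.1, p.2 - e) := by
          rw [Summable.tsum_finsetSum]; intros; exact ENNReal.summable
      _ = 3 ^ d * W s C := by simp [hsh, hS]
  · intro n k k' hk hkk
    refine ⟨k' - k, ?_, by simpa using hk⟩
    simp only [S, Fintype.mem_piFinset, Finset.mem_Icc, Pi.sub_apply]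
    exact fun i => abs_le.1 (hkk i)

lemma exists_compact {E : Set (EuclideanSpace ℝ (Fin d))} (hE : MeasurableSet E)
    (h : M s E ≠ 0) : ∃ K ⊆ E, IsCompact K ∧ M s K ≠ 0 := by
  have han := hE.analyticSet
  rw [AnalyticSet] at han
  rcases han with rfl | ⟨F, hF, rfl⟩
  · exact (h M_empty).elim
  obtain ⟨c, hc0, hc⟩ := exists_between (pos_iff_ne_zero.2 h)
  obtain ⟨N, hN⟩ := exists_box hc.ne_top hc
  have hcpt : IsCompact {σ : ℕ → ℕ | ∀ i, σ i ≤ N i} := by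
    have := isCompact_univ_pi (X := fun _ : ℕ => ℕ) (s := fun i => Set.Iic (N i)) 
      (fun i => (Set.finite_Iic (N i)).isCompact)
    convert this using 1
    ext; simp [Pi.le_def]
  refine ⟨F '' {σ : ℕ → ℕ | ∀ i, σ i ≤ N i}, Set.image_subset_range _ _, hcpt.image hF, ?_⟩
  intro h0
  have : M s (F '' {σ : ℕ → ℕ | ∀ i, σ i ≤ N i}) < c / 3 ^ d := by
    rw [h0]
    exact ENNReal.div_pos hc0.ne' (by simp)
  obtain ⟨C, hC, hCW⟩ := exists_cov this
  obtain ⟨C', hC'W, hC'⟩ := W_enlarge (s := s) C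
  let U : Set (EuclideanSpace ℝ (Fin d)) := ⋃ p ∈ C, ⋂ i, {x | |(2 : ℝ) ^ p.1 * x i - (p.2 i + 1 / 2)| < 1}
  have hU : IsOpen U := by
    refine isOpen_biUnion fun p _ => isOpen_iInter_of_finite fun i => ?_
    exact isOpen_lt (by fun_prop) continuous_const
  have hKU : {σ : ℕ → ℕ | ∀ i, σ i ≤ N i} ⊆ F ⁻¹' U := by
    intro σ hσ
    obtain ⟨n, hn⟩ := hC (F σ) ⟨σ, hσ, rfl⟩
    refine Set.mem_biUnion hn (Set.mem_iInter.2 fun i => ?_)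
    simp only [q, Set.mem_ofPred_eq]
    have h1 := Int.floor_le ((2 : ℝ) ^ n * F σ i)
    have h2 := Int.lt_floor_add_one ((2 : ℝ) ^ n * F σ i)
    rw [abs_lt]; constructor <;> linarith
  obtain ⟨k, hk⟩ := tube (hU.preimage hF) hKU
  have hcov : Cov C' (F '' Bx k N) := by
    rintro _ ⟨σ, hσ, rfl⟩
    have := hk hσ
    simp only [U, Set.mem_preimage, Set.mem_iUnion, Set.mem_iInter, Set.mem_ofPred_eq] at this
    obtain ⟨⟨n, k⟩, hp, hlt⟩ := this
    refine ⟨n, hC' n k _ hp fun i => ?_⟩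
    have := abs_lt.1 (hlt i)
    simp only at this
    have h1 := Int.floor_le ((2 : ℝ) ^ n * F σ i)
    have h2 := Int.lt_floor_add_one ((2 : ℝ) ^ n * F σ i)
    simp only [q]
    set a := ⌊(2 : ℝ) ^ n * F σ i⌋
    have h3 : (a : ℝ) < k i + 2 := by linarith
    have h4 : (k i : ℝ) < a + 2 := by linarith
    have h3' : a < k i + 2 := by exact_mod_cast h3
    have h4' : k i < a + 2 := by exact_mod_cast h4
    rw [abs_le]; constructor <;> omega
  have h1 := (hN k).trans_le ((M_le hcov).trans hC'W)
  have h2 : (3 : ℝ≥0∞) ^ d * W s C ≤ c := by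
    calc _ ≤ (3 : ℝ≥0∞) ^ d * (c / 3 ^ d) := by gcongr
      _ = c := ENNReal.mul_div_cancel (by simp) (by simp)
  exact absurd (h1.trans_le h2) (lt_irrefl _)

end DD

open MeasureTheory
open scoped ENNReal
set_option autoImplicit false
namespace DD
variable {d : ℕ} {s : ℝ}

lemma split_sum {ι : Type*} (t : Finset ι) (b : ι → ℝ) (hb : ∀ i, 0 ≤ b i) {a : ℝ} (ha : 0 ≤ a)
    (h : a ≤ ∑ i ∈ t, b i) : ∃ c : ι → ℝ, (∀ i, 0 ≤ c i) ∧ (∀ i, c i ≤ b i) ∧ ∑ i ∈ t, c i = a := by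
  rcases (Finset.sum_nonneg fun i (_ : i ∈ t) => hb i).eq_or_lt' with h0 | h0
  · exact ⟨fun _ => 0, fun _ => le_rfl, hb, by simp; linarith⟩
  · refine ⟨fun i => a / (∑ i ∈ t, b i) * b i, fun i => mul_nonneg (by positivity) (hb i), fun i => ?_, ?_⟩
    · exact mul_le_of_le_one_left (hb i) ((div_le_one h0).2 h)
    · rw [← Finset.mul_sum, div_mul_cancel₀ _ h0.ne']

lemma frost (s : ℝ) (A : Set (EuclideanSpace ℝ (Fin d))) (N : ℕ) : ∀ (n : ℕ) (k : Fin d → ℤ) (a : ℝ), 0 ≤ a →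
    ENNReal.ofReal a ≤ M s (A ∩ {x | q n x = k}) →
    ∃ (T : Finset (EuclideanSpace ℝ (Fin d))) (m : EuclideanSpace ℝ (Fin d) → ℝ),
      (∀ y ∈ T, y ∈ A ∧ q n y = k) ∧ (∀ y, 0 ≤ m y) ∧ ∑ y ∈ T, m y = a ∧
      ∀ l, n ≤ l → l ≤ n + N → ∀ k', ∑ y ∈ T with q l y = k', m y ≤ w s l := by
  classical
  have hMw : ∀ n (k : Fin d → ℤ), M s (A ∩ {x | q n x = k}) ≤ ENNReal.ofReal (w s n) :=
    fun n k => M_cube _ n k fun x hx => hx.2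
  have htot : ∀ n (k : Fin d → ℤ) a, ENNReal.ofReal a ≤ M s (A ∩ {x | q n x = k}) → a ≤ w s n :=
    fun n k a h => (ENNReal.ofReal_le_ofReal_iff (w_pos s n).le).1 (h.trans (hMw n k))
  induction N with
  | zero =>
    intro n k a ha h
    rcases (A ∩ {x | q n x = k}).eq_empty_or_nonempty with he | ⟨y, hy⟩
    · rw [he, M_empty] at h
      have ha0 : a = 0 := le_antisymm (by simpa using h) ha
      refine ⟨∅, fun _ => 0, by simp, fun _ => le_rfl, by simp [ha0], ?_⟩
      intro l _ _ k'
      simpa using (w_pos s l).le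
    · refine ⟨{y}, fun _ => a, ?_, fun _ => ha, by simp, ?_⟩
      · intro z hz
        rw [Finset.mem_singleton.1 hz]
        exact hy
      · intro l hl hl' k'
        obtain rfl : l = n := by omega
        refine le_trans ?_ (htot l k a h)
        rw [Finset.filter_singleton]
        split_ifs <;> simp [ha]
  | succ N ih =>
    intro n k a ha h
    let S : Finset (Fin d → ℤ) := Fintype.piFinset fun i => Finset.Icc (2 * k i) (2 * k i + 1)
    have hS : ∀ k', par k' = k → k' ∈ S := by
      intro k' hk'
      simp only [S, Fintype.mem_piFinset, Finset.mem_Icc]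
      intro i
      have := congrFun hk' i
      simp only [par] at this
      omega
    have hS' : ∀ k' ∈ S, par k' = k := by
      intro k' hk'
      simp only [S, Fintype.mem_piFinset, Finset.mem_Icc] at hk'
      funext i
      have := hk' i
      simp only [par]
      omega
    have hsub : A ∩ {x | q n x = k} ⊆ ⋃ k' ∈ S, A ∩ {x | q (n + 1) x = k'} := by
      rintro x ⟨hx, hxk⟩
      refine Set.mem_biUnion (hS (q (n + 1) x) ?_) ⟨hx, rfl⟩
      rw [par_q]; exact hxk
    have hfin : ∀ n (k : Fin d → ℤ), M s (A ∩ {x | q n x = k}) ≠ ⊤ := fun n k =>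
      ne_top_of_le_ne_top ENNReal.ofReal_ne_top (hMw n k)
    have hle : a ≤ ∑ k' ∈ S, (M s (A ∩ {x | q (n + 1) x = k'})).toReal := by
      rw [← ENNReal.toReal_sum fun k' _ => hfin _ _]
      rw [← ENNReal.ofReal_le_iff_le_toReal (ENNReal.sum_ne_top.2 fun k' _ => hfin _ _)]
      exact h.trans ((M_mono hsub).trans (M_biUnion _ _))
    obtain ⟨c, hc0, hcb, hcs⟩ := split_sum S _ (fun _ => ENNReal.toReal_nonneg) ha hle
    have := fun k' => ih (n + 1) k' (c k') (hc0 k')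
      ((ENNReal.ofReal_le_iff_le_toReal (hfin _ _)).2 (hcb k'))
    choose T m hT hm0 hms hml using this
    have hdisj : (S : Set (Fin d → ℤ)).PairwiseDisjoint T := by
      intro k1 _ k2 _ hne
      refine Finset.disjoint_left.2 fun y h1 h2 => hne ?_
      rw [← (hT k1 y h1).2, (hT k2 y h2).2]
    refine ⟨S.biUnion T, fun y => m (q (n + 1) y) y, ?_, fun y => hm0 _ _, ?_, ?_⟩
    · intro y hy
      obtain ⟨k', hk', hy'⟩ := Finset.mem_biUnion.1 hy
      refine ⟨(hT k' y hy').1, ?_⟩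
      rw [← par_q, (hT k' y hy').2, hS' k' hk']
    · rw [Finset.sum_biUnion hdisj, ← hcs]
      refine Finset.sum_congr rfl fun k' _ => ?_
      rw [← hms k']
      exact Finset.sum_congr rfl fun y hy => by rw [(hT k' y hy).2]
    · intro l hl hl' k'
      rcases hl.eq_or_lt with rfl | hlt
      · refine le_trans ?_ (htot n k a h)
        refine (Finset.sum_le_sum_of_subset_of_nonneg (Finset.filter_subset _ _) (fun y _ _ => hm0 _ _)).trans ?_
        rw [Finset.sum_biUnion hdisj, ← hcs]
        refine le_of_eq (Finset.sum_congr rfl fun k' _ => ?_)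
        rw [← hms k']
        exact Finset.sum_congr rfl fun y hy => by rw [(hT k' y hy).2]
      · obtain ⟨j, rfl⟩ := Nat.exists_eq_add_of_le (Nat.succ_le_of_lt hlt)
        have hk0 : ∀ y, q (n + 1 + j) y = k' → q (n + 1) y = par^[j] k' := by
          rintro y rfl; rw [par_iter_q]
        refine le_trans ?_ (hml (par^[j] k') (n + 1 + j) (by omega) (by omega) k')
        calc _ = ∑ y ∈ (S.biUnion T) with q (n + 1 + j) y = k', m (par^[j] k') y := by
              refine Finset.sum_congr rfl fun y hy => ?_
              change m (q (n + 1) y) y = _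
              rw [hk0 y (Finset.mem_filter.1 hy).2]
          _ ≤ _ := by
              refine Finset.sum_le_sum_of_subset_of_nonneg ?_ (fun y _ _ => hm0 _ _)
              intro y hy
              obtain ⟨hy1, hy2⟩ := Finset.mem_filter.1 hy
              obtain ⟨k'', _, hy''⟩ := Finset.mem_biUnion.1 hy1
              have : k'' = par^[j] k' := by rw [← hk0 y hy2, (hT k'' y hy'').2]
              exact Finset.mem_filter.2 ⟨this ▸ hy'', hy2⟩

lemma ball_bound (hs : 0 < s) {T : Finset (EuclideanSpace ℝ (Fin d))} {m : EuclideanSpace ℝ (Fin d) → ℝ}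
    {k : Fin d → ℤ} {N : ℕ} (hm : ∀ y, 0 ≤ m y) (hT : ∀ y ∈ T, q 0 y = k)
    (h : ∀ l, l ≤ N → ∀ k', ∑ y ∈ T with q l y = k', m y ≤ w s l) 
    (z : EuclideanSpace ℝ (Fin d)) (r : ℝ) (hr : (1 / 2 : ℝ) ^ N ≤ r) :
    ∑ y ∈ T with dist y z ≤ r, m y ≤ 5 ^ d * r ^ s := by
  classical
  have hr0 : 0 < r := lt_of_lt_of_le (by positivity) hr
  have hex : ∃ l, (1 / 2 : ℝ) ^ l ≤ r := ⟨N, hr⟩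
  obtain ⟨l, hl, hlN, hlmin⟩ : ∃ l, (1 / 2 : ℝ) ^ l ≤ r ∧ l ≤ N ∧ ∀ j < l, r < (1 / 2 : ℝ) ^ j :=
    ⟨Nat.find hex, Nat.find_spec hex, Nat.find_min' hex hr, fun j hj => not_le.1 (Nat.find_min hex hj)⟩
  have hwl : w s l ≤ r ^ s := Real.rpow_le_rpow (by positivity) hl hs.le
  let S : Finset (Fin d → ℤ) := Fintype.piFinset fun i => Finset.Icc (q l z i - 2) (q l z i + 2)
  have hS : S.card = 5 ^ d := by
    simp [S, Fintype.card_piFinset]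
    have : ∀ x : ℤ, (x + 2 + 1 - (x - 2)).toNat = 5 := by intro x; omega
    simp [this]
  rcases Nat.eq_zero_or_pos l with rfl | hl0
  · calc _ ≤ ∑ y ∈ T with q 0 y = k, m y := by
          refine Finset.sum_le_sum_of_subset_of_nonneg ?_ (fun y _ _ => hm y)
          intro y hy
          have := (Finset.mem_filter.1 hy).1
          exact Finset.mem_filter.2 ⟨this, hT y this⟩
      _ ≤ w s 0 := h 0 (Nat.zero_le _) k
      _ ≤ r ^ s := hwl
      _ ≤ 5 ^ d * r ^ s := le_mul_of_one_le_left (by positivity) (one_le_pow₀ (by norm_num))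
  · obtain ⟨j, rfl⟩ : ∃ j, l = j + 1 := ⟨l - 1, by omega⟩
    have hrj := hlmin j (by omega)
    have hmem : ∀ y, dist y z ≤ r → q (j + 1) y ∈ S := by
      intro y hy
      simp only [S, Fintype.mem_piFinset, Finset.mem_Icc]
      intro i
      have h1 : |y i - z i| ≤ dist y z := by
        have := PiLp.norm_apply_le (y - z) i
        simpa [dist_eq_norm] using this
      have h2 : |y i - z i| < (1 / 2 : ℝ) ^ j := lt_of_le_of_lt (h1.trans hy) hrj
      have h3 : |(2 : ℝ) ^ (j + 1) * y i - 2 ^ (j + 1) * z i| < 2 := by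
        rw [← mul_sub, abs_mul, abs_of_pos (by positivity : (0 : ℝ) < 2 ^ (j + 1))]
        calc _ < (2 : ℝ) ^ (j + 1) * (1 / 2) ^ j := by gcongr
          _ = 2 := by rw [pow_succ, one_div, inv_pow]; field_simp
      rw [abs_lt] at h3
      simp only [q]
      have a1 := Int.floor_le ((2 : ℝ) ^ (j + 1) * y i)
      have a2 := Int.lt_floor_add_one ((2 : ℝ) ^ (j + 1) * y i)
      have b1 := Int.floor_le ((2 : ℝ) ^ (j + 1) * z i)
      have b2 := Int.lt_floor_add_one ((2 : ℝ) ^ (j + 1) * z i)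
      set a := ⌊(2 : ℝ) ^ (j + 1) * y i⌋
      set b := ⌊(2 : ℝ) ^ (j + 1) * z i⌋
      have c1 : (a : ℝ) < b + 3 := by linarith
      have c2 : (b : ℝ) < a + 3 := by linarith
      have c1' : a < b + 3 := by exact_mod_cast c1
      have c2' : b < a + 3 := by exact_mod_cast c2
      omega
    calc _ = ∑ k' ∈ S, ∑ y ∈ T with dist y z ≤ r ∧ q (j + 1) y = k', m y := by
          rw [← Finset.sum_fiberwise_of_maps_to (s := T.filter (fun y => dist y z ≤ r)) (t := S) (g := q (j + 1))]
          · simp only [Finset.filter_filter]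
          · intro y hy
            exact hmem y (Finset.mem_filter.1 hy).2
      _ ≤ ∑ k' ∈ S, w s (j + 1) := by
          refine Finset.sum_le_sum fun k' _ => le_trans ?_ (h (j + 1) hlN k')
          refine Finset.sum_le_sum_of_subset_of_nonneg ?_ (fun y _ _ => hm y)
          intro y hy
          obtain ⟨h1, h2⟩ := Finset.mem_filter.1 hy
          exact Finset.mem_filter.2 ⟨h1, h2.2⟩
      _ = 5 ^ d * w s (j + 1) := by simp [hS]
      _ ≤ _ := by gcongr

/-- Discrete Frostman lemma for Borel sets. -/
theorem frostman (hs : 0 < s) {E : Set (EuclideanSpace ℝ (Fin d))} (hE : MeasurableSet E)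
    (h : ENNReal.ofReal s < dimH E) :
    ∃ K ⊆ E, IsCompact K ∧ ∃ a > 0, ∀ N : ℕ,
      ∃ (T : Finset (EuclideanSpace ℝ (Fin d))) (m : EuclideanSpace ℝ (Fin d) → ℝ),
      (∀ y ∈ T, y ∈ K) ∧ (∀ y, 0 ≤ m y) ∧ ∑ y ∈ T, m y = a ∧
      ∀ z r, (1 / 2 : ℝ) ^ N ≤ r → ∑ y ∈ T with dist y z ≤ r, m y ≤ 5 ^ d * r ^ s := by
  have hun : E = ⋃ k : Fin d → ℤ, E ∩ {x | q 0 x = k} := by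
    ext x; simp
  rw [hun, dimH_iUnion, lt_iSup_iff] at h
  obtain ⟨k, hk⟩ := h
  have hq : Measurable fun x : EuclideanSpace ℝ (Fin d) => q 0 x := by
    unfold q
    refine measurable_pi_lambda _ fun i => Int.measurable_floor.comp ?_
    exact Continuous.measurable (by fun_prop)
  have hmeas : MeasurableSet (E ∩ {x | q 0 x = k}) := hE.inter (hq (measurableSet_singleton k))
  obtain ⟨K, hKE, hK, hM⟩ := exists_compact hmeas (M_pos hs _ hk)
  have hKc : K ∩ {x | q 0 x = k} = K := Set.inter_eq_left.2 fun x hx => (hKE hx).2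
  have hfin : M s K ≠ ⊤ := ne_top_of_le_ne_top ENNReal.ofReal_ne_top (M_cube K 0 k fun x hx => (hKE hx).2)
  refine ⟨K, fun x hx => (hKE hx).1, hK, (M s K).toReal, ENNReal.toReal_pos hM hfin, fun N => ?_⟩
  obtain ⟨T, m, h1, h2, h3, h4⟩ := frost s K N 0 k (M s K).toReal ENNReal.toReal_nonneg
    (by rw [hKc, ENNReal.ofReal_toReal hfin])
  exact ⟨T, m, fun y hy => (h1 y hy).1, h2, h3, fun z r hr => ball_bound hs h2 (fun y hy => (h1 y hy).2)
    (fun l hl k' => h4 l (Nat.zero_le _) (by omega) k') z r hr⟩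

end DD

open MeasureTheory
open scoped ENNReal
set_option autoImplicit false
namespace DD

lemma gauss_sq {V : Type*} [NormedAddCommGroup V] [InnerProductSpace ℝ V] [FiniteDimensional ℝ V]
    [MeasurableSpace V] [BorelSpace V] {ι : Type*} (T : Finset ι) (c : ι → ℂ) (u : ι → V) {b : ℝ} (hb : 0 < b) :
    Integrable (fun z : V => Real.exp (-b * ‖z‖ ^ 2) * ‖∑ i ∈ T, c i * Complex.exp (Complex.I * (inner ℝ (u i) z : ℝ))‖ ^ 2) ∧
    ((∫ z : V, Real.exp (-b * ‖z‖ ^ 2) * ‖∑ i ∈ T, c i * Complex.exp (Complex.I * (inner ℝ (u i) z : ℝ))‖ ^ 2 : ℝ) : ℂ)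
      = (((Real.pi / b) ^ (Module.finrank ℝ V / 2 : ℝ) : ℝ) : ℂ) *
        ∑ i ∈ T, ∑ j ∈ T, c i * (starRingEnd ℂ) (c j) * ((Real.exp (-‖u i - u j‖ ^ 2 / (4 * b)) : ℝ) : ℂ) := by
  have hb' : 0 < (b : ℂ).re := by simpa
  have hpt : ∀ z : V, ((Real.exp (-b * ‖z‖ ^ 2) * ‖∑ i ∈ T, c i * Complex.exp (Complex.I * (inner ℝ (u i) z : ℝ))‖ ^ 2 : ℝ) : ℂ)
      = ∑ i ∈ T, ∑ j ∈ T, c i * (starRingEnd ℂ) (c j) *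
        Complex.exp (-(b : ℂ) * (‖z‖ : ℂ) ^ 2 + Complex.I * (inner ℝ (u i - u j) z : ℝ)) := by
    intro z
    push_cast
    rw [← Complex.mul_conj', map_sum, Finset.sum_mul_sum, Finset.mul_sum]
    refine Finset.sum_congr rfl fun i _ => ?_
    rw [Finset.mul_sum]
    refine Finset.sum_congr rfl fun j _ => ?_
    rw [map_mul, ← Complex.exp_conj, map_mul, Complex.conj_I, Complex.conj_ofReal, Complex.exp_add, inner_sub_left]
    push_cast
    rw [mul_sub, sub_eq_add_neg, Complex.exp_add, neg_mul Complex.I]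
    ring
  have hIntg : ∀ i j, Integrable fun z : V => c i * (starRingEnd ℂ) (c j) *
        Complex.exp (-(b : ℂ) * (‖z‖ : ℂ) ^ 2 + Complex.I * (inner ℝ (u i - u j) z : ℝ)) := fun i j =>
    (GaussianFourier.integrable_cexp_neg_mul_sq_norm_add hb' Complex.I (u i - u j)).const_mul _
  have hI : Integrable (fun z : V => ((Real.exp (-b * ‖z‖ ^ 2) * ‖∑ i ∈ T, c i * Complex.exp (Complex.I * (inner ℝ (u i) z : ℝ))‖ ^ 2 : ℝ) : ℂ)) := by
    simp only [hpt]
    exact integrable_finsetSum _ fun i _ => integrable_finsetSum _ fun j _ => hIntg i j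
  refine ⟨hI.re.congr (Filter.Eventually.of_forall fun z => Complex.ofReal_re _), ?_⟩
  rw [← integral_complex_ofReal]
  simp only [hpt]
  rw [integral_finsetSum _ fun i _ => integrable_finsetSum _ fun j _ => hIntg i j, Finset.mul_sum]
  refine Finset.sum_congr rfl fun i _ => ?_
  rw [integral_finsetSum _ fun j _ => hIntg i j, Finset.mul_sum]
  refine Finset.sum_congr rfl fun j _ => ?_
  rw [integral_const_mul, GaussianFourier.integral_cexp_neg_mul_sq_norm_add hb' Complex.I (u i - u j)]
  rw [Complex.ofReal_cpow (by positivity)]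
  push_cast
  rw [Complex.I_sq]
  have : (-1 * (‖u i - u j‖ : ℂ) ^ 2 / (4 * b)) = -(‖u i - u j‖ : ℂ) ^ 2 / (4 * b) := by ring
  rw [this]
  ring

lemma gauss_sq_le {V : Type*} [NormedAddCommGroup V] [InnerProductSpace ℝ V] [FiniteDimensional ℝ V]
    [MeasurableSpace V] [BorelSpace V] {ι : Type*} (T : Finset ι) (c : ι → ℂ) (u : ι → V) {b : ℝ} (hb : 0 < b) :
    ∫ z : V, Real.exp (-b * ‖z‖ ^ 2) * ‖∑ i ∈ T, c i * Complex.exp (Complex.I * (inner ℝ (u i) z : ℝ))‖ ^ 2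
      ≤ (Real.pi / b) ^ (Module.finrank ℝ V / 2 : ℝ) *
        ∑ i ∈ T, ∑ j ∈ T, ‖c i‖ * ‖c j‖ * Real.exp (-‖u i - u j‖ ^ 2 / (4 * b)) := by
  have h := (gauss_sq T c u hb).2
  have h0 : 0 ≤ ∫ z : V, Real.exp (-b * ‖z‖ ^ 2) * ‖∑ i ∈ T, c i * Complex.exp (Complex.I * (inner ℝ (u i) z : ℝ))‖ ^ 2 :=
    integral_nonneg fun z => by positivity
  rw [← abs_of_nonneg h0, ← Real.norm_eq_abs, ← Complex.norm_real, h, norm_mul, Complex.norm_real,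
    Real.norm_of_nonneg (by positivity)]
  gcongr
  refine (norm_sum_le _ _).trans (Finset.sum_le_sum fun i _ => (norm_sum_le _ _).trans (Finset.sum_le_sum fun j _ => ?_))
  rw [norm_mul, norm_mul, RCLike.norm_conj, Complex.norm_real, Real.norm_of_nonneg (by positivity)]

/-- weighted Cauchy-Schwarz -/
lemma cs {X : Type*} [MeasurableSpace X] {μ : Measure X} {G f : X → ℝ} (hG : ∀ x, 0 ≤ G x) (h0 : Integrable G μ)
    (h1 : Integrable (fun x => G x * f x) μ) (h2 : Integrable (fun x => G x * f x ^ 2) μ) :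
    (∫ x, G x * f x ∂μ) ^ 2 ≤ (∫ x, G x ∂μ) * ∫ x, G x * f x ^ 2 ∂μ := by
  have key : ∀ t : ℝ, 0 ≤ (∫ x, G x ∂μ) * (t * t) + (-2 * ∫ x, G x * f x ∂μ) * t + ∫ x, G x * f x ^ 2 ∂μ := by
    intro t
    have : 0 ≤ ∫ x, G x * (t - f x) ^ 2 ∂μ := integral_nonneg fun x => mul_nonneg (hG x) (sq_nonneg _)
    have e : ∀ x, G x * (t - f x) ^ 2 = (t * t) * G x + (-2 * t) * (G x * f x) + G x * f x ^ 2 := fun x => by ring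
    simp only [e] at this
    have h01 : Integrable (fun x => (t * t) * G x + (-2 * t) * (G x * f x)) μ :=
      (h0.const_mul _).add (h1.const_mul _)
    rw [integral_add h01 h2, integral_add (h0.const_mul _) (h1.const_mul _),
      integral_const_mul, integral_const_mul] at this
    linarith
  have := discrim_le_zero key
  unfold discrim at this
  linarith

lemma gauss_shift {d : ℕ} {τ : ℝ} (hτ : τ ≠ 0) (x y : EuclideanSpace ℝ (Fin d)) :
    Integrable (fun z : EuclideanSpace ℝ (Fin d) => ((Real.exp (-τ ^ 2 * ‖z - x‖ ^ 2) : ℝ) : ℂ) *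
      Complex.exp (Complex.I * (inner ℝ ((-2 * τ) • y) z : ℝ))) ∧
    ∫ z : EuclideanSpace ℝ (Fin d), ((Real.exp (-τ ^ 2 * ‖z - x‖ ^ 2) : ℝ) : ℂ) *
      Complex.exp (Complex.I * (inner ℝ ((-2 * τ) • y) z : ℝ)) =
      (((Real.pi / τ ^ 2) ^ (d / 2 : ℝ) : ℝ) : ℂ) * (((Real.exp (-‖y‖ ^ 2) : ℝ) : ℂ) *
        Complex.exp (Complex.I * (inner ℝ ((-2 * τ) • y) x : ℝ))) := by
  have hb : 0 < τ ^ 2 := by positivity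
  have hb' : 0 < ((τ ^ 2 : ℝ) : ℂ).re := by rw [Complex.ofReal_re]; exact hb
  let f : EuclideanSpace ℝ (Fin d) → ℂ := fun z => Complex.exp (Complex.I * (inner ℝ ((-2 * τ) • y) x : ℝ)) * 
    Complex.exp (-((τ ^ 2 : ℝ) : ℂ) * (‖z‖ : ℂ) ^ 2 + Complex.I * (inner ℝ ((-2 * τ) • y) z : ℝ))
  have hf : Integrable f := (GaussianFourier.integrable_cexp_neg_mul_sq_norm_add hb' Complex.I ((-2 * τ) • y)).const_mul _
  have e : (fun z : EuclideanSpace ℝ (Fin d) => ((Real.exp (-τ ^ 2 * ‖z - x‖ ^ 2) : ℝ) : ℂ) *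
      Complex.exp (Complex.I * (inner ℝ ((-2 * τ) • y) z : ℝ))) = fun z => f (z - x) := by
    funext z
    simp only [f]
    rw [inner_sub_right]
    push_cast
    rw [mul_sub, ← Complex.exp_add, ← Complex.exp_add]
    congr 1
    ring
  rw [e]
  refine ⟨hf.comp_sub_right x, ?_⟩
  rw [integral_sub_right_eq_self f x]
  simp only [f]
  rw [integral_const_mul, GaussianFourier.integral_cexp_neg_mul_sq_norm_add hb' Complex.I]
  rw [Complex.ofReal_cpow (by positivity), finrank_euclideanSpace_fin, Complex.I_sq, norm_smul]
  have : (-1 * ((‖-2 * τ‖ * ‖y‖ : ℝ) : ℂ) ^ 2 / (4 * ((τ ^ 2 : ℝ) : ℂ))) = ((-‖y‖ ^ 2 : ℝ) : ℂ) := by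
    rw [← Complex.ofReal_pow, mul_pow, Real.norm_eq_abs, sq_abs]
    have : (τ : ℂ) ≠ 0 := by exact_mod_cast hτ
    push_cast
    field_simp
    norm_num [mul_comm]
  rw [this]
  push_cast
  ring

lemma A_bound {d : ℕ} {τ : ℝ} (hτ : 1 ≤ |τ|) (T : Finset (EuclideanSpace ℝ (Fin d))) (m : EuclideanSpace ℝ (Fin d) → ℝ)
    (hm : ∀ y, 0 ≤ m y) {ρ γ : ℝ} (hρ : ∀ y ∈ T, ‖y‖ ≤ ρ)
    (hγ : ∀ z, ∑ y ∈ T, m y * Real.exp (-τ ^ 2 * ‖y - z‖ ^ 2 / 2) ≤ γ) :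
    ∑ x ∈ T, m x * ‖∑ y ∈ T, (m y : ℂ) * Complex.exp (Complex.I * (τ * ‖x - y‖ ^ 2 : ℝ))‖ ^ 2 ≤
      ((Real.pi / τ ^ 2) ^ (d / 2 : ℝ))⁻¹ * (γ * Real.exp (ρ ^ 2 / 2)) * ((Real.pi / (1 / 4)) ^ (d / 2 : ℝ) * 
        (Real.exp (2 * ρ ^ 2) * ((∑ y ∈ T, m y) * γ))) := by
  have hτ0 : τ ≠ 0 := by rintro rfl; simp at hτ; linarith
  have hτ2 : 1 ≤ τ ^ 2 := by rw [← sq_abs]; nlinarith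
  set P := (Real.pi / τ ^ 2) ^ (d / 2 : ℝ) with hP
  have hP0 : 0 < P := by positivity
  let c : EuclideanSpace ℝ (Fin d) → ℂ := fun y => (m y : ℂ) * Complex.exp (Complex.I * (τ * ‖y‖ ^ 2 : ℝ)) * ((Real.exp (‖y‖ ^ 2) : ℝ) : ℂ)
  have hcn : ∀ y, ‖c y‖ = m y * Real.exp (‖y‖ ^ 2) := by
    intro y
    simp only [c]
    rw [norm_mul, norm_mul, Complex.norm_real, Complex.norm_real, mul_comm Complex.I, Complex.norm_exp_ofReal_mul_I,
      Real.norm_of_nonneg (hm y), Real.norm_of_nonneg (by positivity), mul_one]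
  let u : EuclideanSpace ℝ (Fin d) → EuclideanSpace ℝ (Fin d) := fun y => (-2 * τ) • y
  let H : EuclideanSpace ℝ (Fin d) → ℂ := fun z => ∑ y ∈ T, c y * Complex.exp (Complex.I * (inner ℝ (u y) z : ℝ))
  let G : EuclideanSpace ℝ (Fin d) → EuclideanSpace ℝ (Fin d) → ℝ := fun x z => Real.exp (-τ ^ 2 * ‖z - x‖ ^ 2)
  have hHc : Continuous H := by fun_prop
  have hHb : ∀ z, ‖H z‖ ≤ ∑ y ∈ T, ‖c y‖ := fun z => by
    refine (norm_sum_le _ _).trans (Finset.sum_le_sum fun y _ => ?_)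
    rw [norm_mul, mul_comm Complex.I, Complex.norm_exp_ofReal_mul_I, mul_one]
  have hG0 : ∀ x, Integrable (G x) ∧ ∫ z, G x z = P := by
    intro x
    have := gauss_shift hτ0 x 0
    simp only [smul_zero, inner_zero_left, Complex.ofReal_zero, mul_zero, Complex.exp_zero, mul_one, norm_zero] at this
    refine ⟨this.1.re.congr (Filter.Eventually.of_forall fun z => Complex.ofReal_re _), ?_⟩
    have h2 := this.2
    rw [integral_complex_ofReal] at h2
    simpa [P, G] using Complex.ofReal_injective (by simpa using h2)
  have hG1 : ∀ x, Integrable (fun z => G x z * ‖H z‖) := fun x =>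
    (hG0 x).1.mul_bdd (c := ∑ y ∈ T, ‖c y‖) hHc.norm.aestronglyMeasurable
      (Filter.Eventually.of_forall fun z => by rw [norm_norm]; exact hHb z)
  have hG2 : ∀ x, Integrable (fun z => G x z * ‖H z‖ ^ 2) := fun x =>
    (hG0 x).1.mul_bdd (c := (∑ y ∈ T, ‖c y‖) ^ 2) (hHc.norm.pow 2).aestronglyMeasurable
      (Filter.Eventually.of_forall fun z => by
        rw [Real.norm_of_nonneg (by positivity)]; exact pow_le_pow_left₀ (norm_nonneg _) (hHb z) 2)
  have hh : ∀ x, ‖∑ y ∈ T, (m y : ℂ) * Complex.exp (Complex.I * (τ * ‖x - y‖ ^ 2 : ℝ))‖ ^ 2 ≤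
      P⁻¹ * ∫ z, G x z * ‖H z‖ ^ 2 := by
    intro x
    have e1 : ∑ y ∈ T, (m y : ℂ) * Complex.exp (Complex.I * (τ * ‖x - y‖ ^ 2 : ℝ)) =
       Complex.exp ((τ * ‖x‖ ^ 2 : ℝ) * Complex.I) * ∑ y ∈ T, (m y : ℂ) * Complex.exp (Complex.I * (τ * ‖y‖ ^ 2 : ℝ)) *
        Complex.exp (Complex.I * (inner ℝ (u y) x : ℝ)) := by
      rw [Finset.mul_sum]
      refine Finset.sum_congr rfl fun y _ => ?_
      rw [mul_left_comm, mul_assoc, ← Complex.exp_add, ← Complex.exp_add]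
      congr 2
      simp only [u]
      rw [norm_sub_sq_real, inner_smul_left, real_inner_comm x y]
      push_cast
      simp only [map_mul, map_neg, map_ofNat, Complex.conj_ofReal, conj_trivial]
      push_cast
      ring
    have e2 : ∫ z, ((G x z : ℝ) : ℂ) * H z = (P : ℂ) * ∑ y ∈ T, (m y : ℂ) * Complex.exp (Complex.I * (τ * ‖y‖ ^ 2 : ℝ)) *
        Complex.exp (Complex.I * (inner ℝ (u y) x : ℝ)) := by
      have : ∀ z, ((G x z : ℝ) : ℂ) * H z = ∑ y ∈ T, c y * (((G x z : ℝ) : ℂ) * Complex.exp (Complex.I * (inner ℝ (u y) z : ℝ))) := by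
        intro z
        simp only [H, Finset.mul_sum]
        refine Finset.sum_congr rfl fun y _ => by ring
      simp only [this]
      rw [integral_finsetSum _ fun y _ => ((gauss_shift hτ0 x y).1.const_mul _), Finset.mul_sum]
      refine Finset.sum_congr rfl fun y _ => ?_
      rw [integral_const_mul, (gauss_shift hτ0 x y).2]
      simp only [c]
      have : ((Real.exp (‖y‖ ^ 2) : ℝ) : ℂ) * ((Real.exp (-‖y‖ ^ 2) : ℝ) : ℂ) = 1 := by
        rw [← Complex.ofReal_mul, ← Real.exp_add]; simp
      linear_combination (P : ℂ) * (m y : ℂ) * Complex.exp (Complex.I * (τ * ‖y‖ ^ 2 : ℝ)) * Complex.exp (Complex.I * (inner ℝ (u y) x : ℝ)) * this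
    have e3 : P * ‖∑ y ∈ T, (m y : ℂ) * Complex.exp (Complex.I * (τ * ‖x - y‖ ^ 2 : ℝ))‖ ≤ ∫ z, G x z * ‖H z‖ := by
      rw [e1, norm_mul, Complex.norm_exp_ofReal_mul_I, one_mul]
      have := norm_integral_le_integral_norm (fun z => ((G x z : ℝ) : ℂ) * H z) (μ := volume)
      rw [e2, norm_mul, Complex.norm_real, Real.norm_of_nonneg hP0.le] at this
      refine this.trans (le_of_eq (integral_congr_ae (Filter.Eventually.of_forall fun z => ?_)))
      simp only [norm_mul, Complex.norm_real]
      rw [Real.norm_of_nonneg (by positivity)]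
    have e4 := cs (fun z => (by positivity : 0 ≤ G x z)) (hG0 x).1 (hG1 x) (hG2 x)
    rw [(hG0 x).2] at e4
    have e5 := pow_le_pow_left₀ (by positivity) e3 2
    rw [mul_pow] at e5
    rw [inv_mul_eq_div, le_div_iff₀ hP0]
    refine le_of_mul_le_mul_left ?_ hP0
    linarith
  have hγ0 : 0 ≤ γ := le_trans (Finset.sum_nonneg fun y _ => mul_nonneg (hm y) (Real.exp_pos _).le) (hγ 0)
  calc _ ≤ ∑ x ∈ T, m x * (P⁻¹ * ∫ z, G x z * ‖H z‖ ^ 2) := 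
        Finset.sum_le_sum fun x _ => mul_le_mul_of_nonneg_left (hh x) (hm x)
    _ = P⁻¹ * ∫ z, (∑ x ∈ T, m x * G x z) * ‖H z‖ ^ 2 := by
        simp only [Finset.sum_mul, mul_assoc]
        rw [integral_finsetSum _ fun x _ => (hG2 x).const_mul _, Finset.mul_sum]
        refine Finset.sum_congr rfl fun x _ => ?_
        rw [integral_const_mul]; ring
    _ ≤ P⁻¹ * ∫ z, (γ * Real.exp (ρ ^ 2 / 2)) * (Real.exp (-(1 / 4) * ‖z‖ ^ 2) * ‖H z‖ ^ 2) := by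
        refine mul_le_mul_of_nonneg_left ?_ (inv_nonneg.2 hP0.le)
        refine integral_mono ?_ ((gauss_sq T c u (by norm_num : (0 : ℝ) < 1 / 4)).1.const_mul _) fun z => ?_
        · simp only [Finset.sum_mul, mul_assoc]
          exact integrable_finsetSum _ fun x _ => (hG2 x).const_mul _
        · simp only
          rw [← mul_assoc]
          refine mul_le_mul_of_nonneg_right ?_ (by positivity)
          calc ∑ x ∈ T, m x * G x z ≤ ∑ x ∈ T, (m x * Real.exp (-τ ^ 2 * ‖x - z‖ ^ 2 / 2)) * (Real.exp (ρ ^ 2 / 2) * Real.exp (-(1 / 4) * ‖z‖ ^ 2)) := by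
                refine Finset.sum_le_sum fun x hx => ?_
                rw [mul_assoc]
                refine mul_le_mul_of_nonneg_left ?_ (hm x)
                simp only [G]
                rw [← Real.exp_add, ← Real.exp_add, norm_sub_rev x z]
                apply Real.exp_le_exp.2
                have h1 : ‖z‖ ≤ ‖z - x‖ + ρ := by
                  have := norm_add_le (z - x) x
                  rw [sub_add_cancel] at this
                  linarith [hρ x hx]
                have h2 : ‖z‖ ^ 2 ≤ (‖z - x‖ + ρ) ^ 2 := pow_le_pow_left₀ (norm_nonneg _) h1 2
                have h3 : ‖z - x‖ ^ 2 ≤ τ ^ 2 * ‖z - x‖ ^ 2 := le_mul_of_one_le_left (by positivity) hτ2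
                nlinarith [sq_nonneg (‖z - x‖ - ρ)]
            _ ≤ γ * (Real.exp (ρ ^ 2 / 2) * Real.exp (-(1 / 4) * ‖z‖ ^ 2)) := by
                rw [← Finset.sum_mul]
                exact mul_le_mul_of_nonneg_right (hγ z) (by positivity)
            _ = _ := by ring
    _ = P⁻¹ * (γ * Real.exp (ρ ^ 2 / 2)) * ∫ z, (Real.exp (-(1 / 4) * ‖z‖ ^ 2) * ‖H z‖ ^ 2) := by
        rw [integral_const_mul]; ring
    _ ≤ _ := by
        refine mul_le_mul_of_nonneg_left ((gauss_sq_le T c u (by norm_num : (0 : ℝ) < 1 / 4)).trans ?_) (by positivity)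
        rw [finrank_euclideanSpace_fin]
        refine mul_le_mul_of_nonneg_left ?_ (by positivity)
        calc _ ≤ ∑ y ∈ T, ∑ j ∈ T, Real.exp (2 * ρ ^ 2) * (m y * (m j * Real.exp (-τ ^ 2 * ‖j - y‖ ^ 2 / 2))) := by
              refine Finset.sum_le_sum fun y hy => Finset.sum_le_sum fun j hj => ?_
              rw [hcn, hcn]
              have h1 : Real.exp (‖y‖ ^ 2) * Real.exp (‖j‖ ^ 2) ≤ Real.exp (2 * ρ ^ 2) := by
                rw [← Real.exp_add]
                apply Real.exp_le_exp.2
                have := pow_le_pow_left₀ (norm_nonneg _) (hρ y hy) 2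
                have := pow_le_pow_left₀ (norm_nonneg _) (hρ j hj) 2
                linarith
              have h2 : Real.exp (-‖u y - u j‖ ^ 2 / (4 * (1 / 4))) ≤ Real.exp (-τ ^ 2 * ‖j - y‖ ^ 2 / 2) := by
                apply Real.exp_le_exp.2
                simp only [u]
                rw [← smul_sub, norm_smul, mul_pow, Real.norm_eq_abs, sq_abs, norm_sub_rev j y]
                have : 0 ≤ τ ^ 2 * ‖y - j‖ ^ 2 := by positivity
                linarith
              have := mul_le_mul h1 h2 (Real.exp_pos _).le (Real.exp_pos _).le
              have := mul_le_mul_of_nonneg_left this (mul_nonneg (hm y) (hm j))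
              linarith
          _ = Real.exp (2 * ρ ^ 2) * ∑ y ∈ T, m y * ∑ j ∈ T, (m j * Real.exp (-τ ^ 2 * ‖j - y‖ ^ 2 / 2)) := by
              simp only [Finset.mul_sum]
          _ ≤ Real.exp (2 * ρ ^ 2) * ∑ y ∈ T, m y * γ := by
              refine mul_le_mul_of_nonneg_left (Finset.sum_le_sum fun y _ => mul_le_mul_of_nonneg_left (hγ y) (hm y)) (Real.exp_pos _).le
          _ = _ := by rw [Finset.sum_mul]

end DD

open MeasureTheory
open scoped ENNReal
set_option autoImplicit false
namespace DD

lemma one_d {ι : Type*} (T : Finset ι) (m φ : ι → ℝ) (hm : ∀ y, 0 ≤ m y) {δ : ℝ} (hδ : 0 < δ) :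
    Integrable (fun τ : ℝ => Real.exp (-(δ ^ 2 / 2) * τ ^ 2) * ‖∑ y ∈ T, (m y : ℂ) * Complex.exp (Complex.I * (τ * φ y : ℝ))‖ ^ 2) ∧
    ∑ y ∈ T, ∑ y' ∈ T, (if |φ y - φ y'| ≤ δ then m y * m y' else 0) ≤ Real.exp (1 / 2) * δ *
      ∫ τ : ℝ, Real.exp (-(δ ^ 2 / 2) * τ ^ 2) * ‖∑ y ∈ T, (m y : ℂ) * Complex.exp (Complex.I * (τ * φ y : ℝ))‖ ^ 2 := by
  have hb : 0 < δ ^ 2 / 2 := by positivity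
  have h := gauss_sq (V := ℝ) T (fun y => (m y : ℂ)) φ hb
  simp only [Real.norm_eq_abs, sq_abs] at h
  have hin : ∀ a b : ℝ, inner ℝ a b = b * a := fun a b => by simp
  simp only [hin] at h
  refine ⟨h.1, ?_⟩
  have h2 := h.2
  simp only [Complex.conj_ofReal, Module.finrank_self] at h2
  have h3 : ∫ τ : ℝ, Real.exp (-(δ ^ 2 / 2) * τ ^ 2) * ‖∑ y ∈ T, (m y : ℂ) * Complex.exp (Complex.I * (τ * φ y : ℝ))‖ ^ 2
     = (Real.pi / (δ ^ 2 / 2)) ^ ((1 : ℕ) / 2 : ℝ) * ∑ i ∈ T, ∑ j ∈ T, m i * m j * Real.exp (-(φ i - φ j) ^ 2 / (4 * (δ ^ 2 / 2))) := by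
    apply Complex.ofReal_injective
    rw [h2]
    push_cast
    rfl
  rw [h3]
  have h4 : 1 ≤ δ * (Real.pi / (δ ^ 2 / 2)) ^ ((1 : ℕ) / 2 : ℝ) := by
    rw [Nat.cast_one, ← Real.sqrt_eq_rpow]
    have : 1 / δ ≤ √(Real.pi / (δ ^ 2 / 2)) := by
      apply Real.le_sqrt_of_sq_le
      rw [div_pow, one_pow, div_div_eq_mul_div]
      gcongr
      linarith [Real.pi_gt_three]
    calc 1 = δ * (1 / δ) := by field_simp
      _ ≤ _ := by gcongr
  have h5 : ∑ y ∈ T, ∑ y' ∈ T, (if |φ y - φ y'| ≤ δ then m y * m y' else 0) ≤ Real.exp (1 / 2) * 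
      ∑ i ∈ T, ∑ j ∈ T, m i * m j * Real.exp (-(φ i - φ j) ^ 2 / (4 * (δ ^ 2 / 2))) := by
    rw [Finset.mul_sum]
    refine Finset.sum_le_sum fun i _ => ?_
    rw [Finset.mul_sum]
    refine Finset.sum_le_sum fun j _ => ?_
    have hmm := mul_nonneg (hm i) (hm j)
    split_ifs with hc
    · rw [mul_left_comm, ← Real.exp_add]
      refine le_mul_of_one_le_right hmm (Real.one_le_exp ?_)
      have : (φ i - φ j) ^ 2 ≤ δ ^ 2 := by rw [← sq_abs]; exact pow_le_pow_left₀ (abs_nonneg _) hc 2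
      have : (φ i - φ j) ^ 2 / (4 * (δ ^ 2 / 2)) ≤ 1 / 2 := by
        rw [div_le_iff₀ (by positivity)]; linarith
      rw [neg_div]; linarith
    · positivity
  refine h5.trans ?_
  have h6 : 0 ≤ ∑ i ∈ T, ∑ j ∈ T, m i * m j * Real.exp (-(φ i - φ j) ^ 2 / (4 * (δ ^ 2 / 2))) :=
    Finset.sum_nonneg fun i _ => Finset.sum_nonneg fun j _ => mul_nonneg (mul_nonneg (hm i) (hm j)) (Real.exp_pos _).le
  calc _ ≤ Real.exp (1 / 2) * ((δ * (Real.pi / (δ ^ 2 / 2)) ^ ((1 : ℕ) / 2 : ℝ)) * ∑ i ∈ T, ∑ j ∈ T, m i * m j * Real.exp (-(φ i - φ j) ^ 2 / (4 * (δ ^ 2 / 2)))) := by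
        refine mul_le_mul_of_nonneg_left (le_mul_of_one_le_left h6 h4) (Real.exp_pos _).le
    _ = _ := by ring

lemma gamma_sum (s : ℝ) : Summable fun k : ℕ => Real.exp (-(k : ℝ) ^ 2 / 2) * ((k : ℝ) + 1) ^ s := by
  obtain ⟨D, hD⟩ := exists_nat_ge s
  have h := (Real.summable_pow_mul_exp_neg_nat_mul D (r := 1 / 2) (by norm_num))
  have h' := ((summable_nat_add_iff 1).2 h).mul_left (Real.exp (1 / 2))
  refine Summable.of_nonneg_of_le (fun k => by positivity) (fun k => ?_) h'
  have h1 : ((k : ℝ) + 1) ^ s ≤ ((k : ℝ) + 1) ^ D := by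
    rw [← Real.rpow_natCast]
    exact Real.rpow_le_rpow_of_exponent_le (by linarith [(Nat.cast_nonneg k : (0 : ℝ) ≤ k)]) hD
  have h2 : Real.exp (-(k : ℝ) ^ 2 / 2) ≤ Real.exp (1 / 2) * Real.exp (-(1 / 2) * ((k + 1 : ℕ) : ℝ)) := by
    rw [← Real.exp_add]
    apply Real.exp_le_exp.2
    have : (k : ℝ) ≤ (k : ℝ) ^ 2 := by exact_mod_cast Nat.le_self_pow (by norm_num) k
    push_cast
    linarith
  calc _ ≤ (Real.exp (1 / 2) * Real.exp (-(1 / 2) * ((k + 1 : ℕ) : ℝ))) * ((k : ℝ) + 1) ^ D := by gcongr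
    _ = _ := by push_cast; ring

lemma gamma_bound {d : ℕ} {s : ℝ} {T : Finset (EuclideanSpace ℝ (Fin d))} {m : EuclideanSpace ℝ (Fin d) → ℝ}
    (hm : ∀ y, 0 ≤ m y) {C r : ℝ} (hr : 0 < r) (hC : 0 ≤ C) (z : EuclideanSpace ℝ (Fin d))
    (h : ∀ r', r ≤ r' → ∑ y ∈ T with dist y z ≤ r', m y ≤ C * r' ^ s) :
    ∑ y ∈ T, m y * Real.exp (-(‖y - z‖ / r) ^ 2 / 2) ≤
      C * (∑' k : ℕ, Real.exp (-(k : ℝ) ^ 2 / 2) * ((k : ℝ) + 1) ^ s) * r ^ s := by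
  classical
  let g : EuclideanSpace ℝ (Fin d) → ℕ := fun y => ⌊‖y - z‖ / r⌋₊
  rw [← Finset.sum_fiberwise_of_maps_to (t := T.image g) (g := g) (fun y hy => Finset.mem_image_of_mem g hy)]
  calc _ ≤ ∑ k ∈ T.image g, C * r ^ s * (Real.exp (-(k : ℝ) ^ 2 / 2) * ((k : ℝ) + 1) ^ s) := by
        refine Finset.sum_le_sum fun k _ => ?_
        calc _ ≤ ∑ y ∈ T with g y = k, m y * Real.exp (-(k : ℝ) ^ 2 / 2) := by
              refine Finset.sum_le_sum fun y hy => mul_le_mul_of_nonneg_left (Real.exp_le_exp.2 ?_) (hm y)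
              have hk := (Finset.mem_filter.1 hy).2
              have : (k : ℝ) ≤ ‖y - z‖ / r := by rw [← hk]; exact Nat.floor_le (by positivity)
              have := pow_le_pow_left₀ (Nat.cast_nonneg k) this 2
              linarith
          _ = (∑ y ∈ T with g y = k, m y) * Real.exp (-(k : ℝ) ^ 2 / 2) := by rw [Finset.sum_mul]
          _ ≤ (C * (((k : ℝ) + 1) * r) ^ s) * Real.exp (-(k : ℝ) ^ 2 / 2) := by
              refine mul_le_mul_of_nonneg_right (le_trans ?_ (h (((k : ℝ) + 1) * r) ?_)) (Real.exp_pos _).le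
              · refine Finset.sum_le_sum_of_subset_of_nonneg ?_ (fun y _ _ => hm y)
                intro y hy
                obtain ⟨h1, hk⟩ := Finset.mem_filter.1 hy
                refine Finset.mem_filter.2 ⟨h1, ?_⟩
                rw [dist_eq_norm, ← div_le_iff₀ hr, ← hk]
                exact (Nat.lt_floor_add_one _).le
              · exact le_mul_of_one_le_left hr.le (by linarith [(Nat.cast_nonneg k : (0 : ℝ) ≤ k)])
          _ = _ := by rw [Real.mul_rpow (by positivity) hr.le]; ring
    _ ≤ C * r ^ s * ∑' k : ℕ, (Real.exp (-(k : ℝ) ^ 2 / 2) * ((k : ℝ) + 1) ^ s) := by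
        rw [← Finset.mul_sum]
        refine mul_le_mul_of_nonneg_left ((gamma_sum s).sum_le_tsum _ fun k _ => by positivity) (by positivity)
    _ = _ := by ring

lemma decay {s : ℝ} (hs : 0 < s) (d : ℝ) : ∃ Cs > 0, ∀ R δ : ℝ, 1 ≤ R → 0 < δ →
    R ^ d * (max (1 / R) δ ^ s) ^ 2 * Real.exp (-(δ ^ 2 / 2) * R ^ 2) ≤ Cs * R ^ (d - 2 * s) := by
  obtain ⟨D, hD⟩ := exists_nat_ge s
  refine ⟨2 ^ D * D.factorial, by positivity, fun R δ hR hδ => ?_⟩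
  have hR0 : 0 < R := by linarith
  set v := max 1 (δ * R) with hv
  have hv1 : 1 ≤ v := le_max_left _ _
  have e1 : max (1 / R) δ = v / R := by
    rw [hv, ← max_div_div_right hR0.le, mul_div_cancel_right₀ _ hR0.ne']
  have e2 : R ^ d * (max (1 / R) δ ^ s) ^ 2 = (v ^ s) ^ 2 * R ^ (d - 2 * s) := by
    rw [e1, Real.div_rpow (by positivity) hR0.le, Real.rpow_sub hR0, mul_comm 2 s, Real.rpow_mul hR0.le, div_pow]
    rw [Real.rpow_two]
    ring
  have e3 : (v ^ s) ^ 2 * Real.exp (-(δ ^ 2 / 2) * R ^ 2) ≤ 2 ^ D * D.factorial := by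
    rcases le_total (δ * R) 1 with h | h
    · rw [hv, max_eq_left h, Real.one_rpow, one_pow, one_mul]
      calc _ ≤ (1 : ℝ) := Real.exp_le_one_iff.2 (by
            have : 0 ≤ δ ^ 2 / 2 * R ^ 2 := by positivity
            linarith)
        _ ≤ _ := by
            have : (1 : ℝ) ≤ D.factorial := by exact_mod_cast Nat.factorial_pos D
            exact one_le_mul_of_one_le_of_one_le (one_le_pow₀ (by norm_num)) this
    · rw [hv, max_eq_right h]
      have h1 : ((δ * R) ^ s) ^ 2 ≤ ((δ * R) ^ 2) ^ D := by
        have : (δ * R) ^ s ≤ (δ * R) ^ D := by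
          rw [← Real.rpow_natCast]; exact Real.rpow_le_rpow_of_exponent_le h hD
        calc _ ≤ ((δ * R) ^ D) ^ 2 := pow_le_pow_left₀ (by positivity) this 2
          _ = _ := by ring
      have h2 := Real.pow_div_factorial_le_exp (x := (δ * R) ^ 2 / 2) (by positivity) D
      rw [div_le_iff₀ (by positivity), div_pow, div_le_iff₀ (by positivity)] at h2
      have h3 : -(δ ^ 2 / 2) * R ^ 2 = -((δ * R) ^ 2 / 2) := by ring
      rw [h3, Real.exp_neg, ← div_eq_mul_inv, div_le_iff₀ (Real.exp_pos _)]
      linarith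
  rw [e2, mul_right_comm]
  exact mul_le_mul_of_nonneg_right e3 (by positivity)

theorem pinned {d : ℕ} {s : ℝ} (hs : (d + 1 : ℝ) < 2 * s) {ρ C0 a : ℝ} (hC0 : 0 ≤ C0) (ha : 0 < a) :
    ∃ C1 > 0, ∀ δ : ℝ, 0 < δ → ∀ (T : Finset (EuclideanSpace ℝ (Fin d))) (m : EuclideanSpace ℝ (Fin d) → ℝ),
      (∀ y ∈ T, ‖y‖ ≤ ρ) → (∀ y, 0 ≤ m y) → ∑ y ∈ T, m y = a →
      (∀ z r, δ ≤ r → ∑ y ∈ T with dist y z ≤ r, m y ≤ C0 * r ^ s) →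
      ∃ x ∈ T, ∑ y ∈ T, ∑ y' ∈ T, (if |‖x - y‖ ^ 2 - ‖x - y'‖ ^ 2| ≤ δ then m y * m y' else 0) ≤ C1 * δ := by
  have hs0 : 0 < s := by linarith [(Nat.cast_nonneg d : (0 : ℝ) ≤ d)]
  obtain ⟨Cs, hCs, hdec⟩ := decay hs0 d
  set Cg := ∑' k : ℕ, Real.exp (-(k : ℝ) ^ 2 / 2) * ((k : ℝ) + 1) ^ s with hCg
  have hCg0 : 0 ≤ Cg := tsum_nonneg fun k => by positivity
  set p := 2 * s - d with hp
  set Q : ℝ := (Real.pi ^ (d / 2 : ℝ))⁻¹ * ((C0 * Cg) ^ 2 * Real.exp (ρ ^ 2 / 2)) * ((Real.pi / (1 / 4)) ^ (d / 2 : ℝ) * 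
        (Real.exp (2 * ρ ^ 2) * a)) with hQ
  have hQ0 : 0 ≤ Q := by positivity
  set B : ℝ := (a ^ 3 + Q * Cs) * 2 ^ (p / 2) with hB
  have hB0 : 0 < B := by positivity
  have hIntg : Integrable fun τ : ℝ => ((1 : ℝ) + ‖τ‖ ^ 2) ^ (-p / 2) :=
    integrable_rpow_neg_one_add_norm_sq (by simp; linarith)
  set J := ∫ τ : ℝ, ((1 : ℝ) + ‖τ‖ ^ 2) ^ (-p / 2) with hJ
  have hJ0 : 0 ≤ J := integral_nonneg fun τ => by positivity
  refine ⟨Real.exp (1 / 2) * (B * J) / a + 1, by positivity, ?_⟩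
  intro δ hδ T m hρ hm hma hball
  by_contra! hcon
  let h : EuclideanSpace ℝ (Fin d) → ℝ → ℝ := fun x τ => ‖∑ y ∈ T, (m y : ℂ) * Complex.exp (Complex.I * (τ * ‖x - y‖ ^ 2 : ℝ))‖ ^ 2
  have h1d := fun x => one_d T m (fun y => ‖x - y‖ ^ 2) hm hδ
  -- pointwise bound
  have hpt : ∀ τ : ℝ, ∑ x ∈ T, m x * (Real.exp (-(δ ^ 2 / 2) * τ ^ 2) * h x τ) ≤ B * ((1 : ℝ) + ‖τ‖ ^ 2) ^ (-p / 2) := by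
    intro τ
    have epull : ∑ x ∈ T, m x * (Real.exp (-(δ ^ 2 / 2) * τ ^ 2) * h x τ) = (∑ x ∈ T, m x * h x τ) * Real.exp (-(δ ^ 2 / 2) * τ ^ 2) := by
      rw [Finset.sum_mul]
      exact Finset.sum_congr rfl fun x _ => by ring
    rw [epull, Real.norm_eq_abs, neg_div, Real.rpow_neg (by positivity)]
    have hX : 0 < (1 + |τ| ^ 2) ^ (p / 2) := by positivity
    rw [← div_eq_mul_inv, le_div_iff₀ hX]
    rcases le_or_gt 1 |τ| with hτ | hτ
    · have hτpos : 0 < |τ| := by linarith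
      set r := max (1 / |τ|) δ with hr
      have hr0 : 0 < r := lt_of_lt_of_le hδ (le_max_right _ _)
      have hγ : ∀ z, ∑ y ∈ T, m y * Real.exp (-τ ^ 2 * ‖y - z‖ ^ 2 / 2) ≤ C0 * Cg * r ^ s := by
        intro z
        refine le_trans ?_ (gamma_bound hm hr0 hC0 z fun r' hr' => hball z r' ((le_max_right _ _).trans hr'))
        refine Finset.sum_le_sum fun y _ => mul_le_mul_of_nonneg_left (Real.exp_le_exp.2 ?_) (hm y)
        have : ‖y - z‖ / r ≤ |τ| * ‖y - z‖ := by
          rw [div_le_iff₀ hr0]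
          have : 1 ≤ |τ| * r := by
            rw [← div_le_iff₀' hτpos]; exact le_max_left _ _
          nlinarith [norm_nonneg (y - z)]
        have := pow_le_pow_left₀ (by positivity) this 2
        rw [mul_pow, sq_abs] at this
        linarith
      have hA := A_bound hτ T m hm hρ hγ
      have eP : ((Real.pi / τ ^ 2) ^ (d / 2 : ℝ))⁻¹ = (Real.pi ^ (d / 2 : ℝ))⁻¹ * |τ| ^ (d : ℝ) := by
        rw [← sq_abs, Real.div_rpow Real.pi_pos.le (by positivity), ← Real.rpow_two, ← Real.rpow_mul hτpos.le, inv_div,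
          mul_div_cancel₀ _ (two_ne_zero), div_eq_inv_mul]
      have e2 : ((Real.pi / τ ^ 2) ^ (d / 2 : ℝ))⁻¹ * ((C0 * Cg * r ^ s) * Real.exp (ρ ^ 2 / 2)) * ((Real.pi / (1 / 4)) ^ (d / 2 : ℝ) * 
        (Real.exp (2 * ρ ^ 2) * ((∑ y ∈ T, m y) * (C0 * Cg * r ^ s)))) = Q * (|τ| ^ (d : ℝ) * (r ^ s) ^ 2) := by
        rw [eP, hma, hQ]; ring
      rw [e2] at hA
      have hd := hdec |τ| δ hτ hδ
      rw [sq_abs] at hd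
      have e3 : |τ| ^ ((d : ℝ) - 2 * s) * (1 + |τ| ^ 2) ^ (p / 2) ≤ 2 ^ (p / 2) := by
        have hp' : (d : ℝ) - 2 * s = -p := by rw [hp]; ring
        rw [hp', Real.rpow_neg hτpos.le, inv_mul_le_iff₀ (by positivity)]
        calc (1 + |τ| ^ 2) ^ (p / 2) ≤ (|τ| ^ 2 * 2) ^ (p / 2) := by
              refine Real.rpow_le_rpow (by positivity) (by nlinarith) (by linarith)
          _ = _ := by
              rw [Real.mul_rpow (by positivity) (by positivity), ← Real.rpow_two, ← Real.rpow_mul hτpos.le,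
                mul_div_cancel₀ _ (two_ne_zero)]
      calc _ ≤ Q * (|τ| ^ (d : ℝ) * (r ^ s) ^ 2) * Real.exp (-(δ ^ 2 / 2) * τ ^ 2) * (1 + |τ| ^ 2) ^ (p / 2) := by
            gcongr
        _ = Q * (|τ| ^ (d : ℝ) * (r ^ s) ^ 2 * Real.exp (-(δ ^ 2 / 2) * τ ^ 2)) * (1 + |τ| ^ 2) ^ (p / 2) := by ring
        _ ≤ Q * (Cs * |τ| ^ ((d : ℝ) - 2 * s)) * (1 + |τ| ^ 2) ^ (p / 2) := by gcongr
        _ = Q * Cs * (|τ| ^ ((d : ℝ) - 2 * s) * (1 + |τ| ^ 2) ^ (p / 2)) := by ring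
        _ ≤ Q * Cs * 2 ^ (p / 2) := by gcongr
        _ ≤ B := by
            rw [hB]
            refine mul_le_mul_of_nonneg_right ?_ (by positivity)
            have : 0 < a ^ 3 := by positivity
            linarith
    · have hh : ∀ x, h x τ ≤ a ^ 2 := by
        intro x
        refine pow_le_pow_left₀ (norm_nonneg _) ?_ 2
        refine (norm_sum_le _ _).trans (le_of_eq ?_)
        rw [← hma]
        refine Finset.sum_congr rfl fun y _ => ?_
        rw [norm_mul, mul_comm Complex.I, Complex.norm_exp_ofReal_mul_I, mul_one, Complex.norm_real, Real.norm_of_nonneg (hm y)]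
      have h1 : ∑ x ∈ T, m x * h x τ ≤ a ^ 3 := by
        calc _ ≤ ∑ x ∈ T, m x * a ^ 2 := Finset.sum_le_sum fun x _ => mul_le_mul_of_nonneg_left (hh x) (hm x)
          _ = a ^ 3 := by rw [← Finset.sum_mul, hma]; ring
      have h2 : Real.exp (-(δ ^ 2 / 2) * τ ^ 2) ≤ 1 := Real.exp_le_one_iff.2 (by
            have : 0 ≤ δ ^ 2 / 2 * τ ^ 2 := by positivity
            linarith)
      have h3 : (1 + |τ| ^ 2) ^ (p / 2) ≤ 2 ^ (p / 2) :=
        Real.rpow_le_rpow (by positivity) (by nlinarith [abs_nonneg τ]) (by linarith)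
      calc _ ≤ a ^ 3 * 1 * 2 ^ (p / 2) := by gcongr
        _ ≤ B := by
            rw [hB]
            refine mul_le_mul_of_nonneg_right ?_ (by positivity)
            have : 0 ≤ Q * Cs := by positivity
            linarith
  have htot : ∑ x ∈ T, m x * ∫ τ : ℝ, Real.exp (-(δ ^ 2 / 2) * τ ^ 2) * h x τ ≤ B * J := by
    simp only [← integral_const_mul]
    rw [← integral_finsetSum _ fun x _ => (h1d x).1.const_mul _, hJ, ← integral_const_mul]
    exact integral_mono (integrable_finsetSum _ fun x _ => (h1d x).1.const_mul _) (hIntg.const_mul _) hpt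
  have hlow : a * ((Real.exp (1 / 2) * (B * J) / a + 1) * δ) ≤ Real.exp (1 / 2) * δ * (B * J) := by
    calc _ = ∑ x ∈ T, m x * ((Real.exp (1 / 2) * (B * J) / a + 1) * δ) := by rw [← Finset.sum_mul, hma]
      _ ≤ ∑ x ∈ T, m x * (Real.exp (1 / 2) * δ * ∫ τ : ℝ, Real.exp (-(δ ^ 2 / 2) * τ ^ 2) * h x τ) :=
          Finset.sum_le_sum fun x hx => mul_le_mul_of_nonneg_left ((hcon x hx).le.trans (h1d x).2) (hm x)
      _ = Real.exp (1 / 2) * δ * ∑ x ∈ T, m x * ∫ τ : ℝ, Real.exp (-(δ ^ 2 / 2) * τ ^ 2) * h x τ := by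
          rw [Finset.mul_sum]; exact Finset.sum_congr rfl fun x _ => by ring
      _ ≤ _ := by gcongr
  have : a * ((Real.exp (1 / 2) * (B * J) / a + 1) * δ) = Real.exp (1 / 2) * δ * (B * J) + a * δ := by
    field_simp
  have : 0 < a * δ := by positivity
  linarith

end DD

open MeasureTheory
open scoped ENNReal
set_option autoImplicit false
namespace DD

lemma vol_lower {ι : Type*} (T : Finset ι) (m φ : ι → ℝ) (hm : ∀ y, 0 ≤ m y) {δ C1 a : ℝ} (hδ : 0 < δ)
    (hC1 : 0 < C1) (ha : ∑ y ∈ T, m y = a)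
    (h : ∑ y ∈ T, ∑ y' ∈ T, (if |φ y - φ y'| ≤ δ then m y * m y' else 0) ≤ C1 * δ) :
    a ^ 2 / C1 ≤ volume.real (⋃ y ∈ T, Set.Icc (φ y - δ / 2) (φ y + δ / 2)) := by
  set I : ι → Set ℝ := fun y => Set.Icc (φ y - δ / 2) (φ y + δ / 2) with hI
  set U : Set ℝ := ⋃ y ∈ T, I y with hU
  set f : ℝ → ℝ := fun t => ∑ y ∈ T, m y * (I y).indicator 1 t with hf
  set G : ℝ → ℝ := U.indicator 1 with hG
  have hIm : ∀ y, MeasurableSet (I y) := fun y => measurableSet_Icc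
  have hUm : MeasurableSet U := T.measurableSet_biUnion fun y _ => hIm y
  have hIv : ∀ y, volume.real (I y) = δ := fun y => by
    rw [hI]; simp only [Real.volume_real_Icc]; rw [max_eq_left (by linarith)]; ring
  have hUc : IsCompact U := T.isCompact_biUnion fun y _ => isCompact_Icc
  have hii : ∀ S : Set ℝ, MeasurableSet S → volume S ≠ ∞ → Integrable (S.indicator (1 : ℝ → ℝ)) := by
    intro S hS hS'
    exact (integrable_indicator_iff hS).2 (integrableOn_const hS')
  have hvS : ∀ S : Set ℝ, MeasurableSet S → ∫ t, S.indicator (1 : ℝ → ℝ) t = volume.real S := by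
    intro S hS
    exact integral_indicator_one hS
  have hGint : Integrable G := hii U hUm hUc.measure_lt_top.ne
  have hGI : ∀ y ∈ T, ∀ t, G t * (I y).indicator 1 t = (I y).indicator 1 t := by
    intro y hy t
    by_cases ht : t ∈ I y
    · have : t ∈ U := Set.mem_biUnion (Finset.mem_coe.2 hy) ht
      simp [hG, ht, this]
    · simp [ht]
  have hGf : ∀ t, G t * f t = ∑ y ∈ T, m y * (I y).indicator 1 t := by
    intro t
    simp only [hf, Finset.mul_sum]
    refine Finset.sum_congr rfl fun y hy => ?_
    rw [← hGI y hy t]; rw [hGI y hy t]; rw [mul_left_comm, hGI y hy t]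
  have hGf2 : ∀ t, G t * f t ^ 2 = ∑ y ∈ T, ∑ y' ∈ T, m y * m y' * (I y ∩ I y').indicator 1 t := by
    intro t
    rw [sq, ← mul_assoc, hGf]
    simp only [hf, Finset.sum_mul_sum]
    refine Finset.sum_congr rfl fun y hy => Finset.sum_congr rfl fun y' hy' => ?_
    rw [Set.inter_indicator_one, Pi.mul_apply]; ring
  have hi1 : ∀ y ∈ T, Integrable (fun t => m y * (I y).indicator (1 : ℝ → ℝ) t) := fun y _ =>
    (hii _ (hIm y) isCompact_Icc.measure_lt_top.ne).const_mul _
  have hi2 : ∀ y ∈ T, ∀ y' ∈ T, Integrable (fun t => m y * m y' * (I y ∩ I y').indicator (1 : ℝ → ℝ) t) :=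
    fun y _ y' _ => (hii _ ((hIm y).inter (hIm y'))
      ((measure_mono Set.inter_subset_left).trans_lt isCompact_Icc.measure_lt_top).ne).const_mul _
  have hcs := cs (μ := volume) (G := G) (f := f) (fun x => Set.indicator_nonneg (fun _ _ => zero_le_one) x) hGint
    (by simp only [hGf]; exact integrable_finsetSum _ hi1)
    (by simp only [hGf2]; exact integrable_finsetSum _ fun y hy => integrable_finsetSum _ (hi2 y hy))
  have h1 : ∫ t, G t * f t = a * δ := by
    simp only [hGf]
    rw [integral_finsetSum _ hi1, ← ha, Finset.sum_mul]
    refine Finset.sum_congr rfl fun y _ => ?_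
    rw [integral_const_mul, hvS _ (hIm y), hIv]
  have h2 : ∫ t, G t * f t ^ 2 ≤ C1 * δ * δ := by
    simp only [hGf2]
    rw [integral_finsetSum _ fun y hy => integrable_finsetSum _ (hi2 y hy)]
    refine le_trans ?_ (mul_le_mul_of_nonneg_right h hδ.le)
    rw [Finset.sum_mul]
    refine Finset.sum_le_sum fun y hy => ?_
    rw [integral_finsetSum _ (hi2 y hy), Finset.sum_mul]
    refine Finset.sum_le_sum fun y' hy' => ?_
    rw [integral_const_mul, hvS _ ((hIm y).inter (hIm y'))]
    split_ifs with hc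
    · refine mul_le_mul_of_nonneg_left ?_ (mul_nonneg (hm _) (hm _))
      rw [← hIv y]
      exact measureReal_mono Set.inter_subset_left isCompact_Icc.measure_lt_top.ne
    · have : I y ∩ I y' = ∅ := by
        rw [Set.eq_empty_iff_forall_notMem]
        rintro t ⟨⟨h1, h2⟩, h3, h4⟩
        exact hc (abs_le.2 ⟨by linarith, by linarith⟩)
      simp [this]
  have h3 : ∫ t, G t = volume.real U := hvS U hUm
  rw [h1, h3] at hcs
  rw [div_le_iff₀ hC1]
  have h4 : (a * δ) ^ 2 ≤ volume.real U * (C1 * δ * δ) :=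
    hcs.trans (mul_le_mul_of_nonneg_left h2 measureReal_nonneg)
  have h5 : 0 < δ ^ 2 := by positivity
  nlinarith

theorem exists_pos {d : ℕ} {s : ℝ} (hs : (d + 1 : ℝ) < 2 * s) (hs0 : 0 < s) {E : Set (EuclideanSpace ℝ (Fin d))}
    (hE : MeasurableSet E) (h : ENNReal.ofReal s < dimH E) :
    ∃ x ∈ E, ∃ K ⊆ E, IsCompact K ∧ 0 < volume ((fun y => ‖x - y‖ ^ 2) '' K) := by
  obtain ⟨K, hKE, hK, a, ha, hT⟩ := frostman hs0 hE h
  obtain ⟨ρ, hρ⟩ := hK.isBounded.exists_norm_le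
  obtain ⟨C1, hC1, hp⟩ := pinned (d := d) hs (ρ := ρ) (C0 := 5 ^ d) (a := a) (by positivity) ha
  have key : ∀ N : ℕ, ∃ x ∈ K, ∃ T : Finset (EuclideanSpace ℝ (Fin d)), (∀ y ∈ T, y ∈ K) ∧
      a ^ 2 / C1 ≤ volume.real (⋃ y ∈ T, Set.Icc (‖x - y‖ ^ 2 - (1 / 2 : ℝ) ^ N / 2) (‖x - y‖ ^ 2 + (1 / 2 : ℝ) ^ N / 2)) := by
    intro N
    obtain ⟨T, m, hTK, hm, hma, hball⟩ := hT N
    obtain ⟨x, hx, hle⟩ := hp ((1 / 2) ^ N) (by positivity) T m (fun y hy => hρ y (hTK y hy)) hm hma hball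
    exact ⟨x, hTK x hx, T, hTK, vol_lower T m (fun y => ‖x - y‖ ^ 2) hm (by positivity) hC1 hma hle⟩
  choose x hxK T hTK hv using key
  obtain ⟨x0, hx0, g, hg, hlim⟩ := hK.tendsto_subseq hxK
  refine ⟨x0, hKE hx0, K, hKE, hK, ?_⟩
  set D := (fun y => ‖x0 - y‖ ^ 2) '' K with hD
  have hDc : IsCompact D := hK.image (by fun_prop)
  have hpos : 0 < a ^ 2 / C1 := by positivity
  have hth : ∀ η > 0, ENNReal.ofReal (a ^ 2 / C1) ≤ volume (Metric.cthickening η D) := by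
    intro η hη
    have l1 : Filter.Tendsto (fun n => ‖x (g n) - x0‖ * (4 * ρ) + (1 / 2 : ℝ) ^ (g n) / 2) Filter.atTop (nhds 0) := by
      have t1 : Filter.Tendsto (fun n => ‖x (g n) - x0‖) Filter.atTop (nhds 0) :=
        tendsto_iff_norm_sub_tendsto_zero.1 hlim
      have t2 : Filter.Tendsto (fun n => (1 / 2 : ℝ) ^ (g n)) Filter.atTop (nhds 0) :=
        (tendsto_pow_atTop_nhds_zero_of_lt_one (by norm_num) (by norm_num)).comp hg.tendsto_atTop
      simpa using (t1.mul_const (4 * ρ)).add (t2.div_const 2)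
    obtain ⟨n, hn⟩ := (l1.eventually_lt_const hη).exists
    have hsub : (⋃ y ∈ T (g n), Set.Icc (‖x (g n) - y‖ ^ 2 - (1 / 2 : ℝ) ^ (g n) / 2) (‖x (g n) - y‖ ^ 2 + (1 / 2 : ℝ) ^ (g n) / 2))
        ⊆ Metric.cthickening η D := by
      intro t ht
      simp only [Set.mem_iUnion] at ht
      obtain ⟨y, hy, h1, h2⟩ := ht
      have hyK := hTK _ y hy
      refine Metric.mem_cthickening_of_dist_le t (‖x0 - y‖ ^ 2) η D ⟨y, hyK, rfl⟩ ?_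
      have e1 : |‖x (g n) - y‖ ^ 2 - ‖x0 - y‖ ^ 2| ≤ ‖x (g n) - x0‖ * (4 * ρ) := by
        have b1 : |‖x (g n) - y‖ - ‖x0 - y‖| ≤ ‖x (g n) - x0‖ := by
          have := abs_norm_sub_norm_le (x (g n) - y) (x0 - y)
          rwa [sub_sub_sub_cancel_right] at this
        have b2 : ‖x (g n) - y‖ ≤ 2 * ρ := by
          have := norm_sub_le (x (g n)) y
          linarith [hρ _ (hxK (g n)), hρ _ hyK]
        have b3 : ‖x0 - y‖ ≤ 2 * ρ := by
          have := norm_sub_le x0 y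
          linarith [hρ _ hx0, hρ _ hyK]
        rw [sq_sub_sq, mul_comm, abs_mul, abs_of_nonneg (by positivity : 0 ≤ ‖x (g n) - y‖ + ‖x0 - y‖)]
        exact mul_le_mul b1 (by linarith) (by positivity) (norm_nonneg _)
      rw [abs_le] at e1
      rw [Real.dist_eq, abs_le]
      constructor <;> linarith
    refine le_trans ?_ (measure_mono hsub)
    refine ENNReal.ofReal_le_of_le_toReal (hv (g n))
  have hfin := tendsto_measure_cthickening_of_isCompact (μ := volume) hDc
  have hfin2 := hfin.mono_left (nhdsWithin_le_nhds (s := Set.Ioi 0))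
  have := ge_of_tendsto hfin2 (by filter_upwards [self_mem_nhdsWithin] with η hη using hth η hη)
  exact lt_of_lt_of_le (ENNReal.ofReal_pos.2 hpos) this

lemma steinhaus {A B : Set ℝ} (hA : MeasurableSet A) (hB : MeasurableSet B) (hA0 : 0 < volume A) (hB0 : 0 < volume B) :
    ∃ u ε : ℝ, 0 < ε ∧ ∀ v, |v - u| < ε → ∃ p ∈ A, ∃ q ∈ B, v = p + q := by
  obtain ⟨u, hu⟩ : ∃ u : ℝ, 0 < volume (A ∩ (fun t => u - t) ⁻¹' B) := by
    by_contra! hcon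
    have hm : ∀ u : ℝ, MeasurableSet ((fun t => u - t) ⁻¹' B) := fun u => (measurable_const.sub measurable_id) hB
    have h0 : ∫⁻ u : ℝ, ∫⁻ t : ℝ, A.indicator 1 t * B.indicator (1 : ℝ → ℝ≥0∞) (u - t) = 0 := by
      rw [lintegral_eq_zero_of_ae_eq_zero]
      refine Filter.Eventually.of_forall fun u => ?_
      have : ∀ t : ℝ, A.indicator 1 t * B.indicator (1 : ℝ → ℝ≥0∞) (u - t)
          = (A ∩ (fun t => u - t) ⁻¹' B).indicator 1 t := by
        intro t
        rw [Set.inter_indicator_one]; rfl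
      simp only [this]
      rw [lintegral_indicator_one (hA.inter (hm u))]
      exact le_antisymm (hcon u) zero_le
    rw [lintegral_lintegral_swap] at h0
    · have : ∀ t : ℝ, ∫⁻ u : ℝ, A.indicator 1 t * B.indicator (1 : ℝ → ℝ≥0∞) (u - t) = A.indicator 1 t * volume B := by
        intro t
        rw [lintegral_const_mul]
        · rw [lintegral_sub_right_eq_self (fun u => B.indicator (1 : ℝ → ℝ≥0∞) u) t, lintegral_indicator_one hB]
        · exact (measurable_one.indicator hB).comp (measurable_id.sub_const t)
      simp only [this] at h0
      rw [lintegral_mul_const _ (measurable_one.indicator hA), lintegral_indicator_one hA] at h0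
      exact mul_ne_zero hA0.ne' hB0.ne' h0
    · refine Measurable.aemeasurable ?_
      exact ((measurable_one.indicator hA).comp measurable_snd).mul
        ((measurable_one.indicator hB).comp (measurable_fst.sub measurable_snd))
  set P := A ∩ (fun t => u - t) ⁻¹' B with hP
  have hPm : MeasurableSet P := hA.inter ((measurable_const.sub measurable_id) hB)
  have hn := Measure.sub_mem_nhds_zero_of_addHaar_pos volume P hPm hu
  obtain ⟨ε, hε, hball⟩ := Metric.mem_nhds_iff.1 hn
  refine ⟨u, ε, hε, fun v hv => ?_⟩
  have := hball (show v - u ∈ Metric.ball 0 ε by simpa using hv)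
  obtain ⟨p, hp, q, hq, hpq⟩ := this
  refine ⟨p, hp.1, u - q, hq.2, ?_⟩
  simp only at hpq
  linarith

lemma split {D : Set ℝ} (hD : MeasurableSet D) (hpos : 0 < volume D) :
    ∃ c, 0 < volume (D ∩ Set.Iio c) ∧ 0 < volume (D ∩ Set.Ioi c) := by
  by_contra! hcon
  have hcon' : ∀ c, volume (D ∩ Set.Iio c) = 0 ∨ volume (D ∩ Set.Ioi c) = 0 := by
    intro c
    rcases eq_or_ne (volume (D ∩ Set.Iio c)) 0 with h | h
    · exact Or.inl h
    · exact Or.inr (le_antisymm (hcon c (pos_iff_ne_zero.2 h)) zero_le)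
  obtain ⟨x, hx, hxl⟩ : ∃ x ∈ D, ∀ ε > 0, 0 < volume (D ∩ Set.Ioo (x - ε) (x + ε)) := by
    obtain ⟨x, hx, h⟩ := exists_mem_forall_mem_nhdsWithin_pos_measure hpos.ne'
    refine ⟨x, hx, fun ε hε => h _ ?_⟩
    exact Filter.inter_mem self_mem_nhdsWithin (mem_nhdsWithin_of_mem_nhds (Ioo_mem_nhds (by linarith) (by linarith)))
  have hD1 : volume (D \ {x}) ≠ 0 := by
    rw [measure_sdiff_null (measure_singleton x)]; exact hpos.ne'
  obtain ⟨y, hy, hyl⟩ := exists_mem_forall_mem_nhdsWithin_pos_measure hD1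
  have hy2 : ∀ ε > 0, 0 < volume (D ∩ Set.Ioo (y - ε) (y + ε)) := fun ε hε =>
    (hyl _ (Filter.inter_mem self_mem_nhdsWithin (mem_nhdsWithin_of_mem_nhds
      (Ioo_mem_nhds (by linarith : y - ε < y) (by linarith))))).trans_le
      (measure_mono (Set.inter_subset_inter_left _ Set.sdiff_subset))
  have fin : ∀ p q : ℝ, p < q → (∀ ε > 0, 0 < volume (D ∩ Set.Ioo (p - ε) (p + ε))) →
      (∀ ε > 0, 0 < volume (D ∩ Set.Ioo (q - ε) (q + ε))) → False := by
    intro p q hpq h1 h2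
    have e : 0 < (q - p) / 2 := by linarith
    rcases hcon' ((p + q) / 2) with h | h
    · exact (h1 _ e).ne' (measure_mono_null (Set.inter_subset_inter_right _ fun t ht => by
        have := ht.2; simp only [Set.mem_Iio]; linarith) h)
    · exact (h2 _ e).ne' (measure_mono_null (Set.inter_subset_inter_right _ fun t ht => by
        have := ht.1; simp only [Set.mem_Ioi]; linarith) h)
  rcases lt_trichotomy x y with h | h | h
  · exact fin x y h hxl hy2
  · exact hy.2 h.symm
  · exact fin y x h hy2 hxl

theorem main (d : ℕ) (hd : 2 ≤ d) (E : Set (EuclideanSpace ℝ (Fin d)))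
    (hE : MeasurableSet E)
    (hdim : ((2 * d + 1 : ℕ) : ℝ≥0∞) / 3 < dimH E) :
    (interior { t : ℝ | ∃ x ∈ E, ∃ y₁ ∈ E, ∃ y₂ ∈ E, y₁ ≠ y₂ ∧
        t = Real.sqrt (‖x - y₁‖ ^ 2 + ‖x - y₂‖ ^ 2) }).Nonempty := by
  obtain ⟨r, hr1, hr2⟩ := ENNReal.lt_iff_exists_nnreal_btwn.1 hdim
  have hr3 : ((2 * d + 1 : ℕ) : ℝ) / 3 < (r : ℝ) := by
    have e : ((2 * d + 1 : ℕ) : ℝ≥0∞) / 3 = (((2 * d + 1 : ℕ) / 3 : NNReal) : ℝ≥0∞) := by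
      rw [ENNReal.coe_div (by norm_num)]; simp
    rw [e, ENNReal.coe_lt_coe] at hr1
    exact_mod_cast hr1
  have hd' : (2 : ℝ) ≤ d := by exact_mod_cast hd
  push_cast at hr3
  obtain ⟨x, hx, K, hKE, hK, hpos⟩ := exists_pos (d := d) (s := r) (by linarith) (by linarith) hE (by simpa using hr2)
  set D := (fun y => ‖x - y‖ ^ 2) '' K with hD
  have hDm : MeasurableSet D := (hK.image (by fun_prop)).measurableSet
  obtain ⟨c, h1, h2⟩ := split hDm hpos
  obtain ⟨u, ε, hε, hu⟩ := steinhaus (hDm.inter measurableSet_Iio) (hDm.inter measurableSet_Ioi) h1 h2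
  have hnn : ∀ v, |v - u| < ε → 0 ≤ v := by
    intro v hv
    obtain ⟨p, ⟨⟨y, _, rfl⟩, _⟩, q, ⟨⟨y', _, rfl⟩, _⟩, rfl⟩ := hu v hv
    positivity
  have hu0 : 0 ≤ u := hnn u (by simpa using hε)
  refine ⟨√u, mem_interior_iff_mem_nhds.2 ?_⟩
  have hev : ∀ᶠ t in nhds (√u), |t ^ 2 - u| < ε ∧ 0 < t := by
    have hupos : 0 < u := by
      have := hnn (u - ε / 2) (by rw [abs_lt]; constructor <;> linarith)
      linarith
    have t1 : Filter.Tendsto (fun t : ℝ => |t ^ 2 - u|) (nhds (√u)) (nhds |√u ^ 2 - u|) := by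
      apply Continuous.tendsto; fun_prop
    rw [Real.sq_sqrt hu0, sub_self, abs_zero] at t1
    exact (t1.eventually_lt_const hε).and (lt_mem_nhds (Real.sqrt_pos.2 hupos))
  filter_upwards [hev] with t ht
  obtain ⟨p, ⟨⟨y, hy, rfl⟩, hyc⟩, q, ⟨⟨y', hy', rfl⟩, hyc'⟩, hv⟩ := hu _ ht.1
  refine ⟨x, hx, y, hKE hy, y', hKE hy', ?_, ?_⟩
  · rintro rfl
    exact lt_asymm (Set.mem_Iio.1 hyc) (Set.mem_Ioi.1 hyc')
  · rw [← Real.sqrt_sq ht.2.le, hv]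

end DD

/-- If `E ⊆ ℝ^d` (`d ≥ 2`) is a Borel set with Hausdorff dimension
`dim E > (2d+1)/3`, then the diagonal distance set
`Δ°^diag(E) = { |(x,x) − (y₁,y₂)| : x, y₁, y₂ ∈ E, y₁ ≠ y₂ }` (Euclidean norm on `ℝ^{2d}`)
has nonempty interior in `ℝ`. -/
theorem stmt_0 (d : ℕ) (hd : 2 ≤ d) (E : Set (EuclideanSpace ℝ (Fin d)))
    (hE : MeasurableSet E)
    (hdim : ((2 * d + 1 : ℕ) : ℝ≥0∞) / 3 < dimH E) :
    (interior { t : ℝ | ∃ x ∈ E, ∃ y₁ ∈ E, ∃ y₂ ∈ E, y₁ ≠ y₂ ∧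
        t = Real.sqrt (‖x - y₁‖ ^ 2 + ‖x - y₂‖ ^ 2) }).Nonempty := by
  exact DD.main d hd E hE hdim
end

section
/- Let d ≥ 2, k ≥ 3, and let E ⊆ ℝ^d be a compact set. If dim(E) > (2d+1)/3 when k = 3, or dim(E) > (k−1)d/k when k ≥ 4, then the k-point diagonal configuration set Δ°_k^diag(E) has non-empty interior in ℝ. -/
section partA
open MeasureTheory Set Filter Topology
open scoped ENNReal NNReal

theorem tree_flow {ι : Type*} (p : ι → ι) (hp : ∀ a, Finite {b // p b = a})
    (H : ℕ → ι → ℝ≥0∞) (hfin : ∀ n a, H n a ≠ ∞)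
    (hsub : ∀ n a, H n a ≤ ∑' b : {b // p b = a}, H (n+1) b) (a0 : ι) :
    ∃ ν : ℕ → ι → ℝ≥0∞, (∀ n a, ν n a ≤ H n a) ∧
      (∀ n, ∑' a, ν n a = H 0 a0) ∧
      (∀ n j (g : ι → ℝ≥0∞), ∑' b, ν (n+j) b * g (p^[j] b) = ∑' a, ν n a * g a) := by
  classical
  let D : ℕ → ι → ℝ≥0∞ := fun n a => ∑' b : {b // p b = a}, H (n+1) b
  have hDfin : ∀ n a, D n a ≠ ∞ := by
    intro n a
    have := hp a
    have := Fintype.ofFinite {b // p b = a}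
    simp only [D, tsum_fintype]
    exact (ENNReal.sum_lt_top.2 fun b _ => (hfin _ _).lt_top).ne
  let ν : ℕ → ι → ℝ≥0∞ := fun n => Nat.rec (fun a => if a = a0 then H 0 a0 else 0)
    (fun n f b => f (p b) * (H (n+1) b / D n (p b))) n
  have hν0 : ν 0 = fun a => if a = a0 then H 0 a0 else 0 := rfl
  have hνs : ∀ n b, ν (n+1) b = ν n (p b) * (H (n+1) b / D n (p b)) := fun n b => rfl
  have hle : ∀ n a, ν n a ≤ H n a := by
    intro n
    induction n with
    | zero => intro a; rw [hν0]; simp only; split_ifs with h <;> simp [h]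
    | succ n ih =>
      intro b
      rw [hνs]
      have h1 : ν n (p b) ≤ D n (p b) := (ih _).trans (hsub n _)
      calc ν n (p b) * (H (n+1) b / D n (p b)) ≤ D n (p b) * (H (n+1) b / D n (p b)) := by gcongr
        _ ≤ H (n+1) b := ENNReal.mul_div_le
  have hstep : ∀ n (g : ι → ℝ≥0∞), ∑' b, ν (n+1) b * g (p b) = ∑' a, ν n a * g a := by
    intro n g
    rw [← (Equiv.sigmaFiberEquiv p).tsum_eq, ENNReal.tsum_sigma']
    refine tsum_congr fun a => ?_
    have : ∀ b : {b // p b = a}, ν (n+1) ((Equiv.sigmaFiberEquiv p) ⟨a, b⟩) *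
        g (p ((Equiv.sigmaFiberEquiv p) ⟨a, b⟩)) = (ν n a * g a / D n a) * H (n+1) b := by
      rintro ⟨b, rfl⟩
      simp only [Equiv.sigmaFiberEquiv, Equiv.coe_fn_mk, hνs, div_eq_mul_inv]
      ring
    simp_rw [this]
    rw [ENNReal.tsum_mul_left]
    change ν n a * g a / D n a * D n a = _
    by_cases h0 : D n a = 0
    · have : ν n a = 0 := le_antisymm (((hle n a).trans (hsub n a)).trans h0.le) bot_le
      simp [this]
    · rw [ENNReal.div_mul_cancel h0 (hDfin n a)]
  have hj : ∀ n j (g : ι → ℝ≥0∞), ∑' b, ν (n+j) b * g (p^[j] b) = ∑' a, ν n a * g a := by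
    intro n j
    induction j with
    | zero => intro g; simp
    | succ j ih =>
      intro g
      have := hstep (n+j) (fun b => g (p^[j] b))
      rw [← ih g, ← this]
      rfl
  refine ⟨ν, hle, ?_, hj⟩
  intro n
  have := hj 0 n (fun _ => 1)
  simp only [zero_add, mul_one] at this
  rw [this, hν0]
  simp

/-- Hausdorff content -/
noncomputable def hContent (X : Type*) [EMetricSpace X] (s : ℝ) (hs : 0 < s) : OuterMeasure X :=
  OuterMeasure.ofFunction (fun A => Metric.ediam A ^ s) (by simp [hs])

theorem hContent_pos {X : Type*} [EMetricSpace X] [MeasurableSpace X] [BorelSpace X]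
    (s : ℝ) (hs : 0 < s) (E : Set X)
    (h : hContent X s hs E = 0) : μH[s] E = 0 := by
  rw [hContent, OuterMeasure.ofFunction_apply] at h
  have hex : ∀ n : ℕ, ∃ t : ℕ → Set X, E ⊆ iUnion t ∧ ∑' i, Metric.ediam (t i) ^ s < ((n:ℝ≥0∞)+1)⁻¹ := by
    intro n
    have : (⨅ (t : ℕ → Set X) (_ : E ⊆ iUnion t), ∑' n, Metric.ediam (t n) ^ s) < ((n:ℝ≥0∞)+1)⁻¹ := by
      rw [h]; simp
    simpa [iInf_lt_iff] using this
  choose t ht1 ht2 using hex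
  have hlim : Tendsto (fun n : ℕ => ((n:ℝ≥0∞)+1)⁻¹) atTop (𝓝 0) := by
    have := (tendsto_add_atTop_iff_nat 1).2 ENNReal.tendsto_inv_nat_nhds_zero
    simpa using this
  have hlim2 : Tendsto (fun n : ℕ => (((n:ℝ≥0∞)+1)⁻¹) ^ (1/s)) atTop (𝓝 0) := by
    have := (ENNReal.continuous_rpow_const (y := 1/s)).tendsto 0 |>.comp hlim
    simpa [hs, Function.comp_def] using this
  have := Measure.hausdorffMeasure_le_liminf_tsum s E (l := atTop) _ hlim2 (fun n i => t n i)
    (Eventually.of_forall fun n i => by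
      have h1 : Metric.ediam (t n i) ^ s ≤ ((n:ℝ≥0∞)+1)⁻¹ :=
        (ENNReal.le_tsum i).trans (ht2 n).le
      calc Metric.ediam (t n i) = (Metric.ediam (t n i) ^ s) ^ (1/s) := by
            rw [← ENNReal.rpow_mul, mul_one_div_cancel hs.ne', ENNReal.rpow_one]
        _ ≤ _ := ENNReal.rpow_le_rpow h1 (by positivity))
    (Eventually.of_forall ht1)
  refine le_antisymm (this.trans ?_) bot_le
  rw [← hlim.liminf_eq]
  exact liminf_le_liminf (Eventually.of_forall fun n => (ht2 n).le)
end partA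

section partB
open MeasureTheory Set Filter Topology
open scoped ENNReal NNReal

/-- index of the dyadic cell of `x` at generation `n` -/
noncomputable def dcell {d : ℕ} (n : ℕ) (x : EuclideanSpace ℝ (Fin d)) : Fin d → ℤ :=
  fun i => ⌊(2:ℝ)^n * x i⌋

def dpar {d : ℕ} (b : Fin d → ℤ) : Fin d → ℤ := fun i => b i / 2

theorem dpar_dcell {d : ℕ} (n : ℕ) (x : EuclideanSpace ℝ (Fin d)) :
    dpar (dcell (n+1) x) = dcell n x := by
  funext i
  simp only [dpar, dcell]
  have := Int.floor_div_natCast ((2:ℝ)^(n+1) * x i) 2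
  push_cast at this
  rw [← this]
  congr 1
  rw [pow_succ]; ring

theorem dpar_iter_dcell {d : ℕ} (n j : ℕ) (x : EuclideanSpace ℝ (Fin d)) :
    dpar^[j] (dcell (n+j) x) = dcell n x := by
  induction j with
  | zero => rfl
  | succ j ih => rw [Function.iterate_succ_apply, ← add_assoc, dpar_dcell, ih]

theorem dpar_fiber {d : ℕ} (a : Fin d → ℤ) : Finite {b // dpar b = a} := by
  apply Set.Finite.to_subtype (s := {b | dpar b = a})
  refine (Set.finite_Icc (fun i => 2 * a i) (fun i => 2 * a i + 1)).subset ?_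
  rintro b rfl
  constructor <;> intro i <;> simp only [dpar] <;> omega

theorem dcell_ediam {d : ℕ} (n : ℕ) (a : Fin d → ℤ) :
    Metric.ediam {x : EuclideanSpace ℝ (Fin d) | dcell n x = a} ≤
      ENNReal.ofReal (Real.sqrt d * (2:ℝ)⁻¹^n) := by
  refine Metric.ediam_le fun x hx y hy => ?_
  rw [edist_dist]
  apply ENNReal.ofReal_le_ofReal
  rw [EuclideanSpace.dist_eq]
  have h2 : (0:ℝ) < 2^n := by positivity
  have : ∀ i, dist (x i) (y i) ^ 2 ≤ ((2:ℝ)⁻¹^n)^2 := by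
    intro i
    gcongr
    have h1 : ⌊(2:ℝ)^n * x i⌋ = ⌊(2:ℝ)^n * y i⌋ := congrFun (hx.trans hy.symm) i
    have h3 := Int.abs_sub_lt_one_of_floor_eq_floor h1
    rw [← mul_sub, abs_mul, abs_of_pos h2] at h3
    rw [Real.dist_eq, inv_pow, ← one_div, le_div_iff₀ h2]
    linarith
  calc √(∑ i, dist (x i) (y i) ^ 2) ≤ √(∑ i : Fin d, ((2:ℝ)⁻¹^n)^2) :=
        Real.sqrt_le_sqrt (Finset.sum_le_sum fun i _ => this i)
    _ = _ := by
        rw [Finset.sum_const, Finset.card_univ, Fintype.card_fin, nsmul_eq_mul, Real.sqrt_mul (by positivity),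
          Real.sqrt_sq (by positivity)]

theorem dcell_near {d : ℕ} (n : ℕ) (x y : EuclideanSpace ℝ (Fin d)) (h : dist y x ≤ (2:ℝ)⁻¹^n) :
    dcell n y ∈ Finset.Icc (dcell n x - 1) (dcell n x + 1) := by
  have h2 : (0:ℝ) < 2^n := by positivity
  have key : ∀ i, |(2:ℝ)^n * y i - 2^n * x i| ≤ 1 := by
    intro i
    have h3 : |y i - x i| ≤ dist y x := by
      rw [dist_eq_norm]
      simpa using PiLp.norm_apply_le (y - x) i
    rw [← mul_sub, abs_mul, abs_of_pos h2]
    calc (2:ℝ)^n * |y i - x i| ≤ 2^n * (2:ℝ)⁻¹^n := by gcongr; linarith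
      _ = 1 := by rw [← mul_pow]; simp
  rw [Finset.mem_Icc]
  constructor <;> intro i <;> simp only [dcell, Pi.sub_apply, Pi.add_apply, Pi.one_apply] <;>
    have := abs_le.1 (key i)
  · rw [← Int.floor_sub_one]
    apply Int.floor_le_floor; linarith
  · rw [← Int.floor_add_one]
    apply Int.floor_le_floor; linarith

theorem frostman {d : ℕ} (E : Set (EuclideanSpace ℝ (Fin d))) (hE : IsCompact E) (s : ℝ)
    (hs : 0 < s) (hH : μH[s] E ≠ 0) :
    ∃ μ : Measure (EuclideanSpace ℝ (Fin d)), IsProbabilityMeasure μ ∧ μ Eᶜ = 0 ∧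
      ∃ C : ℝ, 0 ≤ C ∧ ∀ x r, 0 < r → μ (Metric.ball x r) ≤ ENNReal.ofReal (C * r ^ s) := by
  classical
  set m := hContent (EuclideanSpace ℝ (Fin d)) s hs with hm
  have hm0 : m E ≠ 0 := fun h => hH (hContent_pos s hs E h)
  have hmle : ∀ A, m A ≤ Metric.ediam A ^ s := fun A => OuterMeasure.ofFunction_le A
  let Q : ℕ → (Fin d → ℤ) → Set (EuclideanSpace ℝ (Fin d)) := fun n a => {x | dcell n x = a}
  let H : ℕ → (Fin d → ℤ) → ℝ≥0∞ := fun n a => m (E ∩ Q n a)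
  have hHle : ∀ n a, H n a ≤ ENNReal.ofReal ((Real.sqrt d * (2:ℝ)⁻¹^n) ^ s) := by
    intro n a
    calc H n a ≤ Metric.ediam (E ∩ Q n a) ^ s := hmle _
      _ ≤ Metric.ediam (Q n a) ^ s :=
        ENNReal.rpow_le_rpow (Metric.ediam_mono inter_subset_right) hs.le
      _ ≤ ENNReal.ofReal (Real.sqrt d * (2:ℝ)⁻¹^n) ^ s :=
        ENNReal.rpow_le_rpow (dcell_ediam n a) hs.le
      _ = _ := ENNReal.ofReal_rpow_of_nonneg (by positivity) hs.le
  have hfin : ∀ n a, H n a ≠ ∞ := fun n a => ((hHle n a).trans_lt ENNReal.ofReal_lt_top).ne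
  have hsub : ∀ n a, H n a ≤ ∑' b : {b // dpar b = a}, H (n+1) b := by
    intro n a
    refine (measure_mono ?_).trans (measure_iUnion_le (μ := m) (fun b : {b // dpar b = a} => E ∩ Q (n+1) b))
    rintro x ⟨hx, hxa⟩
    refine mem_iUnion.2 ⟨⟨dcell (n+1) x, ?_⟩, hx, rfl⟩
    rw [dpar_dcell]; exact hxa
  obtain ⟨a0, ha0⟩ : ∃ a0, H 0 a0 ≠ 0 := by
    by_contra! hcon
    apply hm0
    have : m E ≤ ∑' a, H 0 a := by
      refine (measure_mono ?_).trans (measure_iUnion_le (μ := m) (fun a => E ∩ Q 0 a))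
      intro x hx
      exact mem_iUnion.2 ⟨dcell 0 x, hx, rfl⟩
    simpa [hcon] using this
  obtain ⟨ν, hν1, hν2, hν3⟩ := tree_flow dpar dpar_fiber H hfin hsub a0
  set M := H 0 a0 with hM
  have hMtop : M ≠ ∞ := hfin _ _
  have hEne : E.Nonempty := by
    rw [nonempty_iff_ne_empty]; rintro rfl; simp at hm0
  obtain ⟨e0, he0⟩ := hEne
  have hchoose : ∀ n a, ∃ e : E, ν n a ≠ 0 → dcell n (e : EuclideanSpace ℝ (Fin d)) = a := by
    intro n a
    by_cases h : (E ∩ Q n a).Nonempty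
    · obtain ⟨x, hx, hxa⟩ := h
      exact ⟨⟨x, hx⟩, fun _ => hxa⟩
    · refine ⟨⟨e0, he0⟩, fun h0 => absurd ?_ h0⟩
      have : H n a = 0 := by
        simp only [H]
        rw [not_nonempty_iff_eq_empty.1 h]; simp
      exact le_antisymm ((hν1 n a).trans this.le) bot_le
  choose e he using hchoose
  let μ0 : ℕ → Measure E := fun N => Measure.sum (fun a => (ν N a / M) • Measure.dirac (e N a))
  have hμ0 : ∀ N (A : Set E), MeasurableSet A →
      μ0 N A = ∑' a, ν N a / M * A.indicator 1 (e N a) := by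
    intro N A hA
    simp only [μ0]
    rw [Measure.sum_apply _ hA]
    simp [hA]
  have hprob : ∀ N, IsProbabilityMeasure (μ0 N) := by
    intro N
    constructor
    rw [hμ0 N _ MeasurableSet.univ]
    simp only [indicator_univ, Pi.one_apply, mul_one, div_eq_mul_inv]
    rw [ENNReal.tsum_mul_right, hν2, ENNReal.mul_inv_cancel ha0 hMtop]
  have : CompactSpace E := isCompact_iff_compactSpace.1 hE
  let μs : ℕ → ProbabilityMeasure E := fun N => ⟨μ0 N, hprob N⟩
  let U : Ultrafilter ℕ := hyperfilter ℕ
  obtain ⟨μ, hμ⟩ : ∃ μ : ProbabilityMeasure E, Tendsto μs U (𝓝 μ) :=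
    ⟨_, (U.map μs).le_nhds_lim⟩
  have hball : ∀ n (x : EuclideanSpace ℝ (Fin d)) r, r ≤ (2:ℝ)⁻¹^n →
      (μ : Measure E) {y : E | dist (y:EuclideanSpace ℝ (Fin d)) x < r} ≤
        3^d * ENNReal.ofReal ((Real.sqrt d * (2:ℝ)⁻¹^n) ^ s) / M := by
    intro n x r hr
    have hopen : IsOpen {y : E | dist (y:EuclideanSpace ℝ (Fin d)) x < r} :=
      isOpen_lt (by fun_prop) continuous_const
    refine (ProbabilityMeasure.le_liminf_measure_open_of_tendsto hμ hopen).trans ?_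
    have hev : ∀ᶠ N in (U : Filter ℕ), (μs N : Measure E) {y : E | dist (y:EuclideanSpace ℝ (Fin d)) x < r} ≤
        3^d * ENNReal.ofReal ((Real.sqrt d * (2:ℝ)⁻¹^n) ^ s) / M := by
      have h1 : ∀ᶠ N in (U : Filter ℕ), n ≤ N := Nat.hyperfilter_le_atTop (eventually_ge_atTop n)
      filter_upwards [h1] with N hN
      obtain ⟨j, rfl⟩ := Nat.exists_eq_add_of_le hN
      change μ0 (n+j) _ ≤ _
      rw [hμ0 _ _ hopen.measurableSet]
      set A := Finset.Icc (dcell n x - 1) (dcell n x + 1)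
      let g : (Fin d → ℤ) → ℝ≥0∞ := fun a => if a ∈ A then 1 else 0
      have hcard : A.card = 3^d := by
        simp only [A, Pi.card_Icc, Int.card_Icc, Pi.add_apply, Pi.sub_apply, Pi.one_apply]
        have : ∀ i, (dcell n x i + 1 + 1 - (dcell n x i - 1)).toNat = 3 := by intro i; omega
        simp [this]
      calc ∑' a, ν (n+j) a / M * indicator {y : E | dist (y:EuclideanSpace ℝ (Fin d)) x < r} 1 (e (n+j) a)
          ≤ ∑' a, (ν (n+j) a * g (dpar^[j] a)) * M⁻¹ := by
            refine ENNReal.tsum_le_tsum fun a => ?_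
            by_cases h0 : ν (n+j) a = 0
            · simp [h0]
            rw [div_eq_mul_inv, mul_right_comm]
            gcongr
            by_cases hin : dist ((e (n+j) a : E) : EuclideanSpace ℝ (Fin d)) x < r
            · have h4 : dpar^[j] a ∈ A := by
                rw [← he (n+j) a h0, dpar_iter_dcell]
                exact dcell_near n x _ (hin.le.trans hr)
              simp [g, h4, hin]
            · simp [hin]
        _ = (∑' a, ν n a * g a) * M⁻¹ := by rw [ENNReal.tsum_mul_right, hν3]
        _ = (∑ a ∈ A, ν n a) * M⁻¹ := by
            congr 1
            rw [tsum_eq_sum (s := A)]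
            · exact Finset.sum_congr rfl fun a ha => by simp [g, ha]
            · intro a ha; simp [g, ha]
        _ ≤ (∑ a ∈ A, ENNReal.ofReal ((Real.sqrt d * (2:ℝ)⁻¹^n) ^ s)) * M⁻¹ := by
            gcongr with a ha
            exact (hν1 n a).trans (hHle n a)
        _ = _ := by
            rw [Finset.sum_const, hcard, nsmul_eq_mul, div_eq_mul_inv]; push_cast; rfl
    exact (liminf_le_liminf hev).trans (by simp)
  refine ⟨(μ : Measure E).map Subtype.val, ?_, ?_, ?_⟩
  · exact Measure.isProbabilityMeasure_map (by fun_prop)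
  · rw [Measure.map_apply measurable_subtype_coe hE.isClosed.measurableSet.compl]
    simp
  · set C0 : ℝ := 3^d * (Real.sqrt d * 2)^s / M.toReal with hC0
    have hC0' : 0 ≤ C0 := by positivity
    refine ⟨max C0 1, by positivity, fun x r hr => ?_⟩
    rw [Measure.map_apply measurable_subtype_coe Metric.isOpen_ball.measurableSet]
    rcases le_or_gt r 1 with hr1 | hr1
    · obtain ⟨n, hn1, hn2⟩ := exists_nat_pow_near_of_lt_one (y := (2:ℝ)⁻¹) hr hr1 (by norm_num) (by norm_num)
      refine (hball n x r hn2).trans ?_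
      have : (3:ℝ≥0∞)^d * ENNReal.ofReal ((Real.sqrt d * (2:ℝ)⁻¹^n) ^ s) / M =
          ENNReal.ofReal (3^d * (Real.sqrt d * (2:ℝ)⁻¹^n) ^ s / M.toReal) := by
        rw [ENNReal.ofReal_div_of_pos (ENNReal.toReal_pos ha0 hMtop), ENNReal.ofReal_toReal hMtop,
          ENNReal.ofReal_mul (by positivity), ENNReal.ofReal_pow (by norm_num)]
        simp
      rw [this]
      apply ENNReal.ofReal_le_ofReal
      calc 3^d * (Real.sqrt d * (2:ℝ)⁻¹^n) ^ s / M.toReal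
          ≤ 3^d * (Real.sqrt d * (2 * r)) ^ s / M.toReal := by
            gcongr
            rw [pow_succ] at hn1; linarith
        _ = C0 * r^s := by
            rw [← mul_assoc, Real.mul_rpow (by positivity) hr.le, hC0]; ring
        _ ≤ max C0 1 * r^s := by gcongr; exact le_max_left _ _
    · refine prob_le_one.trans ?_
      rw [← ENNReal.ofReal_one]
      apply ENNReal.ofReal_le_ofReal
      have := Real.one_le_rpow hr1.le hs.le
      nlinarith [le_max_right C0 1]
end partB

section partC
open MeasureTheory Set Filter Topology
open scoped ENNReal NNReal

theorem gauss_mass {d : ℕ} (μ : Measure (EuclideanSpace ℝ (Fin d))) (C s : ℝ) (hC : 0 ≤ C)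
    (hμ : ∀ x r, 0 < r → μ (Metric.ball x r) ≤ ENNReal.ofReal (C * r ^ s)) :
    ∃ K : ℝ, 0 ≤ K ∧ ∀ l : ℝ, 0 < l → ∀ z,
      ∫⁻ x, ENNReal.ofReal (Real.exp (-(l^2 * ‖z - x‖^2))) ∂μ ≤ ENNReal.ofReal (K * l ^ (-s)) := by
  have hsum : Summable (fun n : ℕ => Real.exp (-(n:ℝ)) * ((n:ℝ)+1)^s) := by
    have h1 := Real.summable_pow_mul_exp_neg_nat_mul ⌈s⌉₊ (r := 1) one_pos
    have h2 := ((summable_nat_add_iff 1).2 h1).mul_left (Real.exp 1)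
    refine Summable.of_nonneg_of_le (fun n => by positivity) (fun n => ?_) h2
    have h3 : ((n:ℝ)+1)^s ≤ ((n:ℝ)+1)^⌈s⌉₊ := by
      rw [← Real.rpow_natCast]
      exact Real.rpow_le_rpow_of_exponent_le (by linarith [n.cast_nonneg (α := ℝ)]) (Nat.le_ceil s)
    have h4 : Real.exp (-(n:ℝ)) = Real.exp 1 * Real.exp (-1 * ((n+1 : ℕ):ℝ)) := by
      rw [← Real.exp_add]; push_cast; congr 1; ring
    rw [h4]; push_cast
    calc Real.exp 1 * Real.exp (-1 * ((n:ℝ)+1)) * ((n:ℝ)+1)^s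
        ≤ Real.exp 1 * Real.exp (-1 * ((n:ℝ)+1)) * ((n:ℝ)+1)^⌈s⌉₊ := by gcongr
      _ = _ := by ring
  refine ⟨C * ∑' n : ℕ, Real.exp (-(n:ℝ)) * ((n:ℝ)+1)^s, ?_, fun l hl z => ?_⟩
  · exact mul_nonneg hC (tsum_nonneg fun n => by positivity)
  have hpt : ∀ x, ENNReal.ofReal (Real.exp (-(l^2 * ‖z - x‖^2))) ≤
      ∑' n : ℕ, (Metric.ball z (((n:ℝ)+1)/l)).indicator (fun _ => ENNReal.ofReal (Real.exp (-(n:ℝ)))) x := by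
    intro x
    set v := l * ‖z - x‖ with hv
    have hv0 : 0 ≤ v := by positivity
    set n := ⌊v^2⌋₊
    have h1 : (n:ℝ) ≤ v^2 := Nat.floor_le (by positivity)
    have h2 : v^2 < n+1 := Nat.lt_floor_add_one _
    have h3 : v < n + 1 := by
      by_contra! hcon
      have : (1:ℝ) ≤ n + 1 := by linarith [n.cast_nonneg (α := ℝ)]
      nlinarith
    have h4 : x ∈ Metric.ball z (((n:ℝ)+1)/l) := by
      rw [mem_ball_iff_norm', lt_div_iff₀ hl]; linarith
    refine le_trans ?_ (ENNReal.le_tsum n)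
    rw [indicator_of_mem h4]
    apply ENNReal.ofReal_le_ofReal
    apply Real.exp_le_exp.2
    rw [← mul_pow]; linarith
  calc _ ≤ ∫⁻ x, ∑' n : ℕ, (Metric.ball z (((n:ℝ)+1)/l)).indicator (fun _ => ENNReal.ofReal (Real.exp (-(n:ℝ)))) x ∂μ :=
        lintegral_mono hpt
    _ = ∑' n : ℕ, ENNReal.ofReal (Real.exp (-(n:ℝ))) * μ (Metric.ball z (((n:ℝ)+1)/l)) := by
        rw [lintegral_tsum (fun n => (measurable_const.indicator Metric.isOpen_ball.measurableSet).aemeasurable)]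
        refine tsum_congr fun n => ?_
        rw [lintegral_indicator_const Metric.isOpen_ball.measurableSet]
    _ ≤ ∑' n : ℕ, ENNReal.ofReal ((C * l^(-s)) * (Real.exp (-(n:ℝ)) * ((n:ℝ)+1)^s)) := by
        refine ENNReal.tsum_le_tsum fun n => ?_
        have h := hμ z (((n:ℝ)+1)/l) (by positivity)
        calc _ ≤ ENNReal.ofReal (Real.exp (-(n:ℝ))) * ENNReal.ofReal (C * (((n:ℝ)+1)/l) ^ s) := by gcongr
          _ = _ := by
            rw [← ENNReal.ofReal_mul (by positivity), Real.div_rpow (by positivity) hl.le, Real.rpow_neg hl.le]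
            congr 1
            field_simp
    _ = _ := by
        rw [← ENNReal.ofReal_tsum_of_nonneg (fun n => by positivity) (hsum.mul_left _), tsum_mul_left]
        congr 1; ring

theorem lintegral_cs {α : Type*} [MeasurableSpace α] (μ : Measure α) (f g : α → ℝ≥0∞)
    (hf : AEMeasurable f μ) (hg : AEMeasurable g μ) :
    (∫⁻ a, f a * g a ∂μ)^2 ≤ (∫⁻ a, f a ^ 2 ∂μ) * ∫⁻ a, g a ^ 2 ∂μ := by
  have h := ENNReal.lintegral_mul_le_Lp_mul_Lq μ Real.HolderConjugate.two_two hf hg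
  have h2 := pow_le_pow_left' h 2
  rw [mul_pow, ← ENNReal.rpow_natCast (_ ^ _), ← ENNReal.rpow_natCast (_ ^ _), ← ENNReal.rpow_mul, ← ENNReal.rpow_mul] at h2
  norm_num at h2
  simpa using h2

/-- Gaussian Fubini -/
theorem gauss_fubini {d : ℕ} {Y : Type*} [MeasurableSpace Y] (m : Measure Y) [IsFiniteMeasure m]
    (h : Y → ℂ) (hh : Measurable h) (B : ℝ) (hB : ∀ y, ‖h y‖ ≤ B)
    (q : Y → EuclideanSpace ℝ (Fin d)) (hq : Measurable q) (b : ℝ) (hb : 0 < b) (l : ℝ) :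
    ∫ z : EuclideanSpace ℝ (Fin d), (Real.exp (-(b * ‖z‖^2)) : ℂ) *
        ∫ y, Complex.exp (((-(l * inner ℝ z (q y)) : ℝ) : ℂ) * Complex.I) * h y ∂m =
      (((Real.pi / b)^((d:ℝ)/2) : ℝ) : ℂ) * ∫ y, (Real.exp (-(l^2 * ‖q y‖^2 / (4*b))) : ℂ) * h y ∂m := by
  have hgint : Integrable (fun z : EuclideanSpace ℝ (Fin d) => Real.exp (-(b * ‖z‖^2))) := by
    have := (GaussianFourier.integrable_cexp_neg_mul_sq_norm_add (V := EuclideanSpace ℝ (Fin d)) (b := (b:ℂ)) (by simpa using hb) 0 0).norm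
    refine this.congr (Eventually.of_forall fun z => ?_)
    simp only [Complex.norm_exp]
    congr 1
    simp [← Complex.ofReal_pow]
  simp_rw [← integral_const_mul]
  rw [integral_integral_swap]
  · congr 1; ext y
    have := GaussianFourier.integral_cexp_neg_mul_sq_norm_add (V := EuclideanSpace ℝ (Fin d)) (b := (b:ℂ)) (by simpa using hb) (-(l:ℂ) * Complex.I) (q y)
    have h2 : ∀ z : EuclideanSpace ℝ (Fin d), (Real.exp (-(b * ‖z‖^2)) : ℂ) *
        (Complex.exp (((-(l * inner ℝ z (q y)) : ℝ) : ℂ) * Complex.I) * h y) =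
        Complex.exp (-(b:ℂ) * ‖z‖^2 + (-(l:ℂ) * Complex.I) * inner ℝ (q y) z) * h y := by
      intro z
      rw [← mul_assoc, Complex.ofReal_exp, ← Complex.exp_add, real_inner_comm]
      congr 2
      push_cast; ring
    simp_rw [h2]
    rw [integral_mul_const, this, mul_assoc]
    have h3 : ((Real.pi:ℂ) / (b:ℂ)) ^ ((Module.finrank ℝ (EuclideanSpace ℝ (Fin d)) : ℂ) / 2) = (((Real.pi / b)^((d:ℝ)/2) : ℝ) : ℂ) := by
      rw [Complex.ofReal_cpow (by positivity)]
      simp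
    rw [h3, Complex.ofReal_exp]
    congr 3
    push_cast
    rw [mul_pow, Complex.I_sq]
    ring
  · have hbd : Integrable (fun p : EuclideanSpace ℝ (Fin d) × Y => Real.exp (-(b * ‖p.1‖^2)) * B) (volume.prod m) := by
      exact Integrable.mul_prod hgint (integrable_const B)
    refine hbd.mono' ?_ (Eventually.of_forall fun p => ?_)
    · apply Measurable.aestronglyMeasurable
      unfold Function.uncurry
      fun_prop
    · simp only [Function.uncurry, norm_mul, Complex.norm_exp_ofReal_mul_I, one_mul, Complex.norm_real, Real.norm_eq_abs, Real.abs_exp]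
      gcongr
      exact hB _
end partC

section partD
open MeasureTheory Set Filter Topology
open scoped ENNReal NNReal

theorem gauss_integrable {d : ℕ} (b : ℝ) (hb : 0 < b) :
    Integrable (fun z : EuclideanSpace ℝ (Fin d) => Real.exp (-(b * ‖z‖^2))) := by
  have := (GaussianFourier.integrable_cexp_neg_mul_sq_norm_add (V := EuclideanSpace ℝ (Fin d)) (b := (b:ℂ)) (by simpa using hb) 0 0).norm
  refine this.congr (Eventually.of_forall fun z => ?_)
  simp only [Complex.norm_exp]
  congr 1
  simp [← Complex.ofReal_pow]

/-- oscillatory transform -/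
noncomputable def osc {d : ℕ} (μ : Measure (EuclideanSpace ℝ (Fin d))) (l : ℝ)
    (g : EuclideanSpace ℝ (Fin d) → ℂ) (z : EuclideanSpace ℝ (Fin d)) : ℂ :=
  ∫ y, Complex.exp (((-(l * inner ℝ z y) : ℝ) : ℂ) * Complex.I) * g y ∂μ

theorem osc_measurable {d : ℕ} (μ : Measure (EuclideanSpace ℝ (Fin d))) [IsFiniteMeasure μ] (l : ℝ)
    (g : EuclideanSpace ℝ (Fin d) → ℂ) (hg : Measurable g) : Measurable (osc μ l g) := by
  apply StronglyMeasurable.measurable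
  apply StronglyMeasurable.integral_prod_right'
    (f := fun p : EuclideanSpace ℝ (Fin d) × EuclideanSpace ℝ (Fin d) =>
      Complex.exp (((-(l * inner ℝ p.1 p.2) : ℝ) : ℂ) * Complex.I) * g p.2)
  apply Measurable.stronglyMeasurable
  fun_prop

theorem osc_bound {d : ℕ} (μ : Measure (EuclideanSpace ℝ (Fin d))) [IsFiniteMeasure μ] (l : ℝ)
    (g : EuclideanSpace ℝ (Fin d) → ℂ) (B : ℝ) (hB : ∀ y, ‖g y‖ ≤ B) (z) :
    ‖osc μ l g z‖ ≤ B * μ.real univ := by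
  refine norm_integral_le_of_norm_le_const (Eventually.of_forall fun y => ?_)
  rw [norm_mul, Complex.norm_exp_ofReal_mul_I, one_mul]; exact hB y

theorem osc_L2 {d : ℕ} (μ : Measure (EuclideanSpace ℝ (Fin d))) [IsFiniteMeasure μ] (s K : ℝ) (hK : 0 ≤ K)
    (hμ : ∀ l : ℝ, 0 < l → ∀ z,
      ∫⁻ x, ENNReal.ofReal (Real.exp (-(l^2 * ‖z - x‖^2))) ∂μ ≤ ENNReal.ofReal (K * l ^ (-s)))
    (B : ℝ) (hB0 : 0 ≤ B) :
    ∃ K' : ℝ, 0 ≤ K' ∧ ∀ l : ℝ, l ≠ 0 → ∀ g : EuclideanSpace ℝ (Fin d) → ℂ, Measurable g →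
      (∀ y, ‖g y‖ ≤ B) →
      ∫⁻ z, ENNReal.ofReal (Real.exp (-(1/8 * ‖z‖^2))) * ‖osc μ l g z‖ₑ^2 ≤
        ENNReal.ofReal (K' * |l|^(-s)) := by
  set c : ℝ := (Real.pi / (1/8))^((d:ℝ)/2) with hc
  refine ⟨c * B^2 * K * μ.real univ, by positivity, fun l hl g hg hB => ?_⟩
  have hmeas := osc_measurable μ l g hg
  set F : EuclideanSpace ℝ (Fin d) → ℝ := fun z => Real.exp (-(1/8 * ‖z‖^2)) * ‖osc μ l g z‖^2 with hF
  have hFint : Integrable F := by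
    have := (gauss_integrable (d := d) (1/8) (by norm_num)).mul_const ((B * μ.real univ)^2)
    refine this.mono' ?_ (Eventually.of_forall fun z => ?_)
    · apply Measurable.aestronglyMeasurable; fun_prop
    · rw [Real.norm_of_nonneg (by positivity)]
      simp only [hF]
      gcongr
      exact osc_bound μ l g B hB z
  have h1 : ∫⁻ z, ENNReal.ofReal (Real.exp (-(1/8 * ‖z‖^2))) * ‖osc μ l g z‖ₑ^2 = ENNReal.ofReal (∫ z, F z) := by
    rw [ofReal_integral_eq_lintegral_ofReal hFint (Eventually.of_forall fun z => by positivity)]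
    refine lintegral_congr fun z => ?_
    simp only [hF]
    rw [ENNReal.ofReal_mul (by positivity), ENNReal.ofReal_pow (by positivity), ofReal_norm]
  have h2 : ((∫ z, F z : ℝ) : ℂ) = (c:ℂ) * ∫ y : EuclideanSpace ℝ (Fin d) × EuclideanSpace ℝ (Fin d),
      (Real.exp (-(l^2 * ‖y.1 - y.2‖^2 / (4*(1/8)))) : ℂ) * (g y.1 * (starRingEnd ℂ) (g y.2)) ∂(μ.prod μ) := by
    rw [← gauss_fubini (μ.prod μ) (fun y => g y.1 * (starRingEnd ℂ) (g y.2))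
      ((hg.comp measurable_fst).mul (Complex.continuous_conj.measurable.comp (hg.comp measurable_snd))) (B * B) ?_ (fun y => y.1 - y.2) (by fun_prop) (1/8) (by norm_num) l]
    · rw [← integral_complex_ofReal]
      congr 1; ext z
      simp only [hF, Complex.ofReal_mul]
      congr 1
      rw [Complex.ofReal_pow, ← Complex.mul_conj', osc, ← integral_conj, ← integral_prod_mul]
      congr 1; ext y
      rw [map_mul, ← Complex.exp_conj, map_mul, Complex.conj_I, Complex.conj_ofReal, mul_mul_mul_comm, ← Complex.exp_add]
      congr 2
      rw [inner_sub_right]; push_cast; ring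
    · intro y
      rw [norm_mul, RCLike.norm_conj]
      exact mul_le_mul (hB _) (hB _) (norm_nonneg _) hB0
  have h3 : ENNReal.ofReal (∫ z, F z) = ‖((∫ z, F z : ℝ) : ℂ)‖ₑ := by
    rw [← ofReal_norm, Complex.norm_real, Real.norm_of_nonneg (integral_nonneg fun z => by positivity)]
  rw [h1, h3, h2, enorm_mul]
  have h4 : ‖(c:ℂ)‖ₑ = ENNReal.ofReal c := by
    rw [← ofReal_norm, Complex.norm_real, Real.norm_of_nonneg (by positivity)]
  rw [h4]
  calc _ ≤ ENNReal.ofReal c * ∫⁻ y : EuclideanSpace ℝ (Fin d) × EuclideanSpace ℝ (Fin d),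
        ENNReal.ofReal (Real.exp (-(|l|^2 * ‖y.1 - y.2‖^2))) * ENNReal.ofReal (B^2) ∂(μ.prod μ) := by
        gcongr
        refine (enorm_integral_le_lintegral_enorm _).trans (lintegral_mono fun y => ?_)
        rw [← ofReal_norm, ← ENNReal.ofReal_mul (by positivity)]
        apply ENNReal.ofReal_le_ofReal
        rw [norm_mul, norm_mul, RCLike.norm_conj, Complex.norm_real, Real.norm_of_nonneg (by positivity)]
        have : ‖g y.1‖ * ‖g y.2‖ ≤ B^2 := by
          rw [sq]; exact mul_le_mul (hB _) (hB _) (norm_nonneg _) hB0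
        gcongr
        rw [sq_abs, le_div_iff₀ (by norm_num)]
        have : 0 ≤ l^2 * ‖y.1 - y.2‖^2 := by positivity
        linarith
    _ = ENNReal.ofReal c * (∫⁻ y, ∫⁻ x, ENNReal.ofReal (Real.exp (-(|l|^2 * ‖y - x‖^2))) ∂μ ∂μ) * ENNReal.ofReal (B^2) := by
        rw [lintegral_mul_const _ (by fun_prop), lintegral_prod _ (by fun_prop), mul_assoc]
    _ ≤ ENNReal.ofReal c * (∫⁻ y, ENNReal.ofReal (K * |l|^(-s)) ∂μ) * ENNReal.ofReal (B^2) := by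
        gcongr with y
        exact hμ |l| (abs_pos.2 hl) y
    _ = _ := by
        rw [lintegral_const, ← ofReal_measureReal (by simp), ← ENNReal.ofReal_mul (by positivity),
          ← ENNReal.ofReal_mul (by positivity), ← ENNReal.ofReal_mul (by positivity)]
        congr 1; ring

theorem osc_pointwise {d : ℕ} (μ : Measure (EuclideanSpace ℝ (Fin d))) [IsFiniteMeasure μ]
    (B : ℝ) (l : ℝ) (hl : l ≠ 0) (g : EuclideanSpace ℝ (Fin d) → ℂ) (hg : Measurable g)
    (hB : ∀ y, ‖g y‖ ≤ B) (x : EuclideanSpace ℝ (Fin d)) :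
    ENNReal.ofReal ((Real.pi / (l^2/2))^((d:ℝ)/2)) *
      ‖osc μ l (fun y => (Real.exp (-(‖y‖^2/2)) : ℂ) * g y) x‖ₑ^2 ≤
    ∫⁻ z, ENNReal.ofReal (Real.exp (-(l^2/2 * ‖z - x‖^2))) * ‖osc μ l g z‖ₑ^2 := by
  have hb : 0 < l^2/2 := by positivity
  set N := (Real.pi / (l^2/2))^((d:ℝ)/2) with hN
  have hN0 : 0 < N := by positivity
  have hmeas := osc_measurable μ l g hg
  have h1 := gauss_fubini (d := d) μ (fun y => Complex.exp (((-(l * inner ℝ x y) : ℝ) : ℂ) * Complex.I) * g y)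
    (by fun_prop) B (fun y => by rw [norm_mul, Complex.norm_exp_ofReal_mul_I, one_mul]; exact hB y)
    id measurable_id (l^2/2) hb l
  have h2 : ∫ w : EuclideanSpace ℝ (Fin d), (Real.exp (-(l^2/2 * ‖w‖^2)) : ℂ) * osc μ l g (w + x) =
      (N:ℂ) * osc μ l (fun y => (Real.exp (-(‖y‖^2/2)) : ℂ) * g y) x := by
    convert! h1 using 1
    · congr 1; ext w
      congr 1
      unfold osc
      congr 1; ext y
      rw [← mul_assoc, ← Complex.exp_add]
      congr 2
      simp only [id]
      rw [inner_add_left]; push_cast; ring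
    · congr 1
      unfold osc
      congr 1; ext y
      have : ‖y‖^2/2 = l^2 * ‖id y‖^2 / (4 * (l^2/2)) := by
        simp only [id]; field_simp; norm_num
      beta_reduce; rw [← this]; ring
  have h3 : ENNReal.ofReal N * ‖osc μ l (fun y => (Real.exp (-(‖y‖^2/2)) : ℂ) * g y) x‖ₑ ≤
      ∫⁻ w, ENNReal.ofReal (Real.exp (-(l^2/2 * ‖w‖^2))) * ‖osc μ l g (w + x)‖ₑ := by
    have h4 : ‖(N:ℂ)‖ₑ = ENNReal.ofReal N := by
      rw [← ofReal_norm, Complex.norm_real, Real.norm_of_nonneg (by positivity)]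
    rw [← h4, ← enorm_mul, ← h2]
    refine (enorm_integral_le_lintegral_enorm _).trans (lintegral_mono fun y => ?_)
    rw [enorm_mul, ← ofReal_norm (Complex.ofReal _), Complex.norm_real, Real.norm_of_nonneg (by positivity)]
  have h5 : ∫⁻ w : EuclideanSpace ℝ (Fin d), ENNReal.ofReal (Real.exp (-(l^2/2 * ‖w‖^2))) = ENNReal.ofReal N := by
    rw [← ofReal_integral_eq_lintegral_ofReal (gauss_integrable _ hb) (Eventually.of_forall fun z => by positivity)]
    have := GaussianFourier.integral_rexp_neg_mul_sq_norm (V := EuclideanSpace ℝ (Fin d)) hb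
    simp only [neg_mul] at this
    rw [this]; simp [hN]
  have hsq : ∀ w : EuclideanSpace ℝ (Fin d), ENNReal.ofReal (Real.exp (-(l^2/2 * ‖w‖^2))) =
      ENNReal.ofReal (Real.exp (-(l^2/4 * ‖w‖^2)))^2 := by
    intro w
    rw [← ENNReal.ofReal_pow (by positivity), ← Real.exp_nat_mul]
    congr 2; push_cast; ring
  have h6 := lintegral_cs volume (fun w : EuclideanSpace ℝ (Fin d) => ENNReal.ofReal (Real.exp (-(l^2/4 * ‖w‖^2))))
    (fun w => ENNReal.ofReal (Real.exp (-(l^2/4 * ‖w‖^2))) * ‖osc μ l g (w + x)‖ₑ) (by fun_prop) (by fun_prop)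
  simp_rw [← mul_assoc, ← sq, mul_pow, ← hsq, h5] at h6
  have h7 := (pow_le_pow_left' h3 2).trans h6
  rw [mul_pow, sq (ENNReal.ofReal N), mul_assoc] at h7
  have h8 := (ENNReal.mul_le_mul_iff_right (by simpa using hN0) (by simp)).1 h7
  refine h8.trans (le_of_eq ?_)
  have h9 := lintegral_add_right_eq_self (μ := volume) (fun z => ENNReal.ofReal (Real.exp (-(l^2/2 * ‖z - x‖^2))) * ‖osc μ l g z‖ₑ^2) x
  simpa using h9
end partD

section partF
open MeasureTheory Set Filter Topology
open scoped ENNReal NNReal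

theorem key_est {d : ℕ} (μ₀ μ₁ : Measure (EuclideanSpace ℝ (Fin d))) [IsFiniteMeasure μ₀] [IsFiniteMeasure μ₁]
    (R : ℝ) (h₀R : ∀ᵐ x ∂μ₀, ‖x‖ ≤ R) (h₁R : ∀ᵐ x ∂μ₁, ‖x‖ ≤ R)
    (C s : ℝ) (hC : 0 ≤ C)
    (h₀ : ∀ x r, 0 < r → μ₀ (Metric.ball x r) ≤ ENNReal.ofReal (C * r ^ s))
    (h₁ : ∀ x r, 0 < r → μ₁ (Metric.ball x r) ≤ ENNReal.ofReal (C * r ^ s)) :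
    ∃ K : ℝ, 0 ≤ K ∧ ∀ τ : ℝ, 1 ≤ |τ| →
      ∫⁻ x, ‖∫ y, Complex.exp (((τ * ‖x - y‖^2 : ℝ) : ℂ) * Complex.I) ∂μ₁‖ₑ^2 ∂μ₀ ≤
        ENNReal.ofReal (K * |τ|^((d:ℝ) - 2 * s)) := by
  obtain ⟨K₀, hK₀, hG₀⟩ := gauss_mass μ₀ C s hC h₀
  obtain ⟨K₁, hK₁, hG₁⟩ := gauss_mass μ₁ C s hC h₁
  obtain ⟨K', hK', hS⟩ := osc_L2 μ₁ s K₁ hK₁ hG₁ (Real.exp (R^2/2)) (by positivity)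
  set c : ℝ := (2:ℝ)^(-s) with hc
  refine ⟨((2 * Real.pi)^(-((d:ℝ)/2)) * 2^(d:ℝ)) * (Real.exp (R^2/4) * K₀) * (K' * c), by positivity, fun τ hτ => ?_⟩
  have hτ0 : τ ≠ 0 := by rintro rfl; norm_num at hτ
  have hτp : 0 < |τ| := by linarith
  set l := 2 * τ with hl
  have hl0 : l ≠ 0 := by simp [hl, hτ0]
  have hla : |l| = 2 * |τ| := by rw [hl, abs_mul]; norm_num
  have hl2 : l^2 = 4 * |τ|^2 := by rw [hl, sq_abs]; ring
  -- the amplitude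
  let g : EuclideanSpace ℝ (Fin d) → ℂ := fun y =>
    (Real.exp (min (‖y‖^2) (R^2) / 2) : ℂ) * Complex.exp (((τ * ‖y‖^2 : ℝ) : ℂ) * Complex.I)
  have hg : Measurable g := by fun_prop
  have hgB : ∀ y, ‖g y‖ ≤ Real.exp (R^2/2) := by
    intro y
    simp only [g]
    rw [norm_mul, Complex.norm_exp_ofReal_mul_I, mul_one, Complex.norm_real, Real.norm_of_nonneg (by positivity)]
    gcongr
    exact min_le_right _ _
  have hT : ∀ x, ‖∫ y, Complex.exp (((τ * ‖x - y‖^2 : ℝ) : ℂ) * Complex.I) ∂μ₁‖ₑ =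
      ‖osc μ₁ l (fun y => (Real.exp (-(‖y‖^2/2)) : ℂ) * g y) x‖ₑ := by
    intro x
    have : ∫ y, Complex.exp (((τ * ‖x - y‖^2 : ℝ) : ℂ) * Complex.I) ∂μ₁ =
        Complex.exp (((τ * ‖x‖^2 : ℝ) : ℂ) * Complex.I) * osc μ₁ l (fun y => (Real.exp (-(‖y‖^2/2)) : ℂ) * g y) x := by
      unfold osc
      rw [← integral_const_mul]
      refine integral_congr_ae ?_
      filter_upwards [h₁R] with y hy
      have hmin : min (‖y‖^2) (R^2) = ‖y‖^2 := min_eq_left (by gcongr)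
      simp only [g, hmin]
      rw [← mul_assoc (Complex.ofReal _), ← Complex.ofReal_mul, ← Real.exp_add]
      simp only [neg_add_cancel, Real.exp_zero, Complex.ofReal_one, one_mul]
      rw [← Complex.exp_add, ← Complex.exp_add]
      congr 1
      rw [norm_sub_sq_real, hl]; push_cast; ring
    rw [this, enorm_mul, ← ofReal_norm (Complex.exp _), Complex.norm_exp_ofReal_mul_I]
    simp
  set N := (Real.pi / (l^2/2))^((d:ℝ)/2) with hN
  have hN0 : 0 < N := by positivity
  have hmeas := osc_measurable μ₁ l g hg
  have step1 : ENNReal.ofReal N * ∫⁻ x, ‖∫ y, Complex.exp (((τ * ‖x - y‖^2 : ℝ) : ℂ) * Complex.I) ∂μ₁‖ₑ^2 ∂μ₀ ≤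
      ENNReal.ofReal (Real.exp (R^2/4) * (K₀ * |τ|^(-s))) * ENNReal.ofReal (K' * |l|^(-s)) := by
    calc _ = ∫⁻ x, ENNReal.ofReal N * ‖osc μ₁ l (fun y => (Real.exp (-(‖y‖^2/2)) : ℂ) * g y) x‖ₑ^2 ∂μ₀ := by
          rw [← lintegral_const_mul' _ _ (by simp)]
          simp_rw [hT]
      _ ≤ ∫⁻ x, (∫⁻ z, ENNReal.ofReal (Real.exp (-(l^2/2 * ‖z - x‖^2))) * ‖osc μ₁ l g z‖ₑ^2) ∂μ₀ :=
          lintegral_mono fun x => osc_pointwise μ₁ _ l hl0 g hg hgB x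
      _ = ∫⁻ z, (∫⁻ x, ENNReal.ofReal (Real.exp (-(l^2/2 * ‖z - x‖^2))) ∂μ₀) * ‖osc μ₁ l g z‖ₑ^2 := by
          rw [lintegral_lintegral_swap (by fun_prop)]
          refine lintegral_congr fun z => ?_
          rw [lintegral_mul_const _ (by fun_prop)]
      _ ≤ ∫⁻ z, ENNReal.ofReal (Real.exp (R^2/4) * (K₀ * |τ|^(-s))) *
            (ENNReal.ofReal (Real.exp (-(1/8 * ‖z‖^2))) * ‖osc μ₁ l g z‖ₑ^2) := by
          refine lintegral_mono fun z => ?_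
          rw [← mul_assoc]
          gcongr
          calc ∫⁻ x, ENNReal.ofReal (Real.exp (-(l^2/2 * ‖z - x‖^2))) ∂μ₀
              ≤ ∫⁻ x, ENNReal.ofReal (Real.exp (R^2/4) * Real.exp (-(1/8 * ‖z‖^2))) *
                  ENNReal.ofReal (Real.exp (-(|τ|^2 * ‖z - x‖^2))) ∂μ₀ := by
                refine lintegral_mono_ae ?_
                filter_upwards [h₀R] with x hx
                rw [← ENNReal.ofReal_mul (by positivity), ← Real.exp_add, ← Real.exp_add]
                apply ENNReal.ofReal_le_ofReal
                apply Real.exp_le_exp.2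
                have hx2 : ‖x‖^2 ≤ R^2 := by gcongr
                have hz : ‖z‖ ≤ ‖z - x‖ + ‖x‖ := by simpa using norm_add_le (z - x) x
                have hz2 : ‖z‖^2 ≤ 2 * ‖z - x‖^2 + 2 * ‖x‖^2 := by
                  nlinarith [norm_nonneg z, norm_nonneg x, norm_nonneg (z - x), sq_nonneg (‖z - x‖ - ‖x‖)]
                have h5 : 1 ≤ |τ|^2 := one_le_pow₀ hτ
                have h6 : ‖z - x‖^2 ≤ |τ|^2 * ‖z - x‖^2 := le_mul_of_one_le_left (by positivity) h5
                have h7 : 4*|τ|^2/2*‖z-x‖^2 = 2*(|τ|^2*‖z-x‖^2) := by ring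
                rw [hl2, h7]
                have h8 := sq_nonneg ‖z - x‖
                linarith
            _ = ENNReal.ofReal (Real.exp (R^2/4) * Real.exp (-(1/8 * ‖z‖^2))) *
                  ∫⁻ x, ENNReal.ofReal (Real.exp (-(|τ|^2 * ‖z - x‖^2))) ∂μ₀ := by
                rw [lintegral_const_mul' _ _ (by simp)]
            _ ≤ ENNReal.ofReal (Real.exp (R^2/4) * Real.exp (-(1/8 * ‖z‖^2))) *
                  ENNReal.ofReal (K₀ * |τ|^(-s)) := by
                gcongr
                exact hG₀ _ hτp z
            _ = _ := by
                rw [← ENNReal.ofReal_mul (by positivity), ← ENNReal.ofReal_mul (by positivity)]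
                congr 1; ring
      _ = ENNReal.ofReal (Real.exp (R^2/4) * (K₀ * |τ|^(-s))) * ∫⁻ z,
            (ENNReal.ofReal (Real.exp (-(1/8 * ‖z‖^2))) * ‖osc μ₁ l g z‖ₑ^2) := by
          rw [lintegral_const_mul' _ _ (by simp)]
      _ ≤ _ := by
          gcongr
          exact hS l hl0 g hg hgB
  have hNinv : N⁻¹ = (2 * Real.pi)^(-((d:ℝ)/2)) * 2^(d:ℝ) * |τ|^(d:ℝ) := by
    have e1 : Real.pi / (l^2/2) = (2 * Real.pi) / (2 * |τ|)^2 := by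
      rw [hl2]; field_simp; norm_num
    rw [hN, e1, Real.div_rpow (by positivity) (by positivity), inv_div, Real.rpow_neg (by positivity),
      ← Real.rpow_natCast (2 * |τ|) 2, ← Real.rpow_mul (by positivity)]
    have : ((2:ℕ):ℝ) * ((d:ℝ)/2) = d := by push_cast; ring
    rw [this, Real.mul_rpow (by norm_num) (by positivity)]
    field_simp
  have step2 := mul_le_mul_right step1 (ENNReal.ofReal N⁻¹)
  rw [← mul_assoc, ← ENNReal.ofReal_mul (by positivity), inv_mul_cancel₀ hN0.ne', ENNReal.ofReal_one, one_mul,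
    ← ENNReal.ofReal_mul (by positivity), ← ENNReal.ofReal_mul (by positivity)] at step2
  refine step2.trans (le_of_eq ?_)
  congr 1
  rw [hNinv, hla, Real.mul_rpow (x := 2) (y := |τ|) (by norm_num) (by positivity), ← hc]
  have : |τ|^((d:ℝ) - 2*s) = |τ|^(d:ℝ) * |τ|^(-s) * |τ|^(-s) := by
    rw [← Real.rpow_add hτp, ← Real.rpow_add hτp]; congr 1; ring
  rw [this]; ring
end partF

section partG
open MeasureTheory Set Filter Topology
open scoped ENNReal NNReal

section four
open scoped FourierTransform ContDiff SchwartzMap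

theorem interior_of_integrable_char (ρ : Measure ℝ) [IsFiniteMeasure ρ] (hρ : ρ ≠ 0) (S : Set ℝ)
    (hS : IsClosed S) (hρS : ρ Sᶜ = 0)
    (hF : Integrable (fun τ : ℝ => ∫ t, Complex.exp (((τ * t : ℝ) : ℂ) * Complex.I) ∂ρ)) :
    (interior S).Nonempty := by
  set F : ℝ → ℂ := VectorFourier.fourierIntegral Real.fourierChar ρ (innerₗ ℝ) (fun _ => (1:ℂ)) with hFdef
  have hFeq : F = fun ξ : ℝ => (fun τ : ℝ => ∫ t, Complex.exp (((τ * t : ℝ) : ℂ) * Complex.I) ∂ρ) ((-2 * Real.pi) * ξ) := by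
    funext ξ
    simp only [hFdef, VectorFourier.fourierIntegral]
    refine integral_congr_ae (Eventually.of_forall fun t => ?_)
    simp only [Circle.smul_def, Real.fourierChar_apply, innerₗ_apply_apply, smul_eq_mul, mul_one]
    congr 2
    simp
    ring
  have hFi : Integrable F := by
    rw [hFeq]
    exact hF.comp_mul_left' (by simp [Real.pi_ne_zero])
  have hL : Continuous fun p : ℝ × ℝ => (innerₗ ℝ) p.1 p.2 := by
    simp only [innerₗ_apply_apply]; fun_prop
  have hLn : Continuous fun p : ℝ × ℝ => (-innerₗ ℝ) p.1 p.2 := hL.neg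
  have h1 : Integrable (fun _ : ℝ => (1:ℂ)) ρ := integrable_const _
  have hFc : Continuous F :=
    VectorFourier.fourierIntegral_continuous Real.continuous_fourierChar hL h1
  set g : ℝ → ℂ := 𝓕⁻ F with hg
  have hgc : Continuous g := by
    have := VectorFourier.fourierIntegral_continuous (L := -innerₗ ℝ) Real.continuous_fourierChar
      hLn hFi
    exact this
  have key : ∀ φ : 𝓢(ℝ, ℂ), ∫ t, φ t * g t = ∫ t, φ t ∂ρ := by
    intro φ
    have e1 := VectorFourier.integral_fourierIntegral_smul_eq_flip (L := innerₗ ℝ) (μ := ρ) (ν := volume)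
      (g := fun x => (𝓕⁻ φ : 𝓢(ℝ, ℂ)) x) Real.continuous_fourierChar hL h1 (𝓕⁻ φ).integrable
    have e2 := VectorFourier.integral_fourierIntegral_smul_eq_flip (L := -innerₗ ℝ) (μ := volume) (ν := volume)
      (f := F) (g := fun x => φ x) Real.continuous_fourierChar hLn hFi φ.integrable
    have e3 : (VectorFourier.fourierIntegral Real.fourierChar volume (innerₗ ℝ).flip fun x => (𝓕⁻ φ : 𝓢(ℝ, ℂ)) x) = φ := by
      rw [flip_innerₗ]
      change 𝓕 (fun x => (𝓕⁻ φ : 𝓢(ℝ, ℂ)) x) = φ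
      have := SchwartzMap.fourier_coe (𝓕⁻ φ)
      rw [FourierTransform.fourier_fourierInv_eq] at this
      exact this.symm
    have e4 : (VectorFourier.fourierIntegral Real.fourierChar volume (-innerₗ ℝ).flip fun x => φ x) =
        (𝓕⁻ φ : 𝓢(ℝ, ℂ)) := by
      have : (-innerₗ ℝ).flip = -innerₗ ℝ := by
        ext; simp
      rw [this]
      exact (SchwartzMap.fourierInv_coe φ).symm
    rw [e3] at e1
    rw [e4] at e2
    simp only [one_smul] at e1
    rw [← e1]
    refine Eq.trans ?_ e2
    refine integral_congr_ae (Eventually.of_forall fun t => ?_)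
    simp only [smul_eq_mul]
    rw [mul_comm]; rfl
  by_contra hne
  rw [not_nonempty_iff_eq_empty] at hne
  have hdense : Dense Sᶜ := interior_eq_empty_iff_dense_compl.1 hne
  have hae := hS.isOpen_compl.ae_eq_zero_of_integral_contDiff_smul_eq_zero (f := g) (μ := volume)
    (hgc.locallyIntegrable.locallyIntegrableOn _) (by
      intro φ hφ hφc hsupp
      have hφ' : ContDiff ℝ ∞ (fun x => (φ x : ℂ)) := Complex.ofRealCLM.contDiff.comp hφ
      have hφc' : HasCompactSupport (fun x => (φ x : ℂ)) := hφc.comp_left (g := ((↑) : ℝ → ℂ)) (by simp)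
      have := key (hφc'.toSchwartzMap hφ')
      simp only [Complex.real_smul]
      refine Eq.trans ?_ (this.trans ?_)
      · rfl
      · refine (integral_congr_ae ?_).trans (integral_zero ℝ ℂ)
        have : ∀ᵐ x ∂ρ, x ∈ S := by
          rw [ae_iff]; exact hρS
        filter_upwards [this] with x hx
        have : φ x = 0 := by
          by_contra h
          exact hsupp (subset_tsupport _ h) hx
        change ((φ x : ℝ) : ℂ) = 0
        simp [this])
  have hg0 : EqOn g 0 Sᶜ := by
    refine Measure.eqOn_open_of_ae_eq (μ := volume) ?_ hS.isOpen_compl hgc.continuousOn continuousOn_const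
    rw [EventuallyEq, ae_restrict_iff' hS.isOpen_compl.measurableSet]
    exact hae
  have hg00 : g = 0 := Continuous.ext_on hdense hgc continuous_zero hg0
  have hFF : 𝓕 F = 0 := by
    funext x
    have : 𝓕⁻ F (-x) = 𝓕 F x := by rw [Real.fourierInv_eq_fourier_neg]; simp
    rw [← this, ← hg, hg00]; rfl
  have hinv := hFc.fourierInv_fourier_eq hFi (by rw [hFF]; exact integrable_zero _ _ _)
  have hF0 : F 0 = 0 := by
    rw [← hinv, hFF, Real.fourierInv_eq]; simp
  rw [hFeq] at hF0
  simp at hF0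
  apply hρ
  rw [measureReal_eq_zero_iff] at hF0
  exact Measure.measure_univ_eq_zero.1 hF0
end four
end partG

section partH
open MeasureTheory Set Filter Topology
open scoped ENNReal NNReal

theorem integrable_of_decay (F : ℝ → ℂ) (hm : AEStronglyMeasurable F) (M K a : ℝ) (ha : 1 < a)
    (hK : 0 ≤ K)
    (h1 : ∀ τ, ‖F τ‖ ≤ M) (h2 : ∀ τ, 1 ≤ |τ| → ‖F τ‖ ≤ K * |τ| ^ (-a)) : Integrable F := by
  have hM : 0 ≤ M := (norm_nonneg _).trans (h1 0)
  have hi := (integrable_one_add_norm (E := ℝ) (μ := volume) (r := a) (by simpa using ha)).const_mul ((M + K) * 2^a)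
  refine hi.mono' hm (Eventually.of_forall fun τ => ?_)
  have hp : 0 < 1 + |τ| := by positivity
  rw [Real.norm_eq_abs]
  rcases le_total 1 |τ| with h | h
  · refine (h2 τ h).trans ?_
    have hp' : 0 < |τ| := by linarith
    have : |τ| ^ (-a) ≤ 2^a * (1 + |τ|)^(-a) := by
      have e : |τ| ^ (-a) = 2^a * (2 * |τ|)^(-a) := by
        rw [Real.mul_rpow (by norm_num) (by positivity), ← mul_assoc, ← Real.rpow_add (by norm_num)]
        simp
      rw [e]
      gcongr 2^a * ?_
      exact Real.rpow_le_rpow_of_nonpos hp (by linarith) (by linarith)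
    calc K * |τ|^(-a) ≤ (M + K) * (2^a * (1 + |τ|)^(-a)) := by
          gcongr; linarith
      _ = _ := by ring
  · refine (h1 τ).trans ?_
    have : 1 ≤ 2^a * (1 + |τ|)^(-a) := by
      rw [Real.rpow_neg hp.le, ← div_eq_mul_inv, one_le_div (by positivity)]
      apply Real.rpow_le_rpow hp.le (by linarith) (by linarith)
    calc M = M * 1 := by ring
      _ ≤ (M + K) * (2^a * (1 + |τ|)^(-a)) := by gcongr; linarith
      _ = _ := by ring

variable {d : ℕ}

theorem triple_interior (μ₀ μ₁ μ₂ : Measure (EuclideanSpace ℝ (Fin d)))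
    [IsFiniteMeasure μ₀] [IsFiniteMeasure μ₁] [IsFiniteMeasure μ₂]
    (hn₀ : μ₀ ≠ 0) (hn₁ : μ₁ ≠ 0) (hn₂ : μ₂ ≠ 0)
    (E₀ E₁ E₂ : Set (EuclideanSpace ℝ (Fin d)))
    (hE₀ : IsCompact E₀) (hE₁ : IsCompact E₁) (hE₂ : IsCompact E₂)
    (hμ₀ : μ₀ E₀ᶜ = 0) (hμ₁ : μ₁ E₁ᶜ = 0) (hμ₂ : μ₂ E₂ᶜ = 0)
    (C s : ℝ) (hC : 0 ≤ C) (hs : (d:ℝ) + 1 < 2 * s)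
    (h₀ : ∀ x r, 0 < r → μ₀ (Metric.ball x r) ≤ ENNReal.ofReal (C * r ^ s))
    (h₁ : ∀ x r, 0 < r → μ₁ (Metric.ball x r) ≤ ENNReal.ofReal (C * r ^ s))
    (h₂ : ∀ x r, 0 < r → μ₂ (Metric.ball x r) ≤ ENNReal.ofReal (C * r ^ s))
    (q : EuclideanSpace ℝ (Fin d) → ℝ) (hq : Continuous q) :
    (interior (Set.image (fun p : EuclideanSpace ℝ (Fin d) × EuclideanSpace ℝ (Fin d) × EuclideanSpace ℝ (Fin d) =>
      ‖p.1 - p.2.1‖^2 + ‖p.1 - p.2.2‖^2 + q p.1)  (E₀ ×ˢ E₁ ×ˢ E₂))).Nonempty := by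
  set Φ := (fun p : EuclideanSpace ℝ (Fin d) × EuclideanSpace ℝ (Fin d) × EuclideanSpace ℝ (Fin d) =>
      ‖p.1 - p.2.1‖^2 + ‖p.1 - p.2.2‖^2 + q p.1) with hΦ
  have hΦc : Continuous Φ := by fun_prop
  have hcomp : IsCompact (Set.image Φ (E₀ ×ˢ E₁ ×ˢ E₂)) := (hE₀.prod (hE₁.prod hE₂)).image hΦc
  set ν := μ₀.prod (μ₁.prod μ₂) with hν
  set ρ := ν.map Φ with hρ
  have hEc : ν (E₀ ×ˢ E₁ ×ˢ E₂)ᶜ = 0 := by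
    have a0 : ∀ᵐ p ∂ν, p.1 ∈ E₀ :=
      Measure.quasiMeasurePreserving_fst.ae (show ∀ᵐ x ∂μ₀, x ∈ E₀ from hμ₀)
    have a12 : ∀ᵐ p ∂ν, p.2 ∈ E₁ ×ˢ E₂ := by
      refine Measure.quasiMeasurePreserving_snd.ae (p := fun z => z ∈ E₁ ×ˢ E₂) (μb := μ₁.prod μ₂) ?_
      have b1 : ∀ᵐ p ∂(μ₁.prod μ₂), p.1 ∈ E₁ :=
        Measure.quasiMeasurePreserving_fst.ae (show ∀ᵐ x ∂μ₁, x ∈ E₁ from hμ₁)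
      have b2 : ∀ᵐ p ∂(μ₁.prod μ₂), p.2 ∈ E₂ :=
        Measure.quasiMeasurePreserving_snd.ae (show ∀ᵐ x ∂μ₂, x ∈ E₂ from hμ₂)
      filter_upwards [b1, b2] with p h1 h2 using ⟨h1, h2⟩
    change ∀ᵐ p ∂ν, p ∈ E₀ ×ˢ E₁ ×ˢ E₂
    filter_upwards [a0, a12] with p h1 h2 using ⟨h1, h2⟩
  obtain ⟨R, hR⟩ : ∃ R : ℝ, ∀ x ∈ E₀ ∪ E₁ ∪ E₂, ‖x‖ ≤ R := by
    obtain ⟨R, hR⟩ := ((hE₀.union hE₁).union hE₂).isBounded.exists_norm_le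
    exact ⟨R, hR⟩
  have r0 : ∀ᵐ x ∂μ₀, ‖x‖ ≤ R := by
    filter_upwards [show ∀ᵐ x ∂μ₀, x ∈ E₀ from hμ₀] with x hx using hR x (Or.inl (Or.inl hx))
  have r1 : ∀ᵐ x ∂μ₁, ‖x‖ ≤ R := by
    filter_upwards [show ∀ᵐ x ∂μ₁, x ∈ E₁ from hμ₁] with x hx using hR x (Or.inl (Or.inr hx))
  have r2 : ∀ᵐ x ∂μ₂, ‖x‖ ≤ R := by
    filter_upwards [show ∀ᵐ x ∂μ₂, x ∈ E₂ from hμ₂] with x hx using hR x (Or.inr hx)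
  obtain ⟨K₁, hK₁, e1⟩ := key_est μ₀ μ₁ R r0 r1 C s hC h₀ h₁
  obtain ⟨K₂, hK₂, e2⟩ := key_est μ₀ μ₂ R r0 r2 C s hC h₀ h₂
  let G₁ : ℝ → EuclideanSpace ℝ (Fin d) → ℂ := fun τ x => ∫ y, Complex.exp (((τ * ‖x - y‖^2 : ℝ) : ℂ) * Complex.I) ∂μ₁
  let G₂ : ℝ → EuclideanSpace ℝ (Fin d) → ℂ := fun τ x => ∫ y, Complex.exp (((τ * ‖x - y‖^2 : ℝ) : ℂ) * Complex.I) ∂μ₂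
  have : IsFiniteMeasure ρ := by rw [hρ]; infer_instance
  refine interior_of_integrable_char ρ ?_ _ hcomp.isClosed ?_ ?_
  · rw [hρ, Ne, Measure.map_eq_zero_iff hΦc.measurable.aemeasurable, hν, ← Measure.measure_univ_eq_zero]
    rw [← univ_prod_univ, Measure.prod_prod, ← univ_prod_univ, Measure.prod_prod]
    simp [hn₀, hn₁, hn₂]
  · rw [hρ, Measure.map_apply hΦc.measurable hcomp.isClosed.measurableSet.compl]
    refine measure_mono_null ?_ hEc
    intro p hp hp'
    exact hp (mem_image_of_mem _ hp')
  · have hfac : ∀ τ : ℝ, ∫ t, Complex.exp (((τ * t : ℝ) : ℂ) * Complex.I) ∂ρ =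
        ∫ x, Complex.exp (((τ * q x : ℝ) : ℂ) * Complex.I) * (G₁ τ x * G₂ τ x) ∂μ₀ := by
      intro τ
      rw [hρ, integral_map hΦc.measurable.aemeasurable (by
        apply Measurable.aestronglyMeasurable; fun_prop), hν, integral_prod]
      · refine integral_congr_ae (Eventually.of_forall fun x => ?_)
        simp only [G₁, G₂]
        rw [← integral_prod_mul, ← integral_const_mul]
        refine integral_congr_ae (Eventually.of_forall fun p => ?_)
        simp only [hΦ]
        rw [← Complex.exp_add, ← Complex.exp_add]
        congr 1; push_cast; ring
      · refine (integrable_const (1:ℝ)).mono' ?_ (Eventually.of_forall fun p => ?_)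
        · apply Measurable.aestronglyMeasurable; fun_prop
        · rw [Complex.norm_exp_ofReal_mul_I]
    refine integrable_of_decay _ ?_ (ρ.real univ) ((K₁ + K₂)/2) (2 * s - d) (by linarith) (by positivity) ?_ ?_
    · apply StronglyMeasurable.aestronglyMeasurable
      apply StronglyMeasurable.integral_prod_right' (f := fun p : ℝ × ℝ => Complex.exp (((p.1 * p.2 : ℝ) : ℂ) * Complex.I))
      apply Measurable.stronglyMeasurable
      fun_prop
    · intro τ
      have := norm_integral_le_of_norm_le_const (μ := ρ) (C := 1)
        (f := fun t => Complex.exp (((τ * t : ℝ) : ℂ) * Complex.I))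
        (Eventually.of_forall fun t => by rw [Complex.norm_exp_ofReal_mul_I])
      simpa using this
    · intro τ hτ
      have hm1 : Measurable (G₁ τ) := by
        apply StronglyMeasurable.measurable
        apply StronglyMeasurable.integral_prod_right'
          (f := fun p : EuclideanSpace ℝ (Fin d) × EuclideanSpace ℝ (Fin d) => Complex.exp (((τ * ‖p.1 - p.2‖^2 : ℝ) : ℂ) * Complex.I))
        apply Measurable.stronglyMeasurable
        fun_prop
      rw [hfac]
      have hexp : -(2 * s - (d:ℝ)) = d - 2 * s := by ring
      rw [hexp]
      have hτp : 0 < |τ| := by linarith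
      rw [← ENNReal.ofReal_le_ofReal_iff (by positivity), ofReal_norm]
      calc _ ≤ ∫⁻ x, ‖Complex.exp (((τ * q x : ℝ) : ℂ) * Complex.I) * (G₁ τ x * G₂ τ x)‖ₑ ∂μ₀ :=
            enorm_integral_le_lintegral_enorm _
        _ ≤ ∫⁻ x, ENNReal.ofReal (1/2) * (‖G₁ τ x‖ₑ^2 + ‖G₂ τ x‖ₑ^2) ∂μ₀ := by
            refine lintegral_mono fun x => ?_
            rw [← ofReal_norm, ← ofReal_norm (G₁ τ x), ← ofReal_norm (G₂ τ x), ← ENNReal.ofReal_pow (by positivity),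
              ← ENNReal.ofReal_pow (by positivity), ← ENNReal.ofReal_add (by positivity) (by positivity),
              ← ENNReal.ofReal_mul (by positivity)]
            apply ENNReal.ofReal_le_ofReal
            rw [norm_mul, norm_mul, Complex.norm_exp_ofReal_mul_I]
            nlinarith [sq_nonneg (‖G₁ τ x‖ - ‖G₂ τ x‖)]
        _ = ENNReal.ofReal (1/2) * (∫⁻ x, ‖G₁ τ x‖ₑ^2 ∂μ₀ + ∫⁻ x, ‖G₂ τ x‖ₑ^2 ∂μ₀) := by
            rw [lintegral_const_mul' _ _ (by simp), lintegral_add_left (by fun_prop)]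
        _ ≤ ENNReal.ofReal (1/2) * (ENNReal.ofReal (K₁ * |τ|^((d:ℝ) - 2 * s)) + ENNReal.ofReal (K₂ * |τ|^((d:ℝ) - 2 * s))) := by
            gcongr
            · exact e1 τ hτ
            · exact e2 τ hτ
        _ = _ := by
            rw [← ENNReal.ofReal_add (by positivity) (by positivity), ← ENNReal.ofReal_mul (by positivity)]
            congr 1; ring
end partH

open MeasureTheory
open scoped ENNReal

theorem threshold_le (d k : ℕ) (hd : 2 ≤ d) (hk : 3 ≤ k) :
    ENNReal.ofReal (((d:ℝ) + 1) / 2) ≤ (if k = 3 then ((2 * d + 1 : ℕ) : ℝ≥0∞) / 3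
      else (((k - 1) * d : ℕ) : ℝ≥0∞) / k) := by
  have hd' : (2:ℝ) ≤ d := by exact_mod_cast hd
  split_ifs with h
  · have : ((2 * d + 1 : ℕ) : ℝ≥0∞) / 3 = ENNReal.ofReal (((2 * d + 1 : ℕ) : ℝ) / 3) := by
      rw [ENNReal.ofReal_div_of_pos (by norm_num), ENNReal.ofReal_natCast]; simp
    rw [this]
    apply ENNReal.ofReal_le_ofReal
    push_cast; linarith
  · have hk4 : 4 ≤ k := by omega
    have hk' : (4:ℝ) ≤ k := by exact_mod_cast hk4
    have : (((k - 1) * d : ℕ) : ℝ≥0∞) / k = ENNReal.ofReal ((((k - 1) * d : ℕ) : ℝ) / k) := by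
      rw [ENNReal.ofReal_div_of_pos (by linarith), ENNReal.ofReal_natCast, ENNReal.ofReal_natCast]
    rw [this]
    apply ENNReal.ofReal_le_ofReal
    rw [div_le_div_iff₀ (by norm_num) (by linarith)]
    push_cast [Nat.cast_sub (show 1 ≤ k by omega)]
    nlinarith [mul_nonneg (sub_nonneg.2 hd') (sub_nonneg.2 hk')]

theorem support_infinite {d : ℕ} (μ : Measure (EuclideanSpace ℝ (Fin d))) [IsProbabilityMeasure μ]
    (C s : ℝ) (hs : 0 < s)
    (h : ∀ x r, 0 < r → μ (Metric.ball x r) ≤ ENNReal.ofReal (C * r ^ s)) : μ.support.Infinite := by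
  have hna : NullSingletonClass μ := by
    refine ⟨fun x => ?_⟩
    have ht : Filter.Tendsto (fun r : ℝ => ENNReal.ofReal (C * r ^ s)) (nhdsWithin 0 (Set.Ioi 0)) (nhds 0) := by
      have h1 : Filter.Tendsto (fun r : ℝ => C * r ^ s) (nhds 0) (nhds (C * 0 ^ s)) :=
        ((Real.continuousAt_rpow_const 0 s (Or.inr hs.le)).tendsto).const_mul C
      rw [Real.zero_rpow hs.ne', mul_zero] at h1
      have h2 := ENNReal.tendsto_ofReal h1
      rw [ENNReal.ofReal_zero] at h2
      exact h2.mono_left nhdsWithin_le_nhds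
    refine le_antisymm (ge_of_tendsto ht ?_) zero_le
    filter_upwards [self_mem_nhdsWithin] with r hr
    exact (measure_mono (Set.singleton_subset_iff.2 (Metric.mem_ball_self hr))).trans (h x r hr)
  intro hf
  have h1 : μ μ.support = 0 := hf.measure_zero μ
  have h2 : μ μ.supportᶜ = 0 := Measure.measure_compl_support
  have h3 : μ Set.univ ≤ 0 := by
    rw [← Set.union_compl_self μ.support]
    refine (measure_union_le _ _).trans ?_
    rw [h1, h2]; simp
  simp at h3

/-- For compact `E ⊆ ℝ^d` (`d ≥ 2`) and `k ≥ 3`, if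
`dim E > (2d+1)/3` when `k = 3` and `dim E > (k−1)d/k` when `k ≥ 4`, then the
`k`-point diagonal configuration set
`Δ°ₖ^diag(E) = { |(x,…,x) − (y₁,…,y_{k−1})| : x, yᵢ ∈ E, yᵢ ≠ yⱼ for i ≠ j }`
(Euclidean norm on `ℝ^{(k−1)d}`) has nonempty interior in `ℝ`. -/
theorem stmt_1 (d k : ℕ) (hd : 2 ≤ d) (hk : 3 ≤ k) (E : Set (EuclideanSpace ℝ (Fin d)))
    (hE : IsCompact E)
    (hdim : (if k = 3 then ((2 * d + 1 : ℕ) : ℝ≥0∞) / 3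
      else (((k - 1) * d : ℕ) : ℝ≥0∞) / k) < dimH E) :
    (interior { t : ℝ |
      ∃ (x : EuclideanSpace ℝ (Fin d)) (y : Fin (k - 1) → EuclideanSpace ℝ (Fin d)),
        x ∈ E ∧ (∀ i, y i ∈ E) ∧ (∀ i j, i ≠ j → y i ≠ y j) ∧
        t = Real.sqrt (∑ i, ‖x - y i‖ ^ 2) }).Nonempty := by
  obtain ⟨s, hs1, hs2⟩ := ENNReal.lt_iff_exists_nnreal_btwn.1 ((threshold_le d k hd hk).trans_lt hdim)
  have hs : ((d:ℝ) + 1) / 2 < (s : ℝ) := by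
    rw [← ENNReal.ofReal_coe_nnreal] at hs1
    exact (ENNReal.ofReal_lt_ofReal_iff'.1 hs1).1
  have hs0 : (0:ℝ) < s := lt_of_le_of_lt (by positivity) hs
  have hH : Measure.hausdorffMeasure (s:ℝ) E ≠ 0 := by
    rw [hausdorffMeasure_of_lt_dimH hs2]; simp
  obtain ⟨μ, hμp, hμE, C, hC, hμ⟩ := frostman E hE s hs0 hH
  have hinf := support_infinite μ C s hs0 hμ
  have hsub : μ.support ⊆ E := Measure.support_subset_of_isClosed hE.isClosed hμE
  obtain ⟨m, rfl⟩ : ∃ m, k = m + 3 := ⟨k - 3, by omega⟩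
  change (interior { t : ℝ |
      ∃ (x : EuclideanSpace ℝ (Fin d)) (y : Fin (m + 2) → EuclideanSpace ℝ (Fin d)),
        x ∈ E ∧ (∀ i, y i ∈ E) ∧ (∀ i j, i ≠ j → y i ≠ y j) ∧
        t = Real.sqrt (∑ i, ‖x - y i‖ ^ 2) }).Nonempty
  let emb := hinf.natEmbedding
  let b : Fin (m + 2) → EuclideanSpace ℝ (Fin d) := fun i => (emb i : EuclideanSpace ℝ (Fin d))
  have hbinj : ∀ i j, i ≠ j → b i ≠ b j := by
    intro i j hij h
    exact hij (Fin.ext (emb.injective (Subtype.ext h)))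
  have hbs : ∀ i, b i ∈ μ.support := fun i => (emb i).2
  obtain ⟨δ, hδ, hsep⟩ : ∃ δ : ℝ, 0 < δ ∧ ∀ i j, i ≠ j → 2 * δ < dist (b i) (b j) := by
    have : ∀ᶠ δ : ℝ in nhdsWithin 0 (Set.Ioi 0), ∀ i j, i ≠ j → 2 * δ < dist (b i) (b j) := by
      refine Filter.eventually_all.2 fun i => Filter.eventually_all.2 fun j => ?_
      by_cases hij : i = j
      · simp [hij]
      · have hp : 0 < dist (b i) (b j) / 2 := by
          have := dist_pos.2 (hbinj i j hij)
          linarith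
        filter_upwards [nhdsWithin_le_nhds (Iio_mem_nhds hp)] with δ hδ _
        rw [Set.mem_Iio] at hδ
        linarith
    obtain ⟨δ, h1, h2⟩ := (this.and self_mem_nhdsWithin).exists
    exact ⟨δ, h2, h1⟩
  have hinj : ∀ y : Fin (m + 2) → EuclideanSpace ℝ (Fin d), (∀ i, y i ∈ Metric.closedBall (b i) δ) →
      ∀ i j, i ≠ j → y i ≠ y j := by
    intro y hy i j hij h
    have h1 := hy i
    have h2 := hy j
    rw [Metric.mem_closedBall] at h1 h2
    have h3 := hsep i j hij
    have h4 := dist_triangle_left (b i) (b j) (y i)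
    rw [← h] at h2
    linarith
  have hpos : ∀ i, μ.restrict (Metric.closedBall (b i) δ) ≠ 0 := by
    intro i h
    rw [Measure.restrict_eq_zero] at h
    have := (Measure.mem_support_iff_forall _).1 (hbs i) _ (Metric.closedBall_mem_nhds (b i) hδ)
    exact this.ne' h
  have hres : ∀ i, μ.restrict (Metric.closedBall (b i) δ) (E ∩ Metric.closedBall (b i) δ)ᶜ = 0 := by
    intro i
    rw [Measure.restrict_apply (hE.isClosed.inter Metric.isClosed_closedBall).measurableSet.compl]
    refine measure_mono_null ?_ hμE
    rintro x ⟨h1, h2⟩ h3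
    exact h1 ⟨h3, h2⟩
  have hfr : ∀ i, ∀ x r, 0 < r → μ.restrict (Metric.closedBall (b i) δ) (Metric.ball x r) ≤
      ENNReal.ofReal (C * r ^ (s:ℝ)) :=
    fun i x r hr => (Measure.restrict_apply_le _ _).trans (hμ x r hr)
  let q : EuclideanSpace ℝ (Fin d) → ℝ := fun x => ∑ i : Fin m, ‖x - b i.succ.succ‖^2
  have hq : Continuous q := by fun_prop
  obtain ⟨u, hu⟩ := triple_interior μ (μ.restrict (Metric.closedBall (b 0) δ)) (μ.restrict (Metric.closedBall (b 1) δ))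
    (IsProbabilityMeasure.ne_zero μ) (hpos 0) (hpos 1) E (E ∩ Metric.closedBall (b 0) δ) (E ∩ Metric.closedBall (b 1) δ)
    hE (hE.inter_right Metric.isClosed_closedBall) (hE.inter_right Metric.isClosed_closedBall)
    hμE (hres 0) (hres 1) C s hC (by linarith) hμ (hfr 0) (hfr 1) q hq
  set S := (Set.image (fun p : EuclideanSpace ℝ (Fin d) × EuclideanSpace ℝ (Fin d) × EuclideanSpace ℝ (Fin d) =>
      ‖p.1 - p.2.1‖^2 + ‖p.1 - p.2.2‖^2 + q p.1)
      (E ×ˢ (E ∩ Metric.closedBall (b 0) δ) ×ˢ (E ∩ Metric.closedBall (b 1) δ))) with hS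
  have hSnn : ∀ v ∈ S, 0 ≤ v := by
    rintro _ ⟨p, _, rfl⟩
    have : 0 ≤ q p.1 := Finset.sum_nonneg fun i _ => by positivity
    positivity
  obtain ⟨v, hv, hv0⟩ : ∃ v ∈ interior S, 0 < v := by
    obtain ⟨ε, hε, hball⟩ := Metric.isOpen_iff.1 isOpen_interior u hu
    have h0 := hSnn u (interior_subset hu)
    refine ⟨u + ε/2, hball ?_, by linarith⟩
    rw [Metric.mem_ball, Real.dist_eq]
    rw [abs_of_pos (by linarith)]; linarith
  refine ⟨Real.sqrt v, mem_interior.2 ⟨{t : ℝ | 0 < t ∧ t^2 ∈ interior S}, ?_, ?_, ?_⟩⟩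
  · rintro t ⟨ht0, ht⟩
    obtain ⟨⟨x, y₁, y₂⟩, ⟨hx, ⟨hy1, hy1'⟩, ⟨hy2, hy2'⟩⟩, hval⟩ := interior_subset ht
    let y : Fin (m + 2) → EuclideanSpace ℝ (Fin d) :=
      Fin.cons y₁ (Fin.cons y₂ (fun i : Fin m => b i.succ.succ))
    refine ⟨x, y, hx, ?_, hinj y ?_, ?_⟩
    · intro i
      refine Fin.cases hy1 (fun i => ?_) i
      refine Fin.cases hy2 (fun i => ?_) i
      exact hsub (hbs i.succ.succ)
    · intro i
      refine Fin.cases hy1' (fun i => ?_) i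
      refine Fin.cases hy2' (fun i => ?_) i
      exact Metric.mem_closedBall_self hδ.le
    · have hsum : ∑ i, ‖x - y i‖^2 = t^2 := by
        rw [← hval, Fin.sum_univ_succ, Fin.sum_univ_succ]
        simp only [y, q, Fin.cons_zero, Fin.cons_succ]
        ring
      rw [hsum, Real.sqrt_sq ht0.le]
  · exact (isOpen_lt continuous_const continuous_id).inter (isOpen_interior.preimage (by fun_prop : Continuous fun t : ℝ => t^2))
  · refine ⟨Real.sqrt_pos.2 hv0, ?_⟩
    rw [Real.sq_sqrt hv0.le]; exact hv
end
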